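/- arXiv:2312.04955 — 4 statements merged into one kernel-verified Lean document; each statement's English description precedes it below -/
import Mathlib

section
/- Let k ≥ 3, t ≥ k-1, q ≥ k-1, χ > C(q, k-1), and n ≥ 3(k-1) be integers with n ≡ 0 (mod k-1), where C(·,·) denotes the binomial coefficient. Let H be a k-graph whose vertex set is partitioned as A_1 ⊔ … ⊔ A_χ, where |A_i| > (χ-1)(k-2) + max{τ(k-1,t), q} for all i ∈ [χ-1] and |A_χ| = t, and whose edges are exactly those k-subsets e of the vertex set satisfying |e ∩ A_i| = k-1 for some i ∈ [χ]. Then R(C_{n,1}^{(k)}, H) > (χ-1)(n-1) + max{τ(k-1,t), q}. -/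
open scoped Classical

/-- There is a copy of the hypergraph with edge set `F` all of whose edges receive
colour `b` under the red/blue colouring `c` (`true` = red, `false` = blue) of the
complete hypergraph on the vertex type `V`. -/
def hasMonoCopy {V W : Type*} [DecidableEq V] [DecidableEq W]
    (c : Finset V → Bool) (b : Bool) (F : Finset (Finset W)) : Prop :=
  ∃ f : W → V, Function.Injective f ∧ ∀ e ∈ F, c (e.image f) = b

/-- The Ramsey number of a pair of hypergraphs: the least `N` such that every
red/blue colouring of the complete hypergraph on `N` vertices contains a red copy
of `G` or a blue copy of `H`. -/
noncomputable def ramseyNumber {V W : Type*} [DecidableEq V] [DecidableEq W]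
    (G : Finset (Finset V)) (H : Finset (Finset W)) : ℕ :=
  sInf {N : ℕ | ∀ c : Finset (Fin N) → Bool,
    hasMonoCopy c true G ∨ hasMonoCopy c false H}

/-- `E` is a `k`-uniform hypergraph: every edge has exactly `k` vertices. -/
def IsUniformHyp {V : Type*} (k : ℕ) (E : Finset (Finset V)) : Prop :=
  ∀ e ∈ E, e.card = k
/-- The edge set of the `k`-uniform `ℓ`-cycle on `n` vertices `0, …, n-1`
(for `n ≡ 0 (mod k-ℓ)`): the `i`-th edge consists of the vertices
`i(k-ℓ), …, i(k-ℓ)+k-1`, with indices taken modulo `n`. -/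
def ellCycleEdges (k ℓ n : ℕ) : Finset (Finset (Fin n)) :=
  (Finset.range (n / (k - ℓ))).image (fun i =>
    Finset.univ.filter (fun v : Fin n => ∃ j < k, (v : ℕ) = (i * (k - ℓ) + j) % n))
/-- The independence number of a hypergraph: the largest size of a vertex set
containing no edge. -/
noncomputable def indepNum {V : Type*} [Fintype V] (E : Finset (Finset V)) : ℕ :=
  Finset.sup (Finset.univ.filter (fun S : Finset V => ∀ e ∈ E, ¬ e ⊆ S)) Finset.card

/-- `E` contains no loose path of length two, i.e. no two (distinct) edges sharing
exactly one vertex. -/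
def NoLoosePathTwo {V : Type*} [DecidableEq V] (E : Finset (Finset V)) : Prop :=
  ∀ e ∈ E, ∀ f ∈ E, e ≠ f → (e ∩ f).card ≠ 1

/-- `τ(k, α)`: the largest `n` such that there is a `k`-uniform hypergraph on `n`
vertices with independence number less than `α` and no loose path of length two. -/
noncomputable def tauFn (k α : ℕ) : ℕ :=
  sSup {n : ℕ | ∃ E : Finset (Finset (Fin n)),
    IsUniformHyp k E ∧ indepNum E < α ∧ NoLoosePathTwo E}

theorem ramAux {α : Type} [DecidableEq α] (k : ℕ) : ∀ s t : ℕ, ∃ N : ℕ, ∀ V : Finset α, N ≤ V.card →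
    ∀ c : Finset α → Bool,
    (∃ S ⊆ V, S.card = s ∧ ∀ e ⊆ S, e.card = k → c e = true) ∨
    (∃ S ⊆ V, S.card = t ∧ ∀ e ⊆ S, e.card = k → c e = false) := by
  induction k with
  | zero =>
    intro s t
    refine ⟨max s t, fun V hV c => ?_⟩
    cases h : c ∅ with
    | true =>
      left
      obtain ⟨S, hS, hc⟩ := Finset.exists_subset_card_eq (le_trans (le_max_left s t) hV)
      refine ⟨S, hS, hc, fun e _ h0 => ?_⟩
      rw [Finset.card_eq_zero.mp h0, h]
    | false =>
      right
      obtain ⟨S, hS, hc⟩ := Finset.exists_subset_card_eq (le_trans (le_max_right s t) hV)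
      refine ⟨S, hS, hc, fun e _ h0 => ?_⟩
      rw [Finset.card_eq_zero.mp h0, h]
  | succ k ih =>
    have key : ∀ d s t : ℕ, s + t = d → ∃ N : ℕ, ∀ V : Finset α, N ≤ V.card →
        ∀ c : Finset α → Bool,
        (∃ S ⊆ V, S.card = s ∧ ∀ e ⊆ S, e.card = k + 1 → c e = true) ∨
        (∃ S ⊆ V, S.card = t ∧ ∀ e ⊆ S, e.card = k + 1 → c e = false) := by
      intro d
      induction d with
      | zero =>
        intro s t hst
        obtain rfl : s = 0 := by omega
        refine ⟨0, fun V _ c => Or.inl ⟨∅, by simp, by simp, ?_⟩⟩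
        intro e he hc
        rw [Finset.subset_empty.mp he] at hc; simp at hc
      | succ d ihd =>
        intro s t hst
        rcases s with _ | s
        · refine ⟨0, fun V _ c => Or.inl ⟨∅, by simp, by simp, ?_⟩⟩
          intro e he hc
          rw [Finset.subset_empty.mp he] at hc; simp at hc
        rcases t with _ | t
        · refine ⟨0, fun V _ c => Or.inr ⟨∅, by simp, by simp, ?_⟩⟩
          intro e he hc
          rw [Finset.subset_empty.mp he] at hc; simp at hc
        obtain ⟨N1, h1⟩ := ihd s (t+1) (by omega)
        obtain ⟨N2, h2⟩ := ihd (s+1) t (by omega)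
        obtain ⟨N3, h3⟩ := ih N1 N2
        have ext : ∀ (b : Bool) (c : Finset α → Bool) (v : α) (S' S : Finset α), v ∉ S → S ⊆ S' →
            (∀ e ⊆ S', e.card = k → c (insert v e) = b) →
            (∀ e ⊆ S, e.card = k + 1 → c e = b) →
            ∀ e ⊆ insert v S, e.card = k + 1 → c e = b := by
          intro b c v S' S hv hSS h4 h5 e he hec
          by_cases hve : v ∈ e
          · rw [← Finset.insert_erase hve]
            apply h4
            · exact (Finset.erase_subset_iff_of_mem (Finset.mem_insert_self v S) |>.mpr he |> fun h => by
                intro x hx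
                have := he (Finset.mem_of_mem_erase hx)
                rcases Finset.mem_insert.mp this with h | h
                · exact absurd h (Finset.ne_of_mem_erase hx)
                · exact hSS h)
            · rw [Finset.card_erase_of_mem hve, hec]; rfl
          · exact h5 e ((Finset.subset_insert_iff_of_notMem hve).mp he) hec
        refine ⟨N3 + 1, fun V hV c => ?_⟩
        obtain ⟨v, hv⟩ : V.Nonempty := Finset.card_pos.mp (by omega)
        have hcv := Finset.card_erase_of_mem hv
        rcases h3 (V.erase v) (by omega) (fun e => c (insert v e)) with ⟨S', hS', hc', h4⟩ | ⟨S', hS', hc', h4⟩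
        · rcases h1 S' (by omega) c with ⟨S, hS, hc, h5⟩ | ⟨S, hS, hc, h5⟩
          · left
            have hvS : v ∉ S := fun h => by simpa using hS' (hS h)
            refine ⟨insert v S, ?_, by rw [Finset.card_insert_of_notMem hvS, hc], ext true c v S' S hvS hS h4 h5⟩
            exact Finset.insert_subset hv ((hS.trans hS').trans (Finset.erase_subset _ _))
          · right
            exact ⟨S, (hS.trans hS').trans (Finset.erase_subset _ _), hc, h5⟩
        · rcases h2 S' (by omega) c with ⟨S, hS, hc, h5⟩ | ⟨S, hS, hc, h5⟩
          · left
            exact ⟨S, (hS.trans hS').trans (Finset.erase_subset _ _), hc, h5⟩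
          · right
            have hvS : v ∉ S := fun h => by simpa using hS' (hS h)
            refine ⟨insert v S, ?_, by rw [Finset.card_insert_of_notMem hvS, hc], ext false c v S' S hvS hS h4 h5⟩
            exact Finset.insert_subset hv ((hS.trans hS').trans (Finset.erase_subset _ _))
    intro s t
    exact key _ s t rfl

theorem ramseyNonempty {n m k : ℕ} (G : Finset (Finset (Fin n))) (H : Finset (Finset (Fin m)))
    (hG : ∀ e ∈ G, e.card = k) (hH : ∀ e ∈ H, e.card = k) :
    ∃ N : ℕ, ∀ c : Finset (Fin N) → Bool, hasMonoCopy c true G ∨ hasMonoCopy c false H := by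
  obtain ⟨N, hN⟩ := ramAux (α := ℕ) k n m
  refine ⟨N, fun c => ?_⟩
  have main : ∀ (r : ℕ) (b : Bool) (F : Finset (Finset (Fin r))), (∀ e ∈ F, e.card = k) →
      (∃ S ⊆ Finset.range N, S.card = r ∧ ∀ e ⊆ S, e.card = k →
        c (Finset.univ.filter (fun x : Fin N => (x : ℕ) ∈ e)) = b) → hasMonoCopy c b F := by
    rintro r b F hF ⟨S, hS, hc, h⟩
    let f := S.orderEmbOfFin hc
    have hfS : ∀ x, f x ∈ S := fun x => Finset.orderEmbOfFin_mem S hc x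
    have hf : ∀ x, f x < N := fun x => Finset.mem_range.mp (hS (hfS x))
    refine ⟨fun x => ⟨f x, hf x⟩, ?_, ?_⟩
    · intro x y hxy
      exact f.injective (by simpa using hxy)
    · intro e he
      have := h (e.image f) ?_ ?_
      · rw [← this]; congr 1; ext x; simp [Fin.ext_iff]
      · intro x hx
        obtain ⟨y, _, rfl⟩ := Finset.mem_image.mp hx
        exact hfS y
      · rw [Finset.card_image_of_injective _ f.injective, hF e he]
  rcases hN (Finset.range N) (by simp) (fun e => c (Finset.univ.filter (fun x : Fin N => (x : ℕ) ∈ e))) with h | h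
  · exact Or.inl (main n true G hG h)
  · exact Or.inr (main m false H hH h)

theorem ramseyTransfer {V W W' : Type*} [DecidableEq V] [Fintype V] [DecidableEq W] [DecidableEq W']
    (G : Finset (Finset W)) (H : Finset (Finset W')) {N : ℕ}
    (h : ∀ c : Finset (Fin N) → Bool, hasMonoCopy c true G ∨ hasMonoCopy c false H)
    (hN : N ≤ Fintype.card V) (c : Finset V → Bool) :
    hasMonoCopy c true G ∨ hasMonoCopy c false H := by
  obtain ⟨φ⟩ : Nonempty (Fin N ↪ V) := Function.Embedding.nonempty_of_card_le (by simpa using hN)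
  rcases h (fun e => c (e.image φ)) with ⟨f, hf, h⟩ | ⟨f, hf, h⟩
  · left
    refine ⟨φ ∘ f, φ.injective.comp hf, fun e he => ?_⟩
    rw [← h e he]; simp only [Finset.image_image]
  · right
    refine ⟨φ ∘ f, φ.injective.comp hf, fun e he => ?_⟩
    rw [← h e he]; simp only [Finset.image_image]

theorem cycleStruct {V : Type*} [DecidableEq V] {k m n : ℕ} (hk : 3 ≤ k) (hm : 3 ≤ m)
    (hn : n = m * (k - 1)) (g : Fin n → V) (hg : Function.Injective g) (P : Finset V → Prop)
    (hP : ∀ e ∈ ellCycleEdges k 1 n, P (e.image g)) :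
    ∃ (e : ℕ → Finset V) (p z : ℕ → V), (∀ i, P (e i)) ∧ (∀ i, (e i).card = k) ∧
      (∀ i, e i ∩ e (i+1) = {p (i+1)}) ∧ (∀ i, p i ≠ p (i+1)) ∧ (∀ i, p i ∈ e i) ∧
      (∀ i, z i ∈ e i ∧ z i ≠ p i ∧ z i ≠ p (i+1)) ∧
      (∀ i i', z i ∈ e i' → e i' = e i ∧ p i' = p i) ∧
      (∀ i, e (i + m) = e i ∧ p (i + m) = p i) ∧ (∀ x : Fin n, ∃ i < m, g x ∈ e i) := by
  obtain ⟨K, rfl⟩ : ∃ K, k = K + 1 := ⟨k - 1, by omega⟩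
  simp only [Nat.add_sub_cancel] at hn
  have hn3 : 3 * K ≤ n := by rw [hn]; exact Nat.mul_le_mul_right K hm
  have hn0 : 0 < n := by omega
  let G : ℕ → V := fun x => g ⟨x % n, Nat.mod_lt _ hn0⟩
  have hG : ∀ x y, G x = G y ↔ x ≡ y [MOD n] := by
    intro x y
    constructor
    · intro h; have := hg h; simpa [Nat.ModEq] using this
    · intro h; simp only [G]; congr 2
  have hGa : ∀ i x y, x < n → y < n → G (i + x) = G (i + y) → x = y := by
    intro i x y hx hy h
    have := Nat.ModEq.add_left_cancel' i ((hG _ _).mp h)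
    exact Nat.ModEq.eq_of_lt_of_lt this hx hy
  let e : ℕ → Finset V := fun i => (Finset.range (K+1)).image (fun j => G (i * K + j))
  have he : ∀ i x, x ∈ e i ↔ ∃ j < K + 1, G (i * K + j) = x := by
    intro i x; simp [e]
  have hper : ∀ i j, G ((i + m) * K + j) = G (i * K + j) := by
    intro i j
    rw [hG]
    have : (i + m) * K + j = i * K + j + n := by rw [hn]; ring
    rw [this]; simp [Nat.ModEq]
  have hcong : ∀ i i', i ≡ i' [MOD m] → ∀ j, G (i * K + j) = G (i' * K + j) := by
    intro i i' h j
    rw [hG, hn]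
    exact Nat.ModEq.add_right j (Nat.ModEq.mul_right' K h)
  have hecong : ∀ i i', i ≡ i' [MOD m] → e i = e i' := by
    intro i i' h
    simp only [e, hcong i i' h]
  refine ⟨e, fun i => G (i * K), fun i => G (i * K + 1), ?_, ?_, ?_, ?_, ?_, ?_, ?_, ?_, ?_⟩
  · intro i
    have hmi : i % m < m := Nat.mod_lt _ (by omega)
    have := hP (Finset.univ.filter (fun v : Fin n => ∃ j < K + 1, (v : ℕ) = ((i % m) * (K + 1 - 1) + j) % n)) ?_
    · rw [hecong i (i % m) (Nat.mod_modEq i m).symm]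
      convert this using 1
      ext x
      rw [he]
      simp only [Nat.add_sub_cancel, Finset.mem_image, Finset.mem_filter, Finset.mem_univ, true_and]
      constructor
      · rintro ⟨j, hj, rfl⟩
        exact ⟨⟨_, Nat.mod_lt _ hn0⟩, ⟨j, hj, rfl⟩, rfl⟩
      · rintro ⟨v, ⟨j, hj, hv⟩, rfl⟩
        refine ⟨j, hj, ?_⟩
        simp only [G]; congr 1; exact Fin.ext hv.symm
    · unfold ellCycleEdges
      refine Finset.mem_image.mpr ⟨i % m, ?_, rfl⟩
      have : n / (K + 1 - 1) = m := by
        rw [hn, Nat.add_sub_cancel]; exact Nat.mul_div_cancel _ (by omega)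
      rw [this]; simpa using hmi
  · intro i
    rw [Finset.card_image_of_injOn]
    · simp
    · intro x hx y hy h
      simp at hx hy
      exact hGa _ _ _ (by omega) (by omega) h
  · intro i
    ext x
    rw [Finset.mem_inter, he, he, Finset.mem_singleton]
    have hs : ∀ j, (i + 1) * K + j = i * K + (K + j) := by intro j; ring
    constructor
    · rintro ⟨⟨j, hj, rfl⟩, ⟨j', hj', h⟩⟩
      rw [hs] at h
      have := hGa _ _ _ (by omega) (by omega) h
      have hj0 : j = K := by omega
      subst hj0
      congr 1; ring
    · rintro rfl
      exact ⟨⟨K, by omega, by congr 1; ring⟩, ⟨0, by omega, rfl⟩⟩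
  · intro i h
    have : G (i * K + 0) = G (i * K + K) := by
      simp only [] at h
      rw [add_zero, h]; congr 1; ring
    have := hGa _ _ _ (by omega) (by omega) this
    omega
  · intro i; exact (he _ _).mpr ⟨0, by omega, rfl⟩
  · intro i
    refine ⟨(he _ _).mpr ⟨1, by omega, rfl⟩, ?_, ?_⟩
    · intro h
      have := hGa (i * K) 1 0 (by omega) (by omega) h
      omega
    · intro h
      have := hGa (i * K) 1 K (by omega) (by omega) (h.trans (by simp only []; congr 1; ring))
      omega
  · intro i i' h
    obtain ⟨j, hj, h⟩ := (he _ _).mp h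
    rw [hG] at h
    have h2 : i' * K + j ≡ i * K + 1 [MOD K] := h.of_dvd (by rw [hn]; exact dvd_mul_left _ _)
    have h3 : j ≡ 1 [MOD K] := by
      have a1 : i' * K + j ≡ j [MOD K] := by simp [Nat.ModEq]
      have a2 : i * K + 1 ≡ 1 [MOD K] := by simp [Nat.ModEq]
      exact a1.symm.trans (h2.trans a2)
    have hj1 : j = 1 := by
      rcases Nat.lt_or_ge j K with hlt | hge
      · exact Nat.ModEq.eq_of_lt_of_lt h3 hlt (by omega)
      · obtain rfl : j = K := by omega
        have : 0 ≡ 1 [MOD j] := by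
          have : j ≡ 0 [MOD j] := by simp [Nat.ModEq]
          exact this.symm.trans h3
        have := Nat.ModEq.eq_of_lt_of_lt this (by omega) (by omega)
        omega
    subst hj1
    have h4 := Nat.ModEq.add_right_cancel' 1 h
    rw [hn] at h4
    have h5 := Nat.ModEq.mul_right_cancel' (by omega : K ≠ 0) h4
    exact ⟨hecong _ _ h5, by simpa using hcong _ _ h5 0⟩
  · intro i
    exact ⟨hecong _ _ (by simp [Nat.ModEq]), by simpa using hper i 0⟩
  · intro x
    refine ⟨x / K, ?_, (he _ _).mpr ⟨x % K, ?_, ?_⟩⟩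
    · rw [Nat.div_lt_iff_lt_mul (by omega), ← hn]; exact x.2
    · have := Nat.mod_lt (x : ℕ) (by omega : 0 < K); omega
    · simp only [G]
      congr 1
      ext
      simp only []
      rw [Nat.div_add_mod' (x:ℕ) K, Nat.mod_eq_of_lt x.2]

theorem cycleEdgeCard {k n : ℕ} (hn : k ≤ n) (hn0 : 0 < n) :
    ∀ e ∈ ellCycleEdges k 1 n, e.card = k := by
  intro e he
  unfold ellCycleEdges at he
  obtain ⟨i, _, rfl⟩ := Finset.mem_image.mp he
  have : (Finset.univ.filter (fun v : Fin n => ∃ j < k, (v : ℕ) = (i * (k - 1) + j) % n))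
      = (Finset.range k).image (fun j => (⟨(i * (k - 1) + j) % n, Nat.mod_lt _ hn0⟩ : Fin n)) := by
    ext v
    simp only [Finset.mem_filter, Finset.mem_univ, true_and, Finset.mem_image, Finset.mem_range]
    constructor
    · rintro ⟨j, hj, h⟩; exact ⟨j, hj, Fin.ext h.symm⟩
    · rintro ⟨j, hj, rfl⟩; exact ⟨j, hj, rfl⟩
  rw [this, Finset.card_image_of_injOn]
  · simp
  · intro x hx y hy h
    simp at hx hy
    have h2 : i * (k - 1) + x ≡ i * (k - 1) + y [MOD n] := by simpa [Nat.ModEq] using h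
    exact Nat.ModEq.eq_of_lt_of_lt (Nat.ModEq.add_left_cancel' _ h2) (by omega) (by omega)

/-- edge inside the block `j` -/
def isVE {a b M : ℕ} (e : Finset ((Fin a × Fin b) ⊕ Fin M)) (j : Fin a) : Prop :=
  ∀ x ∈ e, ∃ y, x = Sum.inl (j, y)

/-- the colouring -/
noncomputable def colr {a b M : ℕ} (R : Finset (Fin M) → Fin a → Prop)
    (e : Finset ((Fin a × Fin b) ⊕ Fin M)) : Bool :=
  decide ((∃ j, isVE e j) ∨
    ∃ f j y, R f j ∧ e = insert (Sum.inl (j, y)) (f.image Sum.inr))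

theorem notAllV {a b M n m : ℕ} (hb : b < n) (e : ℕ → Finset ((Fin a × Fin b) ⊕ Fin M))
    (p : ℕ → (Fin a × Fin b) ⊕ Fin M)
    (h2 : ∀ i, e i ∩ e (i+1) = {p (i+1)}) (g : Fin n → (Fin a × Fin b) ⊕ Fin M)
    (hg : Function.Injective g) (hcov : ∀ x : Fin n, ∃ i < m, g x ∈ e i)
    (hV : ∀ i, ∃ j, isVE (e i) j) : False := by
  obtain ⟨j, hj⟩ := hV 0
  have hall : ∀ i, isVE (e i) j := by
    intro i
    induction i with
    | zero => exact hj
    | succ i ih =>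
      obtain ⟨j', hj'⟩ := hV (i+1)
      have hp : p (i+1) ∈ e i ∩ e (i+1) := by rw [h2]; simp
      rw [Finset.mem_inter] at hp
      obtain ⟨y, hy⟩ := ih _ hp.1
      obtain ⟨y', hy'⟩ := hj' _ hp.2
      rw [hy] at hy'
      have : j = j' := by
        have := Sum.inl.inj hy'
        exact (Prod.mk.inj this).1
      rw [this]; exact hj'
  have hx : ∀ x : Fin n, ∃ y : Fin b, g x = Sum.inl (j, y) := by
    intro x
    obtain ⟨i, _, hi⟩ := hcov x
    exact hall i _ hi
  choose u hu using hx
  have hinj : Function.Injective u := by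
    intro x x' h
    apply hg
    rw [hu, hu, h]
  have := Fintype.card_le_of_injective u hinj
  simp at this
  omega

theorem noRed1 {a b M k m n : ℕ} (hk : 3 ≤ k) (hm : 3 ≤ m) (hn : n = m * (k - 1)) (hb : b < n)
    (E : Finset (Finset (Fin M))) (hE : IsUniformHyp (k-1) E) (hL : NoLoosePathTwo E) :
    ¬ hasMonoCopy (colr (a := a) (b := b) (fun f _ => f ∈ E)) true (ellCycleEdges k 1 n) := by
  rintro ⟨g, hg, hred⟩
  obtain ⟨e, p, z, hP, hcard, hint, hp, hpe, hz, hzz, hper, hcov⟩ :=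
    cycleStruct hk hm hn g hg (fun e => colr (a := a) (b := b) (fun f _ => f ∈ E) e = true) hred
  simp only [colr, decide_eq_true_eq] at hP
  have aux : ∀ (f : Finset (Fin M)) (v : Fin a × Fin b) i x, f ∈ E →
      insert (Sum.inl v) (f.image Sum.inr) ∩ e i = {x} → x = Sum.inl v := by
    intro f v i x hf h
    have hx : x ∈ insert (Sum.inl v) (f.image Sum.inr) ∩ e i := by rw [h]; simp
    rw [Finset.mem_inter, Finset.mem_insert, Finset.mem_image] at hx
    rcases hx with ⟨hx | ⟨w, hw, rfl⟩, hxe⟩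
    · exact hx
    exfalso
    rcases hP i with ⟨j, hj⟩ | ⟨f', j', y', hf', he'⟩
    · obtain ⟨y, hy⟩ := hj _ hxe
      cases hy
    · rw [he'] at h hxe
      have hw' : w ∈ f' := by simpa using hxe
      have hff : f ∩ f' = {w} := by
        ext u
        rw [Finset.mem_inter, Finset.mem_singleton]
        constructor
        · rintro ⟨h1, h2⟩
          have : (Sum.inr u : (Fin a × Fin b) ⊕ Fin M) ∈ insert (Sum.inl v) (f.image Sum.inr) ∩
              insert (Sum.inl (j', y')) (f'.image Sum.inr) := by
            simp [h1, h2]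
          rw [h] at this
          simpa using this
        · rintro rfl; exact ⟨hw, hw'⟩
      have hne : f ≠ f' := by
        rintro rfl
        rw [Finset.inter_self] at hff
        have := hE f hf
        rw [hff] at this
        simp at this; omega
      exact hL f hf f' hf' hne (by rw [hff]; simp)
  refine notAllV hb e p hint g hg hcov ?_
  have key : ∀ i, ∃ j, isVE (e (i+1)) j := by
    intro i
    rcases hP (i+1) with h | ⟨f, j, y, hf, he⟩
    · exact h
    exfalso
    have h1 := hint i
    have h2 := hint (i+1)
    rw [Finset.inter_comm, he] at h1
    rw [he] at h2
    have h1 := aux _ _ _ _ hf h1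
    have h2 := aux _ _ _ _ hf h2
    exact hp (i+1) (h1.trans h2.symm)
  intro i
  have := key (i + (m-1))
  rwa [show i + (m-1) + 1 = i + m by omega, (hper i).1] at this

theorem noRed2 {a b M k m n : ℕ} (hk : 3 ≤ k) (hm : 3 ≤ m) (hn : n = m * (k - 1)) (hb : b < n)
    (R : Finset (Fin M) → Fin a → Prop) (hR : ∀ f j, R f j → f.card = k - 1)
    (hRi : ∀ f f' j, R f j → R f' j → f = f') (hM : (∃ f j, R f j) → 2 * M < n) :
    ¬ hasMonoCopy (colr (b := b) R) true (ellCycleEdges k 1 n) := by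
  rintro ⟨g, hg, hred⟩
  obtain ⟨e, p, z, hP, hcard, hint, hp, hpe, hz, hzz, hper, hcov⟩ :=
    cycleStruct hk hm hn g hg (fun e => colr (b := b) R e = true) hred
  simp only [colr, decide_eq_true_eq] at hP
  by_cases hall : ∀ i, ∃ j, isVE (e i) j
  · exact notAllV hb e p hint g hg hcov hall
  push Not at hall
  obtain ⟨i0, hi0⟩ := hall
  have hp' : ∀ i, p (i+1) ∈ e i ∧ p (i+1) ∈ e (i+1) := by
    intro i
    have : p (i+1) ∈ e i ∩ e (i+1) := by rw [hint]; simp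
    simpa using this
  have hperm : ∀ i s, e (i + s * m) = e i ∧ p (i + s * m) = p i := by
    intro i s
    induction s with
    | zero => simp
    | succ s ih =>
      rw [show i + (s+1) * m = i + s * m + m by ring]
      exact ⟨(hper _).1.trans ih.1, (hper _).2.trans ih.2⟩
  have step : ∀ i, (∃ f j y, R f j ∧ e i = insert (Sum.inl (j, y)) (f.image Sum.inr)) →
      (∃ f j y, R f j ∧ e (i+1) = insert (Sum.inl (j, y)) (f.image Sum.inr)) := by
    rintro i ⟨f, j, y, hf, he⟩
    rcases hP (i+1) with ⟨j', hj'⟩ | h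
    swap
    · exact h
    exfalso
    -- p (i+1) is the outside vertex
    have hpi : p (i+1) = Sum.inl (j, y) := by
      obtain ⟨y', hy'⟩ := hj' _ (hp' i).2
      have := (hp' i).1
      rw [hy', he] at this
      rw [hy']
      simpa using this
    have hjj : j' = j := by
      obtain ⟨y', hy'⟩ := hj' _ (hp' i).2
      rw [hpi] at hy'
      exact ((Prod.mk.inj (Sum.inl.inj hy')).1).symm
    subst hjj
    have hex : ∃ s, ¬ isVE (e (i + 1 + s)) j' := by
      refine ⟨m - 1, fun h => ?_⟩
      rw [show i + 1 + (m-1) = i + m by omega, (hper i).1] at h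
      have hfc := hR _ _ hf
      obtain ⟨w, hw⟩ : f.Nonempty := Finset.card_pos.mp (by omega)
      obtain ⟨y', hy'⟩ := h (Sum.inr w) (by rw [he]; simp [hw])
      cases hy'
    obtain ⟨s, hs, hmin⟩ : ∃ s, ¬ isVE (e (i + 1 + s)) j' ∧ ∀ r < s, isVE (e (i+1+r)) j' := by
      refine ⟨Nat.find hex, Nat.find_spec hex, fun r hr => ?_⟩
      have := Nat.find_min hex hr
      simpa using this
    rcases s with _ | s
    · exact hs hj'
    have hpre := hmin s (by omega)
    have hps := hp' (i + 1 + s)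
    obtain ⟨y2, hy2⟩ := hpre _ hps.1
    rcases hP (i+1+(s+1)) with ⟨j3, hj3⟩ | ⟨f3, j3, y3, hf3, he3⟩
    · obtain ⟨y3, hy3⟩ := hj3 _ hps.2
      rw [hy2] at hy3
      have : j' = j3 := (Prod.mk.inj (Sum.inl.inj hy3)).1
      subst this
      exact hs hj3
    · have h3 := hps.2
      rw [← add_assoc] at he3
      rw [hy2, he3] at h3
      have h3' : j' = j3 := by
        have : j' = j3 ∧ y2 = y3 := by simpa using h3
        exact this.1
      subst h3'
      have hff := hRi _ _ _ hf hf3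
      subst hff
      -- z i ∈ f
      have hzi := hz i
      have hzf : z i ∈ e (i + 1 + s + 1) := by
        rw [he3]
        have h4 := hzi.1
        rw [he, Finset.mem_insert] at h4
        rcases h4 with h4 | h4
        · exact absurd (h4.trans hpi.symm) hzi.2.2
        · exact Finset.mem_insert_of_mem h4
      have h5 := (hzz _ _ hzf).2
      have h6 := hpe i
      rw [← h5, hy2, he] at h6
      have h7 : (Sum.inl (j', y2) : (Fin a × Fin b) ⊕ Fin M) = Sum.inl (j', y) := by
        simpa using h6
      exact hp i (by rw [← h5, hy2, h7, hpi])
  have hF0 : ∃ f j y, R f j ∧ e i0 = insert (Sum.inl (j, y)) (f.image Sum.inr) := by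
    rcases hP i0 with ⟨j, hj⟩ | h
    · exact absurd hj (hi0 j)
    · exact h
  have hFs : ∀ s, ∃ f j y, R f j ∧ e (i0 + s) = insert (Sum.inl (j, y)) (f.image Sum.inr) := by
    intro s
    induction s with
    | zero => exact hF0
    | succ s ih => exact step _ ih
  have hF : ∀ i, ∃ f j y, R f j ∧ e i = insert (Sum.inl (j, y)) (f.image Sum.inr) := by
    intro i
    have hle : i0 ≤ i + i0 * m := by nlinarith
    have := hFs (i + i0 * m - i0)
    rwa [show i0 + (i + i0 * m - i0) = i + i0 * m by omega, (hperm i i0).1] at this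
  have h2M : 2 * M < n := hM (by obtain ⟨f, j, _, h, _⟩ := hF 0; exact ⟨f, j, h⟩)
  choose f j y hf he using hF
  have hsub : Finset.univ.image g ⊆
      (Finset.range m).image (fun i => Sum.inl (j i, y i)) ∪ Finset.univ.image Sum.inr := by
    intro x hx
    obtain ⟨x, _, rfl⟩ := Finset.mem_image.mp hx
    obtain ⟨i, hi, hxi⟩ := hcov x
    rw [he, Finset.mem_insert, Finset.mem_image] at hxi
    rw [Finset.mem_union]
    rcases hxi with h | ⟨w, _, h⟩
    · left; rw [h]; exact Finset.mem_image.mpr ⟨i, by simpa using hi, rfl⟩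
    · right; rw [← h]; simp
  have h1 := Finset.card_le_card hsub
  rw [Finset.card_image_of_injective _ hg] at h1
  have h2 := Finset.card_union_le ((Finset.range m).image (fun i => (Sum.inl (j i, y i) : (Fin a × Fin b) ⊕ Fin M))) (Finset.univ.image Sum.inr)
  have h3 := Finset.card_image_le (s := Finset.range m) (f := fun i => (Sum.inl (j i, y i) : (Fin a × Fin b) ⊕ Fin M))
  have h4 := Finset.card_image_le (s := (Finset.univ : Finset (Fin M))) (f := (Sum.inr : Fin M → (Fin a × Fin b) ⊕ Fin M))
  simp only [Finset.card_univ, Fintype.card_fin, Finset.card_range] at h1 h2 h3 h4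
  have h5 : m * 2 ≤ n := by rw [hn]; exact Nat.mul_le_mul_left m (by omega)
  omega

theorem blueCopy {a b M k t nH : ℕ} (hk : 3 ≤ k) (ha : 0 < a) (R : Finset (Fin M) → Fin a → Prop)
    (H : Finset (Finset (Fin nH))) (part : Fin nH → Fin (a + 1))
    (hA : ∀ i : Fin a, a * (k - 2) + M <
        (Finset.univ.filter (fun v => part v = i.castSucc)).card)
    (hlast : (Finset.univ.filter (fun v => part v = Fin.last a)).card = t)
    (hedges : ∀ e : Finset (Fin nH), e ∈ H ↔
      (e.card = k ∧ ∃ i : Fin (a + 1), (e.filter (fun v => part v = i)).card = k - 1))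
    (hcopy : hasMonoCopy (colr (b := b) R) false H) :
    ∃ T : Finset (Fin M), T.card = t ∧ (∀ f ⊆ T, f.card = k - 1 → ∀ j, ¬ R f j) ∧
      a * (k - 2) + t < b := by
  obtain ⟨h, hh, hblue⟩ := hcopy
  -- basic edges
  have hedge : ∀ (S : Finset (Fin nH)) (i : Fin (a+1)) (x : Fin nH), S.card = k - 1 →
      (∀ v ∈ S, part v = i) → part x ≠ i → insert x S ∈ H := by
    intro S i x hS hSi hx
    rw [hedges]
    have hxS : x ∉ S := fun hxS => hx (hSi x hxS)
    refine ⟨by rw [Finset.card_insert_of_notMem hxS, hS]; omega, i, ?_⟩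
    rw [Finset.filter_insert, if_neg hx, Finset.filter_true_of_mem hSi, hS]
  have hW : ∀ S : Finset (Fin nH), (∀ v ∈ S, ∃ w, h v = Sum.inr w) → S.card ≤ M := by
    intro S hS
    have h1 : S.image h ⊆ Finset.univ.image Sum.inr := by
      intro x hx
      obtain ⟨v, hv, rfl⟩ := Finset.mem_image.mp hx
      obtain ⟨w, hw⟩ := hS v hv
      rw [hw]; simp
    have h2 := Finset.card_le_card h1
    rw [Finset.card_image_of_injective _ hh, Finset.card_image_of_injective _ Sum.inr_injective] at h2
    simpa using h2
  have hVb : ∀ (S : Finset (Fin nH)) (j : Fin a), (∀ v ∈ S, ∃ y, h v = Sum.inl (j, y)) →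
      S.card ≤ b := by
    intro S j hS
    have h1 : S.image h ⊆ Finset.univ.image (fun y : Fin b => Sum.inl (j, y)) := by
      intro x hx
      obtain ⟨v, hv, rfl⟩ := Finset.mem_image.mp hx
      obtain ⟨w, hw⟩ := hS v hv
      rw [hw]; simp
    have h2 := (Finset.card_le_card h1).trans Finset.card_image_le
    rw [Finset.card_image_of_injective _ hh] at h2
    simpa using h2
  let B : Fin a → Fin (a+1) → Finset (Fin nH) := fun j i =>
    Finset.univ.filter (fun v => part v = i ∧ ∃ y, h v = Sum.inl (j, y))
  let C : Fin (a+1) → Finset (Fin nH) := fun i =>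
    Finset.univ.filter (fun v => part v = i ∧ ∃ w, h v = Sum.inr w)
  have hpig : ∀ i : Fin a, ∃ j, k - 1 ≤ (B j i.castSucc).card := by
    intro i
    by_contra hcon
    push Not at hcon
    have hsub : Finset.univ.filter (fun v => part v = i.castSucc) ⊆
        C i.castSucc ∪ Finset.univ.biUnion (fun j => B j i.castSucc) := by
      intro v hv
      have hv : part v = i.castSucc := by simpa using hv
      rw [Finset.mem_union]
      rcases hx : h v with ⟨j, y⟩ | w
      · right; simp [B, hv, hx]
      · left; simp [C, hv, hx]
    have h1 := (Finset.card_le_card hsub).trans (Finset.card_union_le _ _)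
    have h2 : (Finset.univ.biUnion (fun j => B j i.castSucc)).card ≤ (Finset.univ : Finset (Fin a)).card * (k - 2) :=
      Finset.card_biUnion_le_card_mul _ _ _ (fun j _ => by have := hcon j; omega)
    have h3 := hW (C i.castSucc) (fun v hv => by simp only [C, Finset.mem_filter] at hv; exact hv.2.2)
    have h4 := hA i
    simp only [Finset.card_univ, Fintype.card_fin] at h2
    omega
  choose φ hφ using hpig
  have hX : ∀ (i : Fin a) (x : Fin nH) y, h x = Sum.inl (φ i, y) → part x = i.castSucc := by
    intro i x y hx
    by_contra hne
    obtain ⟨S, hS, hSc⟩ := Finset.exists_subset_card_eq (hφ i)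
    have hS' : ∀ v ∈ S, part v = i.castSucc ∧ ∃ y, h v = Sum.inl (φ i, y) := by
      intro v hv; have := hS hv; simpa [B] using this
    have h1 := hblue _ (hedge S i.castSucc x hSc (fun v hv => (hS' v hv).1) hne)
    have h2 : colr (b := b) R ((insert x S).image h) = true := by
      rw [colr, decide_eq_true_eq]
      left
      refine ⟨φ i, fun u hu => ?_⟩
      obtain ⟨v, hv, rfl⟩ := Finset.mem_image.mp hu
      rcases Finset.mem_insert.mp hv with rfl | hv
      · exact ⟨y, hx⟩
      · exact (hS' v hv).2
    rw [h1] at h2; cases h2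
  have hex : ∀ i : Fin a, ∃ x y, part x = i.castSucc ∧ h x = Sum.inl (φ i, y) := by
    intro i
    have h1 := hφ i
    obtain ⟨x, hx⟩ : (B (φ i) i.castSucc).Nonempty := Finset.card_pos.mp (by omega)
    simp only [B, Finset.mem_filter] at hx
    obtain ⟨_, h1, y, h2⟩ := hx
    exact ⟨x, y, h1, h2⟩
  have hφi : Function.Injective φ := by
    intro i i' hii
    obtain ⟨x, y, h1, h2⟩ := hex i'
    rw [← hii] at h2
    have h3 := hX i x y h2
    rw [h1] at h3
    exact (Fin.castSucc_injective a h3).symm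
  have hφs : Function.Surjective φ := Finite.injective_iff_surjective.mp hφi
  have hlastW : ∀ x, part x = Fin.last a → ∃ w, h x = Sum.inr w := by
    intro x hx
    rcases hhx : h x with ⟨j, y⟩ | w
    · exfalso
      obtain ⟨i, rfl⟩ := hφs j
      have := hX i x y hhx
      rw [hx] at this
      exact absurd this.symm (Fin.castSucc_lt_last i).ne
    · exact ⟨w, rfl⟩
  let L := Finset.univ.filter (fun v => part v = Fin.last a)
  let T : Finset (Fin M) := Finset.univ.filter (fun w => ∃ v, part v = Fin.last a ∧ h v = Sum.inr w)
  have hTL : T.image Sum.inr = L.image h := by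
    ext u
    simp only [T, L, Finset.mem_image, Finset.mem_filter, Finset.mem_univ, true_and]
    constructor
    · rintro ⟨w, ⟨v, hv, hw⟩, rfl⟩; exact ⟨v, hv, hw⟩
    · rintro ⟨v, hv, rfl⟩
      obtain ⟨w, hw⟩ := hlastW v hv
      exact ⟨w, ⟨v, hv, hw⟩, hw.symm⟩
  refine ⟨T, ?_, ?_, ?_⟩
  · have := congrArg Finset.card hTL
    rw [Finset.card_image_of_injective _ hh, Finset.card_image_of_injective _ Sum.inr_injective] at this
    rw [this, ← hlast]
  · intro f hf hfc j hRf
    obtain ⟨i, rfl⟩ := hφs j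
    obtain ⟨x, y, hx, hxy⟩ := hex i
    let S := Finset.univ.filter (fun v => ∃ w ∈ f, h v = Sum.inr w)
    have hSf : S.image h = f.image Sum.inr := by
      ext u
      simp only [S, Finset.mem_image, Finset.mem_filter, Finset.mem_univ, true_and]
      constructor
      · rintro ⟨v, ⟨w, hw, hv⟩, rfl⟩; exact ⟨w, hw, hv.symm⟩
      · rintro ⟨w, hw, rfl⟩
        have := hf hw
        simp only [T, Finset.mem_filter, Finset.mem_univ, true_and] at this
        obtain ⟨v, _, hv⟩ := this
        exact ⟨v, ⟨w, hw, hv⟩, hv⟩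
    have hSc : S.card = k - 1 := by
      have := congrArg Finset.card hSf
      rw [Finset.card_image_of_injective _ hh, Finset.card_image_of_injective _ Sum.inr_injective] at this
      rw [this, hfc]
    have hSp : ∀ v ∈ S, part v = Fin.last a := by
      intro v hv
      simp only [S, Finset.mem_filter, Finset.mem_univ, true_and] at hv
      obtain ⟨w, hw, hv⟩ := hv
      have := hf hw
      simp only [T, Finset.mem_filter, Finset.mem_univ, true_and] at this
      obtain ⟨v', hp, hv'⟩ := this
      have : v = v' := hh (hv.trans hv'.symm)
      rw [this]; exact hp
    have h1 := hblue _ (hedge S (Fin.last a) x hSc hSp (by rw [hx]; exact (Fin.castSucc_lt_last i).ne))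
    have h2 : colr (b := b) R ((insert x S).image h) = true := by
      rw [colr, decide_eq_true_eq]
      right
      exact ⟨f, φ i, y, hRf, by rw [Finset.image_insert, hSf, hxy]⟩
    rw [h1] at h2; cases h2
  · let i : Fin a := ⟨0, ha⟩
    have hsub : Finset.univ.filter (fun v => part v = i.castSucc) ⊆
        C i.castSucc ∪ B (φ i) i.castSucc := by
      intro v hv
      have hv : part v = i.castSucc := by simpa using hv
      rw [Finset.mem_union]
      rcases hx : h v with ⟨j, y⟩ | w
      · right
        obtain ⟨i', rfl⟩ := hφs j
        have := hX i' v y hx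
        rw [hv] at this
        have := Fin.castSucc_injective a this
        simp only [B, Finset.mem_filter, Finset.mem_univ, true_and]
        exact ⟨hv, y, by rw [hx, this]⟩
      · left
        simp only [C, Finset.mem_filter, Finset.mem_univ, true_and]
        exact ⟨hv, w, hx⟩
    have h1 := (Finset.card_le_card hsub).trans (Finset.card_union_le _ _)
    have h2 := hVb (B (φ i) i.castSucc) (φ i) (fun v hv => by
      simp only [B, Finset.mem_filter] at hv; exact hv.2.2)
    have hdis : Disjoint (C i.castSucc) L := by
      rw [Finset.disjoint_left]
      intro v hv hv'
      simp only [C, L, Finset.mem_filter, Finset.mem_univ, true_and] at hv hv'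
      rw [hv.1] at hv'
      exact (Fin.castSucc_lt_last i).ne hv'
    have h3 := hW (C i.castSucc ∪ L) (fun v hv => by
      rw [Finset.mem_union] at hv
      rcases hv with hv | hv
      · simp only [C, Finset.mem_filter] at hv; exact hv.2.2
      · exact hlastW v (by simpa [L] using hv))
    rw [Finset.card_union_of_disjoint hdis] at h3
    have h4 := hA i
    have h5 : L.card = t := hlast
    omega

theorem arith {k q t n a : ℕ} (hk : 3 ≤ k) (hq : k - 1 ≤ q) (ht : k - 1 ≤ t)
    (hn : 3 * (k - 1) ≤ n)
    (ha : Nat.choose q (k - 1) ≤ a) (h : a * (k - 2) + t < n - 1) : 2 * q < n := by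
  rcases hq.eq_or_lt with hq | hq
  · omega
  · have h1 : Nat.choose q (k-1) * (k-2) ≤ a * (k-2) := Nat.mul_le_mul_right _ ha
    rcases hk.eq_or_lt with rfl | hk
    · simp only [Nat.reduceSub] at *
      have h2 : 2 * q.choose 2 = q * (q - 1) := by
        rw [Nat.choose_two_right]
        exact Nat.mul_div_cancel' (Nat.even_mul_pred_self q).two_dvd
      obtain ⟨r, rfl⟩ : ∃ r, q = r + 1 := ⟨q - 1, by omega⟩
      simp only [Nat.add_sub_cancel] at h2
      have h3 : (r + 1) * r + 8 > 4 * (r + 1) := by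
        rcases Nat.lt_or_ge r 4 with h | h
        · interval_cases r <;> omega
        · nlinarith
      omega
    · have h2 : q ≤ Nat.choose q (k-1) := by
        obtain ⟨r, rfl⟩ : ∃ r, q = r + 1 := ⟨q - 1, by omega⟩
        obtain ⟨c, hc⟩ : ∃ c, k - 1 = c + 1 := ⟨k - 2, by omega⟩
        rw [hc] at hq ⊢
        clear h h1 ha hn
        have : ∀ r c, c + 1 < r + 1 → r + 1 ≤ Nat.choose (r+1) (c+1) := by
          intro r
          induction r with
          | zero => intro c hc; omega
          | succ r ih =>
            intro c hc
            rw [Nat.choose_succ_succ']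
            rcases Nat.lt_or_ge (c+1) (r+1) with h | h
            · have h1 := ih c h
              have h2 : 0 < Nat.choose (r+1) c := Nat.choose_pos (by omega)
              omega
            · obtain rfl : c = r := by omega
              simp
        exact this r c hq
      have h3 : q * 2 ≤ Nat.choose q (k-1) * (k-2) := Nat.mul_le_mul h2 (by omega)
      omega

theorem assignExists {M a r : ℕ} (ha : 0 < a) (h : Nat.choose M r ≤ a) :
    ∃ ι : Finset (Fin M) → Fin a, ∀ f f' : Finset (Fin M), f.card = r → f'.card = r →
      ι f = ι f' → f = f' := by
  have hn : Nonempty ((Finset.powersetCard r (Finset.univ : Finset (Fin M))) ↪ Fin a) := by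
    apply Function.Embedding.nonempty_of_card_le
    rw [Fintype.card_coe, Finset.card_powersetCard]
    simpa using h
  obtain ⟨ι⟩ := hn
  have hmem : ∀ f : Finset (Fin M), f.card = r → f ∈ Finset.powersetCard r Finset.univ :=
    fun f hf => Finset.mem_powersetCard.mpr ⟨Finset.subset_univ _, hf⟩
  refine ⟨fun f => if hf : f.card = r then ι ⟨f, hmem f hf⟩ else ⟨0, ha⟩, ?_⟩
  intro f f' hf hf' h
  simp only [dif_pos hf, dif_pos hf'] at h
  exact congrArg Subtype.val (ι.injective h)

theorem depExists {M t : ℕ} (E : Finset (Finset (Fin M))) (h : indepNum E < t)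
    (T : Finset (Fin M)) (hT : T.card = t) : ∃ f ∈ E, f ⊆ T := by
  by_contra hno
  push Not at hno
  have : T.card ≤ indepNum E := by
    unfold indepNum
    apply Finset.le_sup (f := Finset.card)
    simp only [Finset.mem_filter]
    exact ⟨Finset.mem_univ T, hno⟩
  omega

/-- Lower bound for loose cycles: for the `k`-graph `H` whose vertex set is
partitioned (by `part`) into classes with `|A_i| > (χ-1)(k-2) + max{τ(k-1,t), q}`
for the first `χ-1` classes and `|A_{χ-1}| = t`, and whose edges are exactly the
`k`-sets meeting some class in exactly `k-1` vertices,
`R(C_{n,1}^{(k)}, H) > (χ-1)(n-1) + max{τ(k-1,t), q}`. -/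
theorem looseCycle_lower {k t q χ n nH : ℕ} (hk : 3 ≤ k)
    (ht : k - 1 ≤ t) (hq : k - 1 ≤ q) (hχ : Nat.choose q (k - 1) < χ)
    (hn : 3 * (k - 1) ≤ n) (hmod : n ≡ 0 [MOD k - 1])
    (H : Finset (Finset (Fin nH))) (part : Fin nH → Fin χ)
    (hA : ∀ i : Fin χ, (i : ℕ) + 1 < χ →
      (χ - 1) * (k - 2) + max (tauFn (k - 1) t) q <
        (Finset.univ.filter (fun v => part v = i)).card)
    (hlast : ∀ i : Fin χ, (i : ℕ) + 1 = χ →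
      (Finset.univ.filter (fun v => part v = i)).card = t)
    (hedges : ∀ e : Finset (Fin nH), e ∈ H ↔
      (e.card = k ∧ ∃ i : Fin χ, (e.filter (fun v => part v = i)).card = k - 1)) :
    (χ - 1) * (n - 1) + max (tauFn (k - 1) t) q <
      ramseyNumber (ellCycleEdges k 1 n) H := by
  obtain ⟨a, rfl⟩ : ∃ a, χ = a + 1 := ⟨χ - 1, by omega⟩
  simp only [Nat.add_sub_cancel] at hA ⊢
  have hch : 0 < Nat.choose q (k - 1) := Nat.choose_pos hq
  have ha : 0 < a := by omega
  obtain ⟨m, hm⟩ : ∃ m, n = m * (k - 1) := by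
    obtain ⟨m, hm⟩ := (Nat.modEq_zero_iff_dvd).mp hmod
    exact ⟨m, by rw [hm, mul_comm]⟩
  have hm3 : 3 ≤ m := by
    rw [hm] at hn
    exact Nat.le_of_mul_le_mul_right hn (by omega)
  have hb : n - 1 < n := by omega
  by_contra hcon
  rw [not_lt] at hcon
  have hHk : ∀ e ∈ H, e.card = k := fun e he => ((hedges e).mp he).1
  have hmem : ramseyNumber (ellCycleEdges k 1 n) H ∈ {N : ℕ | ∀ c : Finset (Fin N) → Bool,
      hasMonoCopy c true (ellCycleEdges k 1 n) ∨ hasMonoCopy c false H} :=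
    Nat.sInf_mem (ramseyNonempty (k := k) _ _ (cycleEdgeCard (by omega) (by omega)) hHk)
  have hA' : ∀ i : Fin a, a * (k - 2) + max (tauFn (k - 1) t) q <
      (Finset.univ.filter (fun v => part v = i.castSucc)).card := fun i =>
    hA i.castSucc (by simp)
  have hlast' := hlast (Fin.last a) (by simp)
  clear hA hlast
  generalize hMdef : max (tauFn (k - 1) t) q = M at *
  have hram : ∀ R : Finset (Fin M) → Fin a → Prop,
      ¬ hasMonoCopy (colr (b := n - 1) R) true (ellCycleEdges k 1 n) →
      ∃ T : Finset (Fin M), T.card = t ∧ (∀ f ⊆ T, f.card = k - 1 → ∀ j, ¬ R f j) ∧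
      a * (k - 2) + t < n - 1 := by
    intro R hR
    have := ramseyTransfer (V := (Fin a × Fin (n-1)) ⊕ Fin M) _ _ hmem (by simpa using hcon) (colr R)
    exact blueCopy hk ha R H part hA' hlast' hedges (this.resolve_left hR)
  rcases Nat.lt_or_ge q (tauFn (k - 1) t) with hlt | hge
  · obtain rfl : M = tauFn (k - 1) t := by omega
    have hτ : tauFn (k - 1) t ∈ {n : ℕ | ∃ E : Finset (Finset (Fin n)),
        IsUniformHyp (k - 1) E ∧ indepNum E < t ∧ NoLoosePathTwo E} := by
      have hpos : 0 < tauFn (k - 1) t := by omega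
      unfold tauFn at hpos ⊢
      apply Nat.sSup_mem
      · by_contra hne
        rw [Set.not_nonempty_iff_eq_empty] at hne
        rw [hne] at hpos
        simp at hpos
      · by_contra hne
        rw [Nat.sSup_of_not_bddAbove hne] at hpos
        simp at hpos
    obtain ⟨E, hE, hind, hL⟩ := hτ
    obtain ⟨T, hT, hTf, _⟩ := hram (fun f _ => f ∈ E) (noRed1 hk hm3 hm hb E hE hL)
    have hdep := depExists E hind T hT
    obtain ⟨f, hf, hfT⟩ := hdep
    exact hTf f hfT (hE f hf) ⟨0, ha⟩ hf
  · obtain rfl : M = q := by omega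
    obtain ⟨_, _, _, hbd⟩ := hram (fun _ _ => False)
      (noRed2 hk hm3 hm hb _ (by simp) (by simp) (by simp))
    have h2q := arith hk hq ht hn (by omega : Nat.choose M (k - 1) ≤ a) hbd
    obtain ⟨ι, hι⟩ := assignExists (M := M) (r := k - 1) ha (by omega)
    obtain ⟨T, hT, hTf, _⟩ := hram (fun f j => f.card = k - 1 ∧ ι f = j)
      (noRed2 hk hm3 hm hb _ (fun f j hf => hf.1)
        (fun f f' j h1 h2 => hι f f' h1.1 h2.1 (h1.2.trans h2.2.symm)) (fun _ => h2q))
    obtain ⟨f, hfT, hfc⟩ := Finset.exists_subset_card_eq (hT ▸ ht : k - 1 ≤ T.card)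
    exact hTf f hfT hfc _ ⟨hfc, rfl⟩
end

section
/- Let χ ≥ 3 and m ≥ 2 be integers, let T_χ be any non-transitive tournament on [χ], and let H = H(T_χ, m) be a tournament hypergraph associated to T_χ with all classes of size m. Let n, t ≥ 1 be integers such that ⌊3t/2⌋ + 1 < n. Then R(P_{n,2}^{(3)}, H) ≥ (m-1)t + 1. -/
open scoped Classical

/-- The edge set of the `k`-uniform `ℓ`-path on `n` vertices `0, …, n-1`
(for `n ≡ ℓ (mod k-ℓ)`): the `i`-th edge consists of the vertices
`i(k-ℓ), …, i(k-ℓ)+k-1`. -/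
def ellPathEdges (k ℓ n : ℕ) : Finset (Finset (Fin n)) :=
  (Finset.range ((n - ℓ) / (k - ℓ))).image (fun i =>
    Finset.univ.filter (fun v : Fin n => i * (k - ℓ) ≤ (v : ℕ) ∧ (v : ℕ) < i * (k - ℓ) + k))
/-- A tournament: an orientation of the complete graph. -/
def IsTournament {V : Type*} (T : V → V → Prop) : Prop :=
  (∀ v, ¬ T v v) ∧ ∀ u v : V, u ≠ v → (T u v ↔ ¬ T v u)

/-- The tournament `T` contains a copy of the transitive tournament on `ℓ` vertices. -/
def ContainsTransTourn {V : Type*} (T : V → V → Prop) (ℓ : ℕ) : Prop :=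
  ∃ f : Fin ℓ → V, Function.Injective f ∧ ∀ i j : Fin ℓ, i < j → T (f i) (f j)

/-- `R⃗(ℓ)`: the least `N` such that every tournament on at least `N` vertices
contains a transitive tournament on `ℓ` vertices. -/
noncomputable def dirRamsey (ℓ : ℕ) : ℕ :=
  sInf {N : ℕ | ∀ M : ℕ, N ≤ M → ∀ T : Fin M → Fin M → Prop,
    IsTournament T → ContainsTransTourn T ℓ}

theorem ramsey_aux (r : ℕ) : ∀ k : ℕ, ∃ N : ℕ, ∀ M : ℕ, ∀ S : Finset (Fin M), N ≤ S.card →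
    ∀ c : Finset (Fin M) → Bool, ∃ A ⊆ S, A.card = k ∧ ∃ b : Bool,
      ∀ e ⊆ A, e.card = r → c e = b := by
  induction r with
  | zero =>
    intro k
    refine ⟨k, fun M S hS c => ?_⟩
    obtain ⟨A, hA, hk⟩ := Finset.exists_subset_card_eq hS
    refine ⟨A, hA, hk, c ∅, fun e _ he => ?_⟩
    rw [Finset.card_eq_zero.mp he]
  | succ r ih =>
    have Q : ∀ k : ℕ, ∃ N : ℕ, ∀ M : ℕ, ∀ S : Finset (Fin M), N ≤ S.card →
        ∀ c : Finset (Fin M) → Bool, ∃ A ⊆ S, A.card = k ∧ ∃ g : Fin M → Bool,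
          ∀ x ∈ A, ∀ e ⊆ A, (∀ y ∈ e, x < y) → e.card = r → c (insert x e) = g x := by
      intro k
      induction k with
      | zero =>
        refine ⟨0, fun M S _ c => ⟨∅, by simp, by simp, fun _ => true, by simp⟩⟩
      | succ k ihk =>
        obtain ⟨N1, h1⟩ := ihk
        obtain ⟨N2, h2⟩ := ih N1
        refine ⟨N2 + 1, fun M S hS c => ?_⟩
        have hne : S.Nonempty := by
          rw [← Finset.card_pos]; omega
        set x := S.min' hne with hx
        have hxS : x ∈ S := S.min'_mem hne
        obtain ⟨A1, hA1, hc1, b, hb⟩ := h2 M (S.erase x)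
          (by rw [Finset.card_erase_of_mem hxS]; omega) (fun e => c (insert x e))
        obtain ⟨A2, hA2, hc2, g, hg⟩ := h1 M A1 hc1.ge c
        have hlt : ∀ y ∈ A2, x < y := by
          intro y hy
          have := hA1 (hA2 hy)
          rw [Finset.mem_erase] at this
          exact lt_of_le_of_ne (S.min'_le y this.2) (Ne.symm this.1)
        have hxA : x ∉ A2 := fun h => lt_irrefl _ (hlt x h)
        refine ⟨insert x A2, ?_, ?_, Function.update g x b, ?_⟩
        · intro y hy
          rcases Finset.mem_insert.mp hy with rfl | hy
          · exact hxS
          · exact Finset.mem_of_mem_erase (hA1 (hA2 hy))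
        · rw [Finset.card_insert_of_notMem hxA, hc2]
        · intro z hz e he hze hcard
          have he2 : e ⊆ A2 := by
            intro y hy
            rcases Finset.mem_insert.mp (he hy) with h | h
            · exfalso
              have h1 := hze y hy
              rcases Finset.mem_insert.mp hz with h2 | h2
              · rw [h, h2] at h1; exact lt_irrefl _ h1
              · have := hlt z h2
                rw [h] at h1
                exact lt_asymm h1 this
            · exact h
          rcases Finset.mem_insert.mp hz with h | h
          · rw [h, Function.update_self]
            exact hb e (he2.trans hA2) hcard
          · rw [Function.update_of_ne (fun h2 : z = x => hxA (by rw [← h2]; exact h))]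
            exact hg z h e he2 hze hcard
    intro k
    obtain ⟨N, hN⟩ := Q (2 * k)
    refine ⟨N, fun M S hS c => ?_⟩
    obtain ⟨A, hA, hAc, g, hg⟩ := hN M S hS c
    have hb : ∃ b : Bool, k ≤ (A.filter (fun x => g x = b)).card := by
      by_contra hcon
      push Not at hcon
      have h1 := hcon true
      have h2 := hcon false
      have h3 := Finset.card_filter_add_card_filter_not (s := A) (fun x => g x = true)
      simp only [Bool.not_eq_true] at h3
      omega
    obtain ⟨b, hb⟩ := hb
    obtain ⟨B, hB, hBk⟩ := Finset.exists_subset_card_eq hb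
    refine ⟨B, hB.trans ((Finset.filter_subset _ _).trans hA), hBk, b, fun e he hcard => ?_⟩
    have hne : e.Nonempty := by
      rw [← Finset.card_pos]; omega
    have hm := e.min'_mem hne
    have hmB := Finset.mem_filter.mp (hB (he hm))
    have := hg (e.min' hne) hmB.1 (e.erase (e.min' hne))
      (fun y hy => (Finset.mem_filter.mp (hB (he (Finset.mem_of_mem_erase hy)))).1)
      (fun y hy => e.min'_lt_of_mem_erase_min' hne hy)
      (by rw [Finset.card_erase_of_mem hm]; omega)
    rw [Finset.insert_erase hm] at this
    rw [this, hmB.2]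

theorem ramsey_nonempty {n nH : ℕ} (G : Finset (Finset (Fin n))) (H : Finset (Finset (Fin nH)))
    (hG : ∀ e ∈ G, e.card = 3) (hH : ∀ e ∈ H, e.card = 3) :
    ∃ N : ℕ, ∀ c : Finset (Fin N) → Bool, hasMonoCopy c true G ∨ hasMonoCopy c false H := by
  obtain ⟨N, hN⟩ := ramsey_aux 3 (n + nH)
  refine ⟨N, fun c => ?_⟩
  obtain ⟨A, -, hA, b, hb⟩ := hN N Finset.univ (by simp) c
  have key : ∀ (k : ℕ) (hk : k ≤ n + nH) (F : Finset (Finset (Fin k))), (∀ e ∈ F, e.card = 3) →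
      hasMonoCopy c b F := by
    intro k hk F hF
    have hinj : Function.Injective (fun i : Fin k => A.orderEmbOfFin hA (Fin.castLE hk i)) :=
      (A.orderEmbOfFin hA).injective.comp (Fin.castLE_injective hk)
    refine ⟨_, hinj, fun e he => hb _ ?_ ?_⟩
    · intro y hy
      obtain ⟨z, _, rfl⟩ := Finset.mem_image.mp hy
      exact A.orderEmbOfFin_mem hA _
    · rw [Finset.card_image_of_injective _ hinj, hF e he]
  cases b with
  | true => exact Or.inl (key n (by omega) G hG)
  | false => exact Or.inr (key nH (by omega) H hH)

/-- the colouring -/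
noncomputable def lowCol (t N : ℕ) (e : Finset (Fin N)) : Bool :=
  decide (∃ i : ℕ, (∀ v ∈ e, (v : ℕ) / t ≤ i) ∧
    ∃ v ∈ e, ∃ w ∈ e, v ≠ w ∧ (v : ℕ) / t = i ∧ (w : ℕ) / t = i)

theorem path_edge_eq {n j : ℕ} (hj : j + 2 < n) :
    ({⟨j, by omega⟩, ⟨j+1, by omega⟩, ⟨j+2, hj⟩} : Finset (Fin n)) ∈ ellPathEdges 3 2 n := by
  unfold ellPathEdges
  rw [Finset.mem_image]
  refine ⟨j, by simp; omega, ?_⟩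
  ext v
  simp [Fin.ext_iff]
  omega

theorem path_card {n : ℕ} : ∀ e ∈ ellPathEdges 3 2 n, e.card = 3 := by
  intro e he
  unfold ellPathEdges at he
  rw [Finset.mem_image] at he
  obtain ⟨j, hj, rfl⟩ := he
  simp at hj
  have : (Finset.univ.filter (fun v : Fin n => j * (3 - 2) ≤ (v : ℕ) ∧ (v : ℕ) < j * (3 - 2) + 3))
      = ({⟨j, by omega⟩, ⟨j+1, by omega⟩, ⟨j+2, by omega⟩} : Finset (Fin n)) := by
    ext v
    simp [Fin.ext_iff]
    omega
  rw [this]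
  rw [Finset.card_eq_three]
  exact ⟨_, _, _, by simp, by simp, by simp, rfl⟩

theorem no_red {n t N : ℕ} (ht : 1 ≤ t) (hnt : 3 * t / 2 + 1 < n) :
    ¬ hasMonoCopy (lowCol t N) true (ellPathEdges 3 2 n) := by
  rintro ⟨f, hf, hc⟩
  set q : ℕ → ℕ := fun j => if h : j < n then (f ⟨j, h⟩ : ℕ) / t else 0 with hq
  have htri : ∀ j, j + 2 < n → ∃ i, q j ≤ i ∧ q (j+1) ≤ i ∧ q (j+2) ≤ i ∧
      ((q j = i ∧ q (j+1) = i) ∨ (q j = i ∧ q (j+2) = i) ∨ (q (j+1) = i ∧ q (j+2) = i)) := by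
    intro j hj
    have h := hc _ (path_edge_eq hj)
    unfold lowCol at h
    rw [decide_eq_true_iff] at h
    obtain ⟨i, h1, v, hv, w, hw, hvw, hvi, hwi⟩ := h
    have e0 : q j = (f ⟨j, by omega⟩ : ℕ) / t := by simp only [hq]; rw [dif_pos]
    have e1 : q (j+1) = (f ⟨j+1, by omega⟩ : ℕ) / t := by simp only [hq]; rw [dif_pos]
    have e2 : q (j+2) = (f ⟨j+2, by omega⟩ : ℕ) / t := by simp only [hq]; rw [dif_pos]
    refine ⟨i, ?_, ?_, ?_, ?_⟩
    · rw [e0]; apply h1; simp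
    · rw [e1]; apply h1; simp
    · rw [e2]; apply h1; simp
    · rw [e0, e1, e2]
      simp only [Finset.image_insert, Finset.image_singleton, Finset.mem_insert,
        Finset.mem_singleton] at hv hw
      rcases hv with rfl | rfl | rfl <;> rcases hw with rfl | rfl | rfl <;> simp_all
  have h3 : 0 + 2 < n := by omega
  obtain ⟨i, hi⟩ := htri 0 h3
  have hall : ∀ j, j + 2 < n → q j ≤ i ∧ q (j+1) ≤ i ∧ q (j+2) ≤ i ∧
      ((q j = i ∧ q (j+1) = i) ∨ (q j = i ∧ q (j+2) = i) ∨ (q (j+1) = i ∧ q (j+2) = i)) := by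
    intro j
    induction j with
    | zero => intro _; exact hi
    | succ j ih =>
      intro hj
      have a := ih (by omega)
      obtain ⟨i', b⟩ := htri (j+1) hj
      have : i' = i := by
        rw [show j + 1 + 1 = j + 2 by omega] at b
        omega
      rw [← this]; exact b
  clear_value q
  have hcount : ∀ k j, j ≤ k → j ≤ n → 2 * j / 3 ≤ Nat.count (fun x => q x = i) j := by
    intro k
    induction k with
    | zero => intro j hj _; simp [show j = 0 by omega]
    | succ k ih =>
      intro j hj hjn
      match j, hj, hjn with
      | 0, _, _ => simp
      | 1, _, _ => simp
      | 2, _, _ =>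
        have := hall 0 h3
        simp only [Nat.count_succ, Nat.count_zero]
        simp only [zero_add] at this ⊢
        split_ifs <;> omega
      | j+3, hj, hjn =>
        have := hall j (by omega)
        have a := ih j (by omega) (by omega)
        simp only [Nat.count_succ]
        split_ifs <;> omega
  have hlow := hcount n n le_rfl le_rfl
  have hup : Nat.count (fun x => q x = i) n ≤ t := by
    rw [Nat.count_eq_card_filter_range]
    have : ((Finset.range n).filter (fun x => q x = i)).card ≤ (Finset.range t).card := by
      apply Finset.card_le_card_of_injOn (fun x => if h : x < n then (f ⟨x, h⟩ : ℕ) % t else 0)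
      · intro x hx
        simp only [Finset.coe_filter, Finset.mem_range, Set.mem_ofPred_eq] at hx
        simp only [Finset.coe_range, Set.mem_Iio]
        rw [dif_pos hx.1]
        exact Nat.mod_lt _ ht
      · intro x hx y hy hxy
        simp only [Finset.coe_filter, Finset.mem_range, Set.mem_ofPred_eq] at hx hy
        simp only [] at hxy
        rw [dif_pos hx.1, dif_pos hy.1] at hxy
        obtain ⟨hx1, hx2⟩ := hx
        obtain ⟨hy1, hy2⟩ := hy
        rw [hq] at hx2 hy2
        simp only [] at hx2 hy2
        rw [dif_pos hx1] at hx2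
        rw [dif_pos hy1] at hy2
        have : (f ⟨x, hx1⟩ : ℕ) = f ⟨y, hy1⟩ := by
          rw [← Nat.div_add_mod (f ⟨x, hx1⟩ : ℕ) t, ← Nat.div_add_mod (f ⟨y, hy1⟩ : ℕ) t,
            hxy, hx2, hy2]
        have := hf (Fin.ext this)
        exact congrArg Fin.val this
    simpa using this
  omega

theorem no_blue {χ m nH N t : ℕ} (ht : 1 ≤ t)
    (hm : 2 ≤ m) (T : Fin χ → Fin χ → Prop) (hT : IsTournament T)
    (hnontrans : ¬ ∀ a b c : Fin χ, T a b → T b c → T a c)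
    (H : Finset (Finset (Fin nH))) (part : Fin nH → Fin χ)
    (hsizes : ∀ i : Fin χ, (Finset.univ.filter (fun v => part v = i)).card = m)
    (hedges : ∀ e : Finset (Fin nH), e ∈ H ↔
      ∃ x y z : Fin nH, x ≠ y ∧ x ≠ z ∧ y ≠ z ∧ e = {x, y, z} ∧
        part x = part y ∧ T (part x) (part z))
    (hN : N ≤ (m - 1) * t) : ¬ hasMonoCopy (lowCol t N) false H := by
  rintro ⟨f, hf, hc⟩
  have hpair : ∀ a : Fin χ, ∃ i : ℕ, ∃ x y : Fin nH, x ≠ y ∧ part x = a ∧ part y = a ∧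
      (f x : ℕ) / t = i ∧ (f y : ℕ) / t = i := by
    intro a
    have hlt : (Finset.range (m-1)).card < (Finset.univ.filter (fun v => part v = a)).card := by
      rw [hsizes a, Finset.card_range]; omega
    obtain ⟨x, hx, y, hy, hxy, h⟩ := Finset.exists_ne_map_eq_of_card_lt_of_maps_to hlt
      (f := fun v => (f v : ℕ) / t) (by
        intro v _
        simp only [Finset.coe_range, Set.mem_Iio]
        rw [Nat.div_lt_iff_lt_mul ht]
        exact lt_of_lt_of_le (f v).2 hN)
    exact ⟨_, x, y, hxy, (Finset.mem_filter.mp hx).2, (Finset.mem_filter.mp hy).2, h, rfl⟩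
  choose p hp using hpair
  have hmono : ∀ a b, T a b → p a < p b := by
    intro a b hab
    obtain ⟨x, y, hxy, hx, hy, hxi, hyi⟩ := hp a
    obtain ⟨z, -, -, hz, -, hzi, -⟩ := hp b
    have hne : a ≠ b := fun h => hT.1 a (by rw [← h] at hab; exact hab)
    have hmem : ({x, y, z} : Finset (Fin nH)) ∈ H := by
      rw [hedges]
      refine ⟨x, y, z, hxy, ?_, ?_, rfl, hx.trans hy.symm, by rw [hx, hz]; exact hab⟩
      · rintro rfl; exact hne (hx.symm.trans hz)
      · rintro rfl; exact hne (hy.symm.trans hz)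
    have h := hc _ hmem
    unfold lowCol at h
    rw [decide_eq_false_iff_not] at h
    by_contra hcon
    push Not at hcon
    apply h
    refine ⟨p a, ?_, f x, by simp, f y, by simp, fun h => hxy (hf h), hxi, hyi⟩
    intro v hv
    simp only [Finset.image_insert, Finset.image_singleton, Finset.mem_insert,
        Finset.mem_singleton] at hv
    rcases hv with rfl | rfl | rfl <;> omega
  apply hnontrans
  intro a b c hab hbc
  have h1 := hmono a b hab
  have h2 := hmono b c hbc
  by_contra hac
  by_cases h : a = c
  · subst h; omega
  · have hca : T c a := (hT.2 c a (Ne.symm h)).mpr hac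
    have := hmono c a hca
    omega

/-- If `T` is a non-transitive tournament on `[χ]` and `H = H(T,m)` is the associated
tournament hypergraph with classes of size `m`, then for `⌊3t/2⌋ + 1 < n` we have
`R(P_{n,2}^{(3)}, H) ≥ (m-1)t + 1`. -/
theorem nontransitive_lower {χ m nH : ℕ} (hχ : 3 ≤ χ) (hm : 2 ≤ m)
    (T : Fin χ → Fin χ → Prop) (hT : IsTournament T)
    (hnontrans : ¬ ∀ a b c : Fin χ, T a b → T b c → T a c)
    (H : Finset (Finset (Fin nH))) (part : Fin nH → Fin χ)
    (hsizes : ∀ i : Fin χ, (Finset.univ.filter (fun v => part v = i)).card = m)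
    (hedges : ∀ e : Finset (Fin nH), e ∈ H ↔
      ∃ x y z : Fin nH, x ≠ y ∧ x ≠ z ∧ y ≠ z ∧ e = {x, y, z} ∧
        part x = part y ∧ T (part x) (part z))
    (n t : ℕ) (hn : 1 ≤ n) (ht : 1 ≤ t) (hnt : 3 * t / 2 + 1 < n) :
    (m - 1) * t + 1 ≤ ramseyNumber (ellPathEdges 3 2 n) H := by
  have hH : ∀ e ∈ H, e.card = 3 := by
    intro e he
    obtain ⟨x, y, z, hxy, hxz, hyz, rfl, -⟩ := (hedges e).mp he
    exact Finset.card_eq_three.mpr ⟨x, y, z, hxy, hxz, hyz, rfl⟩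
  unfold ramseyNumber
  apply le_csInf (ramsey_nonempty _ H path_card hH)
  intro N hN
  by_contra hcon
  rcases hN (lowCol t N) with h | h
  · exact no_red ht hnt h
  · exact no_blue ht hm T hT hnontrans H part hsizes hedges (by omega) h
end

section
/- Given integers χ ≥ 2 and m ≥ 2 and a real number ε > 0, there exists an integer n_0 = n_0(χ, m, ε) such that for all n ≥ n_0: if χ = 2 then R(P_{n,2}^{(3)}, H(TT_χ, m)) ≤ (1+ε)n, and if χ ≥ 3 then R(P_{n,2}^{(3)}, H(TT_χ, m)) ≤ (2/3 + ε)(R⃗(χ) - 1)n. -/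
open scoped Classical

/-- The tournament hypergraph `H(TT_χ, m)` associated to the transitive tournament
on `[χ]` (with arcs `i → j` for `i < j`), with vertex classes `{i} × Fin m`:
its edges are the triples with two vertices in class `i` and one in class `j`,
where `i < j`. -/
def transTournHyp (χ m : ℕ) : Finset (Finset (Fin χ × Fin m)) :=
  Finset.univ.filter (fun e : Finset (Fin χ × Fin m) =>
    ∃ x ∈ e, ∃ y ∈ e, ∃ z ∈ e, x ≠ y ∧ e = {x, y, z} ∧ x.1 = y.1 ∧ x.1 < z.1)


theorem ramsey_aux_s10 (k : ℕ) : ∀ p q : ℕ, ∃ N : ℕ, ∀ (V : Type) [DecidableEq V] (c : Finset V → Bool)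
    (S : Finset V), N ≤ S.card →
    (∃ T ⊆ S, T.card = p ∧ ∀ e ⊆ T, e.card = k → c e = true) ∨
    (∃ T ⊆ S, T.card = q ∧ ∀ e ⊆ T, e.card = k → c e = false) := by
  induction k with
  | zero =>
    intro p q
    refine ⟨max p q, fun V _ c S hS => ?_⟩
    cases h : c ∅ with
    | true =>
      left
      obtain ⟨T, hT, hc⟩ := Finset.exists_subset_card_eq (le_trans (le_max_left p q) hS)
      exact ⟨T, hT, hc, fun e _ he => by rw [Finset.card_eq_zero.1 he]; exact h⟩
    | false =>
      right
      obtain ⟨T, hT, hc⟩ := Finset.exists_subset_card_eq (le_trans (le_max_right p q) hS)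
      exact ⟨T, hT, hc, fun e _ he => by rw [Finset.card_eq_zero.1 he]; exact h⟩
  | succ k ih =>
    intro p
    induction p with
    | zero =>
      intro q
      refine ⟨0, fun V _ c S _ => Or.inl ⟨∅, by simp, by simp, ?_⟩⟩
      intro e he hc
      rw [Finset.subset_empty.1 he] at hc
      simp at hc
    | succ p ihp =>
      intro q
      induction q with
      | zero =>
        refine ⟨0, fun V _ c S _ => Or.inr ⟨∅, by simp, by simp, ?_⟩⟩
        intro e he hc
        rw [Finset.subset_empty.1 he] at hc
        simp at hc
      | succ q ihq =>
        obtain ⟨N1, h1⟩ := ihp (q+1)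
        obtain ⟨N2, h2⟩ := ihq
        obtain ⟨N, hN⟩ := ih N1 N2
        refine ⟨N + 1, fun V _ c S hS => ?_⟩
        obtain ⟨v, hv⟩ : S.Nonempty := Finset.card_pos.1 (by omega)
        have key : ∀ (b : Bool) (T : Finset V), v ∉ T →
            (∀ e ⊆ T, e.card = k + 1 → c e = b) → (∀ e ⊆ T, e.card = k → c (insert v e) = b) →
            ∀ e ⊆ insert v T, e.card = k + 1 → c e = b := by
          intro b T hvT h1 h2 e he hc
          by_cases hve : v ∈ e
          · have := h2 (e.erase v) (by rw [← Finset.erase_insert hvT]; exact Finset.erase_subset_erase _ he)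
              (by rw [Finset.card_erase_of_mem hve]; omega)
            rwa [Finset.insert_erase hve] at this
          · exact h1 e ((Finset.subset_insert_iff_of_notMem hve).1 he) hc
        rcases hN V (fun e => c (insert v e)) (S.erase v) (by rw [Finset.card_erase_of_mem hv]; omega) with
          ⟨T, hT, hTc, hh⟩ | ⟨T, hT, hTc, hh⟩
        · rcases h1 V c T hTc.ge with ⟨U, hU, hUc, hUh⟩ | ⟨U, hU, hUc, hUh⟩
          · left
            have hvU : v ∉ U := fun h => by simpa using hT (hU h)
            refine ⟨insert v U, ?_, by rw [Finset.card_insert_of_notMem hvU, hUc],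
              key _ U hvU hUh (fun e he hc => hh e (he.trans hU) hc)⟩
            exact Finset.insert_subset hv ((hU.trans hT).trans (Finset.erase_subset _ _))
          · right
            exact ⟨U, (hU.trans hT).trans (Finset.erase_subset _ _), hUc, hUh⟩
        · rcases h2 V c T hTc.ge with ⟨U, hU, hUc, hUh⟩ | ⟨U, hU, hUc, hUh⟩
          · left
            exact ⟨U, (hU.trans hT).trans (Finset.erase_subset _ _), hUc, hUh⟩
          · right
            have hvU : v ∉ U := fun h => by simpa using hT (hU h)
            refine ⟨insert v U, ?_, by rw [Finset.card_insert_of_notMem hvU, hUc],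
              key _ U hvU hUh (fun e he hc => hh e (he.trans hU) hc)⟩
            exact Finset.insert_subset hv ((hU.trans hT).trans (Finset.erase_subset _ _))

theorem pair_hom (k : ℕ) : ∃ s : ℕ, ∀ (V : Type) [DecidableEq V] (c : Finset V → Bool)
    (A B : Finset V), s ≤ A.card → s ≤ B.card →
    ∃ A' ⊆ A, ∃ B' ⊆ B, k ≤ A'.card ∧ k ≤ B'.card ∧ ∃ b : Bool,
      ∀ x ∈ A', ∀ y ∈ A', x ≠ y → ∀ z ∈ B', c {x, y, z} = b := by
  obtain ⟨a, ha⟩ := ramsey_aux_s10 2 k k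
  refine ⟨max a (2 ^ (2 ^ a) * (k + 1)), fun V _ c A B hA hB => ?_⟩
  obtain ⟨A0, hA0, hA0c⟩ := Finset.exists_subset_card_eq (le_trans (le_max_left _ _) hA)
  let g : V → Finset (Finset V) := fun b => A0.powerset.filter (fun e => c (insert b e) = true)
  have hg : ∀ b ∈ B, g b ∈ A0.powerset.powerset := fun b _ => by
    simp [g]
  obtain ⟨y, hy, hyc⟩ := Finset.exists_le_card_fiber_of_mul_le_card_of_maps_to hg (n := k + 1)
    ⟨∅, by simp⟩ (by
      rw [Finset.card_powerset, Finset.card_powerset, hA0c]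
      exact le_trans (le_max_right _ _) hB)
  obtain ⟨b0, hb0⟩ : (B.filter (fun x => g x = y)).Nonempty := Finset.card_pos.1 (by omega)
  have hsame : ∀ b ∈ B.filter (fun x => g x = y), ∀ e ⊆ A0, c (insert b e) = c (insert b0 e) := by
    intro b hb e he
    have h1 : g b = g b0 := by
      rw [(Finset.mem_filter.1 hb).2, (Finset.mem_filter.1 hb0).2]
    have h2 : e ∈ g b ↔ e ∈ g b0 := by rw [h1]
    simp only [g, Finset.mem_filter, Finset.mem_powerset, he, true_and] at h2
    exact Bool.eq_iff_iff.2 h2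
  have fin : ∀ (T : Finset V) (b : Bool), T ⊆ A0 → (∀ e ⊆ T, e.card = 2 → c (insert b0 e) = b) →
      ∀ x ∈ T, ∀ y' ∈ T, x ≠ y' → ∀ z ∈ B.filter (fun x => g x = y), c {x, y', z} = b := by
    intro T b hT h x hx y' hy' hxy z hz
    have hsub : ({x, y'} : Finset V) ⊆ T := by
      intro w hw; simp at hw; rcases hw with rfl | rfl <;> assumption
    have e1 : ({x, y', z} : Finset V) = insert z {x, y'} := by
      ext w; simp; tauto
    rw [e1, hsame z hz _ (hsub.trans hT), h _ hsub (Finset.card_pair hxy)]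
  rcases ha V (fun e => c (insert b0 e)) A0 hA0c.ge with ⟨T, hT, hTc, hh⟩ | ⟨T, hT, hTc, hh⟩
  · exact ⟨T, hT.trans hA0, _, Finset.filter_subset _ _, hTc.ge, by omega, true, fin T true hT hh⟩
  · exact ⟨T, hT.trans hA0, _, Finset.filter_subset _ _, hTc.ge, by omega, false, fin T false hT hh⟩

theorem multi_hom_aux (ι : Type) [DecidableEq ι] (k : ℕ) (L : List (ι × ι)) :
    ∃ s : ℕ, ∀ (V : Type) [DecidableEq V] (c : Finset V → Bool)
    (E : ι → Finset V), (∀ i, s ≤ (E i).card) →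
    ∃ E' : ι → Finset V, (∀ i, E' i ⊆ E i) ∧ (∀ i, k ≤ (E' i).card) ∧
      ∀ p ∈ L, p.1 ≠ p.2 → ∃ b : Bool,
      ∀ x ∈ E' p.1, ∀ y ∈ E' p.1, x ≠ y → ∀ z ∈ E' p.2, c {x, y, z} = b := by
  induction L with
  | nil => exact ⟨k, fun V _ c E hE => ⟨E, fun i => subset_rfl, hE, by simp⟩⟩
  | cons p L ih =>
    obtain ⟨s, hs⟩ := ih
    obtain ⟨s', hs'⟩ := pair_hom s
    refine ⟨max s s', fun V _ c E hE => ?_⟩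
    by_cases hp : p.1 = p.2
    · obtain ⟨E', h1, h2, h3⟩ := hs V c E (fun i => le_trans (le_max_left _ _) (hE i))
      refine ⟨E', h1, h2, ?_⟩
      intro q hq hne
      rcases List.mem_cons.1 hq with rfl | hq
      · exact absurd hp hne
      · exact h3 q hq hne
    · obtain ⟨A', hA, B', hB, hAc, hBc, b, hb⟩ := hs' V c (E p.1) (E p.2)
        (le_trans (le_max_right _ _) (hE _)) (le_trans (le_max_right _ _) (hE _))
      let E1 : ι → Finset V := fun i => if i = p.1 then A' else if i = p.2 then B' else E i
      have hE1 : ∀ i, E1 i ⊆ E i := by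
        intro i
        simp only [E1]
        split_ifs with h1 h2
        · rw [h1]; exact hA
        · rw [h2]; exact hB
        · exact subset_rfl
      obtain ⟨E', h1, h2, h3⟩ := hs V c E1 (fun i => by
        simp only [E1]
        split_ifs with h1 h2
        · exact hAc
        · exact hBc
        · exact le_trans (le_max_left _ _) (hE i))
      refine ⟨E', fun i => (h1 i).trans (hE1 i), h2, ?_⟩
      intro q hq hne
      rcases List.mem_cons.1 hq with rfl | hq
      · refine ⟨b, fun x hx y hy hxy z hz => hb x ?_ y ?_ hxy z ?_⟩
        · have := h1 _ hx; simpa [E1] using this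
        · have := h1 _ hy; simpa [E1] using this
        · have := h1 _ hz; simpa [E1, Ne.symm hp] using this
      · exact h3 q hq hne

theorem multi_hom (r k : ℕ) :
    ∃ s : ℕ, ∀ (V : Type) [DecidableEq V] (c : Finset V → Bool)
    (E : Fin r → Finset V), (∀ i, s ≤ (E i).card) →
    ∃ E' : Fin r → Finset V, (∀ i, E' i ⊆ E i) ∧ (∀ i, k ≤ (E' i).card) ∧
      ∃ b : Fin r → Fin r → Bool, ∀ i j, i ≠ j →
      ∀ x ∈ E' i, ∀ y ∈ E' i, x ≠ y → ∀ z ∈ E' j, c {x, y, z} = b i j := by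
  obtain ⟨s, hs⟩ := multi_hom_aux (Fin r) k (Finset.univ : Finset (Fin r × Fin r)).toList
  refine ⟨s, fun V _ c E hE => ?_⟩
  obtain ⟨E', h1, h2, h3⟩ := hs V c E hE
  have h4 : ∀ i j : Fin r, ∃ b : Bool, i ≠ j → 
      ∀ x ∈ E' i, ∀ y ∈ E' i, x ≠ y → ∀ z ∈ E' j, c {x, y, z} = b := by
    intro i j
    by_cases hij : i = j
    · exact ⟨true, fun h => absurd hij h⟩
    · obtain ⟨b, hb⟩ := h3 (i, j) (by simp) hij
      exact ⟨b, fun _ => hb⟩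
  choose b hb using h4
  exact ⟨E', h1, h2, b, hb⟩

/-- blue copy of the transitive tournament hypergraph inside `S`, classes of size at least `m` -/
def BlueH {V : Type} [DecidableEq V] (c : Finset V → Bool) (S : Finset V) (χ m : ℕ) : Prop :=
  ∃ A : Fin χ → Finset V, (∀ i, A i ⊆ S) ∧ (∀ i, m ≤ (A i).card) ∧
    (∀ i j, i ≠ j → Disjoint (A i) (A j)) ∧
    ∀ i j, i < j → ∀ x ∈ A i, ∀ y ∈ A i, x ≠ y → ∀ z ∈ A j, c {x, y, z} = false

theorem BlueH.mono {V : Type} [DecidableEq V] {c : Finset V → Bool} {S S' : Finset V} {χ m : ℕ}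
    (h : BlueH c S χ m) (hS : S ⊆ S') : BlueH c S' χ m := by
  obtain ⟨A, h1, h2⟩ := h
  exact ⟨A, fun i => (h1 i).trans hS, h2⟩

/-- all triples in `l` are red -/
def Clq {V : Type} [DecidableEq V] (c : Finset V → Bool) (l : List V) : Prop :=
  ∀ x ∈ l, ∀ y ∈ l, ∀ z ∈ l, x ≠ y → x ≠ z → y ≠ z → c {x, y, z} = true

/-- red tight path -/
def Tight {V : Type} [DecidableEq V] (c : Finset V → Bool) : List V → Prop
  | x :: y :: z :: l => c {x, y, z} = true ∧ Tight c (y :: z :: l)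
  | _ => True

/-- red tight path on at least `n` vertices inside `S` -/
def RedPath {V : Type} [DecidableEq V] (c : Finset V → Bool) (S : Finset V) (n : ℕ) : Prop :=
  ∃ l : List V, l.Nodup ∧ (∀ x ∈ l, x ∈ S) ∧ n ≤ l.length ∧ Tight c l

section
variable {V : Type} [DecidableEq V] {c : Finset V → Bool}

theorem RedPath.mono {S S' : Finset V} {n : ℕ}
    (h : RedPath c S n) (hS : S ⊆ S') : RedPath c S' n := by
  obtain ⟨l, h1, h2, h3⟩ := h
  exact ⟨l, h1, fun x hx => hS (h2 x hx), h3⟩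

theorem Clq.mono {l l' : List V} (h : Clq c l) (hs : ∀ x ∈ l', x ∈ l) : Clq c l' :=
  fun x hx y hy z hz => h x (hs x hx) y (hs y hy) z (hs z hz)

theorem Tight.tail {x : V} {l : List V} (h : Tight c (x :: l)) : Tight c l := by
  match l, h with
  | [], _ => trivial
  | [_], _ => trivial
  | _ :: _ :: _, h => exact h.2

theorem Tight.right {p q : List V} (h : Tight c (p ++ q)) : Tight c q := by
  induction p with
  | nil => exact h
  | cons x p ih => exact ih h.tail

theorem Tight.glue {p q : List V} {a b : V} (h1 : Tight c (p ++ [a, b]))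
    (h2 : Tight c (a :: b :: q)) : Tight c (p ++ a :: b :: q) := by
  induction p with
  | nil => exact h2
  | cons u p ih =>
    have := ih h1.tail
    match p, h1, this with
    | [], h1, this => exact ⟨h1.1, this⟩
    | [v], h1, this => exact ⟨h1.1, this⟩
    | v :: w :: p, h1, this => exact ⟨h1.1, this⟩

theorem triple_rev (x y z : V) : ({x, y, z} : Finset V) = {z, y, x} := by
  ext w; simp; tauto

theorem Tight.rev {l : List V} (h : Tight c l) : Tight c l.reverse := by
  induction l with
  | nil => trivial
  | cons x l ih =>
    match l, h, ih h.tail with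
    | [], _, _ => trivial
    | [y], _, _ => trivial
    | y :: z :: l, h, this =>
      have h3 : Tight c (l.reverse ++ [z, y]) := by simpa using this
      have h4 : Tight c [z, y, x] := ⟨by rw [triple_rev]; exact h.1, trivial⟩
      have := h3.glue h4
      simpa using this

theorem Tight.left {p q : List V} (h : Tight c (p ++ q)) : Tight c p := by
  have := h.rev
  rw [List.reverse_append] at this
  simpa using this.right.rev

theorem Clq.tight {l : List V} (h : Clq c l) (hn : l.Nodup) : Tight c l := by
  induction l with
  | nil => trivial
  | cons x l ih =>
    have := ih (h.mono (by simp +contextual)) hn.of_cons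
    match l, h, hn, this with
    | [], _, _, _ => trivial
    | [y], _, _, _ => trivial
    | y :: z :: l, h, hn, this =>
      refine ⟨h x (by simp) y (by simp) z (by simp) ?_ ?_ ?_, this⟩ <;>
      · simp at hn; tauto

end

section
variable {V : Type} [DecidableEq V] {c : Finset V → Bool}

theorem blueH_of_clique {S T : Finset V} {χ m : ℕ} (hT : T ⊆ S) (hc : T.card = χ * m)
    (hb : ∀ e ⊆ T, e.card = 3 → c e = false) : BlueH c S χ m := by
  have hcard : Fintype.card (Fin χ × Fin m) = Fintype.card T := by simp [hc]
  let f := Fintype.equivOfCardEq hcard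
  let g : Fin χ × Fin m → V := fun p => (f p : V)
  have hg : Function.Injective g := Subtype.val_injective.comp f.injective
  have hgT : ∀ p, g p ∈ T := fun p => (f p).2
  refine ⟨fun i => Finset.univ.image (fun x => g (i, x)), ?_, ?_, ?_, ?_⟩
  · intro i x hx
    obtain ⟨y, _, rfl⟩ := Finset.mem_image.1 hx
    exact hT (hgT _)
  · intro i
    rw [Finset.card_image_of_injective _ (fun a b h => (Prod.mk.inj (hg h)).2)]
    simp
  · intro i j hij
    rw [Finset.disjoint_left]
    rintro x hx hx'
    obtain ⟨y, _, rfl⟩ := Finset.mem_image.1 hx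
    obtain ⟨z, _, hz⟩ := Finset.mem_image.1 hx'
    exact hij (Prod.mk.inj (hg hz)).1.symm
  · intro i j hij x hx y hy hxy z hz
    obtain ⟨x, _, rfl⟩ := Finset.mem_image.1 hx
    obtain ⟨y, _, rfl⟩ := Finset.mem_image.1 hy
    obtain ⟨z, _, rfl⟩ := Finset.mem_image.1 hz
    apply hb
    · intro w hw
      simp only [Finset.mem_insert, Finset.mem_singleton] at hw
      rcases hw with rfl | rfl | rfl <;> exact hgT _
    · apply Finset.card_eq_three.2
      refine ⟨_, _, _, hxy, ?_, ?_, rfl⟩ <;>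
      · intro h
        exact hij.ne (Prod.mk.inj (hg h)).1

end

theorem clique_cover (χ m K : ℕ) (hK : 0 < K) : ∃ C : ℕ, ∀ (V : Type) [DecidableEq V]
    (c : Finset V → Bool) (S : Finset V), BlueH c S χ m ∨
    ∃ L : List (List V), (∀ s ∈ L, s.length = K ∧ Clq c s) ∧ L.flatten.Nodup ∧
      (∀ x ∈ L.flatten, x ∈ S) ∧ S.card ≤ L.flatten.length + C := by
  obtain ⟨C, hC⟩ := ramsey_aux_s10 3 K (χ * m)
  refine ⟨C, fun V _ c S => ?_⟩
  induction h : S.card using Nat.strong_induction_on generalizing S with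
  | _ n ih =>
  subst h
  by_cases hS : S.card < C
  · exact Or.inr ⟨[], by simp, by simp, by simp, by simp; omega⟩
  rcases hC V c S (by omega) with ⟨T, hT, hTc, hh⟩ | ⟨T, hT, hTc, hh⟩
  · have hcard := Finset.card_sdiff_of_subset hT
    have hle := Finset.card_le_card hT
    rcases ih (S \ T).card (by omega) (S \ T) rfl with hb | ⟨L, h1, h2, h3, h4⟩
    · exact Or.inl (hb.mono Finset.sdiff_subset)
    · right
      refine ⟨T.toList :: L, ?_, ?_, ?_, ?_⟩
      · intro s hs
        rcases List.mem_cons.1 hs with rfl | hs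
        · refine ⟨by simp [hTc], ?_⟩
          intro x hx y hy z hz hxy hxz hyz
          apply hh
          · intro w hw
            simp only [Finset.mem_insert, Finset.mem_singleton] at hw
            simp only [Finset.mem_toList] at hx hy hz
            rcases hw with rfl | rfl | rfl <;> assumption
          · exact Finset.card_eq_three.2 ⟨x, y, z, hxy, hxz, hyz, rfl⟩
        · exact h1 s hs
      · rw [List.flatten_cons, List.nodup_append']
        refine ⟨T.nodup_toList, h2, ?_⟩
        intro x hx hx'
        have := h3 x hx'
        simp at this hx
        exact this.2 hx
      · intro x hx
        rw [List.flatten_cons, List.mem_append] at hx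
        rcases hx with hx | hx
        · exact hT (by simpa using hx)
        · exact (Finset.mem_sdiff.1 (h3 x hx)).1
      · simp only [List.flatten_cons, List.length_append, Finset.length_toList]
        omega
  · exact Or.inl (blueH_of_clique hT hTc hh)

/-- every tournament on `Fin r` contains a transitive one on `χ` vertices -/
def TournProp (r χ : ℕ) : Prop :=
  ∀ T : Fin r → Fin r → Prop, IsTournament T → ContainsTransTourn T χ

/-- a strip: a sequence of red cliques of size `K` whose concatenation is a red tight path -/
def Strip {V : Type} [DecidableEq V] (c : Finset V → Bool) (K : ℕ) (U : List (List V)) : Prop :=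
  U ≠ [] ∧ (∀ s ∈ U, s.length = K ∧ Clq c s) ∧ Tight c U.flatten

section
variable {V : Type} [DecidableEq V] {c : Finset V → Bool}

theorem Strip.rev {K : ℕ} {U : List (List V)} (h : Strip c K U) :
    Strip c K (U.map List.reverse).reverse := by
  obtain ⟨h1, h2, h3⟩ := h
  refine ⟨by simpa using h1, ?_, ?_⟩
  · intro s hs
    simp only [List.mem_reverse, List.mem_map] at hs
    obtain ⟨t, ht, rfl⟩ := hs
    exact ⟨by simpa using (h2 t ht).1, (h2 t ht).2.mono (by simp)⟩
  · rw [← List.reverse_flatten]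
    exact h3.rev

/-- move two elements to the end -/
theorem move_two {l : List V} {x y : V} (hx : x ∈ l) (hy : y ∈ l) (hxy : x ≠ y) :
    ∃ l', (l' ++ [x, y]).Perm l := by
  refine ⟨(l.erase x).erase y, ?_⟩
  have hy' : y ∈ l.erase x := (List.mem_erase_of_ne hxy.symm).2 hy
  have h1 := List.perm_cons_erase hx
  have h2 := List.perm_cons_erase hy'
  refine List.perm_append_comm.trans ?_
  exact ((h2.cons x).symm.trans h1.symm)

/-- change the last two vertices of a strip -/
theorem Strip.change {K : ℕ} {U0 : List (List V)} {a b x y : V} {E0 : List V}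
    (h : Strip c K (U0 ++ [a :: b :: E0])) (hn : (a :: b :: E0).Nodup)
    (hx : x ∈ E0) (hy : y ∈ E0) (hxy : x ≠ y) :
    ∃ E1 : List V, Strip c K (U0 ++ [E1 ++ [x, y]]) ∧ (E1 ++ [x, y]).Perm (a :: b :: E0) := by
  obtain ⟨l', hl⟩ := move_two hx hy hxy
  have hp : (a :: b :: l' ++ [x, y]).Perm (a :: b :: E0) := (hl.cons b).cons a
  obtain ⟨h1, h2, h3⟩ := h
  have hE := h2 (a :: b :: E0) (by simp)
  have hq : Clq c (a :: b :: l' ++ [x, y]) := hE.2.mono (fun x hx => hp.subset hx)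
  refine ⟨a :: b :: l', ⟨by simp, ?_, ?_⟩, hp⟩
  · intro s hs
    rcases List.mem_append.1 hs with hs | hs
    · exact h2 s (by simp [hs])
    · rw [List.mem_singleton.1 hs]
      exact ⟨by rw [hp.length_eq, hE.1], hq⟩
  · have h4 : Tight c (U0.flatten ++ [a, b]) := by
      have : Tight c ((U0.flatten ++ [a, b]) ++ E0) := by simpa using h3
      exact this.left
    have := h4.glue (hq.tight (hp.nodup_iff.2 hn))
    simpa using this

theorem Strip.merge {K : ℕ} {U0 W0 : List (List V)} {a b x y a' b' z w : V} {E0 F0 : List V}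
    (h : Strip c K (U0 ++ [a :: b :: E0])) (hn : (a :: b :: E0).Nodup)
    (hx : x ∈ E0) (hy : y ∈ E0) (hxy : x ≠ y)
    (h' : Strip c K (W0 ++ [a' :: b' :: F0])) (hn' : (a' :: b' :: F0).Nodup)
    (hz : z ∈ F0) (hw : w ∈ F0) (hzw : z ≠ w) (h1 : c {x, y, z} = true) (h2 : c {z, w, y} = true) :
    ∃ Z : List (List V), Strip c K Z ∧ 
      Z.flatten.Perm ((U0 ++ [a :: b :: E0]).flatten ++ (W0 ++ [a' :: b' :: F0]).flatten) := by
  obtain ⟨E1, hE1, hpE⟩ := h.change hn hx hy hxy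
  obtain ⟨F1, hF1, hpF⟩ := h'.change hn' hw hz hzw.symm
  have hR := hF1.rev
  refine ⟨(U0 ++ [E1 ++ [x, y]]) ++ ((W0 ++ [F1 ++ [w, z]]).map List.reverse).reverse, ⟨?_, ?_, ?_⟩, ?_⟩
  · simp
  · intro s hs
    rcases List.mem_append.1 hs with hs | hs
    · exact hE1.2.1 s hs
    · exact hR.2.1 s hs
  · have t1 : Tight c ((U0.flatten ++ E1) ++ [x, y]) := by simpa using hE1.2.2
    have t2 : Tight c (z :: w :: (F1.reverse ++ (W0.map List.reverse).reverse.flatten)) := by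
      simpa using hR.2.2
    have t3 : Tight c ([x, y] ++ z :: w :: (F1.reverse ++ (W0.map List.reverse).reverse.flatten)) := by
      apply Tight.glue _ t2
      refine ⟨h1, ?_, trivial⟩
      have : ({y, z, w} : Finset V) = {z, w, y} := by ext u; simp; tauto
      rw [this]; exact h2
    have := t1.glue t3
    simpa using this
  · rw [List.flatten_append]
    apply List.Perm.append
    · simp only [List.flatten_append, List.flatten_singleton]
      exact hpE.append_left _
    · rw [← List.reverse_flatten]
      refine (List.reverse_perm _).trans ?_
      simp only [List.flatten_append, List.flatten_singleton]
      refine List.Perm.append_left _ (List.Perm.trans ?_ hpF)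
      exact List.Perm.refl _

end

theorem perm_pick {α : Type} (F : List α) (i j : ℕ) (hi : i < F.length) (hj : j < F.length)
    (hij : i ≠ j) : ∃ F', (F[i] :: F[j] :: F').Perm F := by
  have h1 := List.getElem_cons_eraseIdx_perm hi
  have h2 : F[j] ∈ F.eraseIdx i := List.mem_eraseIdx_iff_getElem.2 ⟨j, hj, hij.symm, rfl⟩
  obtain ⟨s, t, hst⟩ := List.append_of_mem h2
  refine ⟨s ++ t, List.Perm.trans (List.Perm.cons _ ?_) h1⟩
  rw [hst]
  exact List.perm_middle.symm

theorem flat_perm {V : Type} {F F' : List (List (List V))} (h : F.Perm F') :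
    (F.map List.flatten).flatten.Perm (F'.map List.flatten).flatten :=
  (h.map _).flatten

theorem merge_family (r χ m : ℕ) (hr : TournProp r χ) : ∃ K0 : ℕ, ∀ K, K0 ≤ K →
    ∀ (V : Type) [DecidableEq V] (c : Finset V → Bool) (S : Finset V) (F : List (List (List V))),
    (∀ U ∈ F, Strip c K U) → (F.map List.flatten).flatten.Nodup →
    (∀ x ∈ (F.map List.flatten).flatten, x ∈ S) → r ≤ F.length →
    BlueH c S χ m ∨ ∃ F' : List (List (List V)), (∀ U ∈ F', Strip c K U) ∧
      (F'.map List.flatten).flatten.Perm (F.map List.flatten).flatten ∧ F'.length < F.length := by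
  obtain ⟨s, hs⟩ := multi_hom r (max m 2)
  refine ⟨s + 2, fun K hK V _ c S F hF hn hS hrF => ?_⟩
  have hdec : ∀ i : Fin r, ∃ (U0 : List (List V)) (a b : V) (E0 : List V),
      F[i.1]'(lt_of_lt_of_le i.2 hrF) = U0 ++ [a :: b :: E0] ∧ s ≤ E0.length := by
    intro i
    have hi : i.1 < F.length := lt_of_lt_of_le i.2 hrF
    obtain ⟨h1, h2, h3⟩ := hF F[i.1] (List.getElem_mem hi)
    obtain ⟨U0, E, hU⟩ : ∃ U0 E, F[i.1] = U0 ++ [E] :=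
      ⟨_, _, (List.dropLast_append_getLast h1).symm⟩
    have hE := (h2 E (by simp [hU])).1
    match E, hE, hU with
    | [], hE, _ => simp at hE; omega
    | [_], hE, _ => simp at hE; omega
    | a :: b :: E0, hE, hU => exact ⟨U0, a, b, E0, hU, by simp at hE; omega⟩
  choose U0 a b E0 hU hE0 using hdec
  have hst : ∀ i, Strip c K (U0 i ++ [a i :: b i :: E0 i]) := fun i => by
    rw [← hU i]; exact hF _ (List.getElem_mem _)
  have hnd : ∀ i, (U0 i ++ [a i :: b i :: E0 i]).flatten.Nodup := fun i => by
    rw [← hU i]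
    exact (List.nodup_flatten.1 hn).1 _ (List.mem_map.2 ⟨_, List.getElem_mem _, rfl⟩)
  have hndE : ∀ i, (a i :: b i :: E0 i).Nodup := fun i => by
    have := hnd i
    rw [List.flatten_append, List.flatten_singleton] at this
    exact this.of_append_right
  have hndE0 : ∀ i, (E0 i).Nodup := fun i => (hndE i).of_cons.of_cons
  have hmem : ∀ i, ∀ x ∈ E0 i, x ∈ (U0 i ++ [a i :: b i :: E0 i]).flatten := by
    intro i x hx
    simp [hx]
  have hdisj : ∀ i j, i ≠ j → Disjoint (E0 i).toFinset (E0 j).toFinset := by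
    intro i j hij
    obtain ⟨F', hF'⟩ := perm_pick F i.1 j.1 (lt_of_lt_of_le i.2 hrF) (lt_of_lt_of_le j.2 hrF)
      (fun h => hij (Fin.ext h))
    have h1 := (flat_perm hF').nodup_iff.2 hn
    rw [hU, hU] at h1
    simp only [List.map_cons] at h1
    rw [List.flatten_cons, List.nodup_append'] at h1
    rw [Finset.disjoint_left]
    intro x hx hx'
    refine h1.2.2 (hmem i x (by simpa using hx)) ?_
    rw [List.flatten_cons]
    exact List.mem_append_left _ (hmem j x (by simpa using hx'))
  have hinS : ∀ i, (E0 i).toFinset ⊆ S := by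
    intro i x hx
    apply hS
    rw [List.mem_flatten]
    refine ⟨_, List.mem_map.2 ⟨_, List.getElem_mem (lt_of_lt_of_le i.2 hrF), rfl⟩, ?_⟩
    rw [hU]
    exact hmem i x (by simpa using hx)
  obtain ⟨E', hE', hEc, col, hcol⟩ := hs V c (fun i => (E0 i).toFinset)
    (fun i => by rw [List.toFinset_card_of_nodup (hndE0 i)]; exact hE0 i)
  by_cases hex : ∃ i j, i ≠ j ∧ col i j = true ∧ col j i = true
  · right
    obtain ⟨i, j, hij, c1, c2⟩ := hex
    obtain ⟨x, hx, y, hy, hxy⟩ := Finset.one_lt_card.1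
      (lt_of_lt_of_le (by norm_num) (le_trans (le_max_right m 2) (hEc i)))
    obtain ⟨z, hz, w, hw, hzw⟩ := Finset.one_lt_card.1
      (lt_of_lt_of_le (by norm_num) (le_trans (le_max_right m 2) (hEc j)))
    have m1 : ∀ i x, x ∈ E' i → x ∈ E0 i := fun i x hx => by simpa using hE' i hx
    obtain ⟨Z, hZ, hZp⟩ := (hst i).merge (hndE i) (m1 i x hx) (m1 i y hy) hxy (hst j) (hndE j)
      (m1 j z hz) (m1 j w hw) hzw (by rw [hcol i j hij x hx y hy hxy z hz, c1])
      (by rw [hcol j i hij.symm z hz w hw hzw y hy, c2])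
    obtain ⟨F', hF'⟩ := perm_pick F i.1 j.1 (lt_of_lt_of_le i.2 hrF) (lt_of_lt_of_le j.2 hrF)
      (fun h => hij (Fin.ext h))
    refine ⟨Z :: F', ?_, ?_, ?_⟩
    · intro U hU
      rcases List.mem_cons.1 hU with rfl | hU
      · exact hZ
      · exact hF U (hF'.subset (by simp [hU]))
    · refine List.Perm.trans ?_ (flat_perm hF')
      rw [hU, hU]
      simp only [List.map_cons]
      rw [List.flatten_cons, List.flatten_cons, List.flatten_cons, ← List.append_assoc]
      exact hZp.append_right _
    · rw [← hF'.length_eq]; simp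
  · left
    push Not at hex
    let T : Fin r → Fin r → Prop := fun i j => i ≠ j ∧ col i j = false ∧ (col j i = true ∨ i < j)
    have hT : IsTournament T := by
      refine ⟨fun v h => h.1 rfl, fun u v huv => ?_⟩
      have h1 := hex u v huv
      have h3 := lt_or_gt_of_ne huv
      simp only [T]
      cases h4 : col u v <;> cases h5 : col v u <;> simp_all <;> grind
    obtain ⟨f, hf, hfT⟩ := hr T hT
    refine ⟨fun i => E' (f i), fun i => (hE' _).trans (hinS _),
      fun i => le_trans (le_max_left _ _) (hEc _), ?_, ?_⟩
    · intro i j hij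
      exact Finset.disjoint_of_subset_left (hE' _) (Finset.disjoint_of_subset_right (hE' _)
        (hdisj _ _ (fun h => hij (hf h))))
    · intro i j hij x hx y hy hxy z hz
      have := hfT i j hij
      rw [hcol _ _ this.1 x hx y hy hxy z hz, this.2.1]

theorem long_strip (r χ m : ℕ) (hr : TournProp r χ) : ∃ K0 : ℕ, ∀ K, K0 ≤ K → ∃ C : ℕ,
    ∀ (V : Type) [DecidableEq V] (c : Finset V → Bool) (S : Finset V),
    BlueH c S χ m ∨ S.card ≤ C ∨ ∃ U : List (List V), Strip c K U ∧ U.flatten.Nodup ∧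
      (∀ x ∈ U.flatten, x ∈ S) ∧ S.card ≤ (r - 1) * U.flatten.length + C := by
  obtain ⟨K0, hK0⟩ := merge_family r χ m hr
  refine ⟨K0 + 1, fun K hK => ?_⟩
  obtain ⟨C, hC⟩ := clique_cover χ m K (by omega)
  refine ⟨C, fun V _ c S => ?_⟩
  rcases hC V c S with h | ⟨L, h1, h2, h3, h4⟩
  · exact Or.inl h
  by_cases hB : BlueH c S χ m
  · exact Or.inl hB
  right
  have main : ∀ k : ℕ, ∀ F : List (List (List V)), F.length = k → (∀ U ∈ F, Strip c K U) →
      (F.map List.flatten).flatten.Perm L.flatten →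
      ∃ F' : List (List (List V)), (∀ U ∈ F', Strip c K U) ∧
        (F'.map List.flatten).flatten.Perm L.flatten ∧ F'.length < r := by
    intro k
    induction k using Nat.strong_induction_on with
    | _ k ih =>
    intro F hk hF hp
    by_cases hl : F.length < r
    · exact ⟨F, hF, hp, hl⟩
    rcases hK0 K (by omega) V c S F hF (hp.nodup_iff.2 h2) (fun x hx => h3 x (hp.subset hx))
      (by omega) with h | ⟨F', h5, h6, h7⟩
    · exact absurd h hB
    · exact ih F'.length (by omega) F' rfl h5 (h6.trans hp)
  obtain ⟨F, hF, hp, hl⟩ := main _ (L.map (fun s => [s])) rfl (by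
    intro U hU
    obtain ⟨s, hs, rfl⟩ := List.mem_map.1 hU
    refine ⟨by simp, by simpa using h1 s hs, ?_⟩
    rw [List.flatten_singleton]
    exact (h1 s hs).2.tight ((List.nodup_flatten.1 h2).1 s hs)) (by
    rw [List.map_map]
    have : (List.flatten ∘ fun s : List V => [s]) = id := by funext s; simp
    rw [this, List.map_id])
  by_cases hne : F = []
  · left
    subst hne
    have := hp.length_eq
    simp at this
    simp at h4
    omega
  right
  by_contra hcon
  push Not at hcon
  have hsum : (F.map List.flatten).flatten.length + C < S.card := by
    have hmem : ∀ U ∈ F, (r - 1) * U.flatten.length + C < S.card := by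
      intro U hU
      apply hcon U (hF U hU)
      · exact (List.nodup_flatten.1 (hp.nodup_iff.2 h2)).1 _ (List.mem_map.2 ⟨_, hU, rfl⟩)
      · intro x hx
        exact h3 x (hp.subset (List.mem_flatten.2 ⟨_, List.mem_map.2 ⟨_, hU, rfl⟩, hx⟩))
    obtain ⟨U0, hU0⟩ := List.exists_mem_of_ne_nil F hne
    have hlt0 := hmem U0 hU0
    have hr1 : 0 < F.length := List.length_pos_iff.2 hne
    have hle : ∀ U ∈ F, U.flatten.length ≤ (S.card - C - 1) / (r - 1) := by
      intro U hU
      rw [Nat.le_div_iff_mul_le (by omega), mul_comm]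
      have := hmem U hU
      omega
    have : (F.map List.flatten).flatten.length ≤ F.length * ((S.card - C - 1) / (r - 1)) := by
      rw [List.length_flatten, List.map_map]
      have := List.sum_le_card_nsmul (F.map (List.length ∘ List.flatten)) ((S.card - C - 1) / (r - 1)) (by
        intro x hx
        obtain ⟨U, hU, rfl⟩ := List.mem_map.1 hx
        exact hle U hU)
      simpa using this
    have h5 : F.length * ((S.card - C - 1) / (r - 1)) ≤ (r - 1) * ((S.card - C - 1) / (r - 1)) :=
      Nat.mul_le_mul_right _ (by omega)
    have h6 := Nat.mul_div_le (S.card - C - 1) (r - 1)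
    omega
  rw [hp.length_eq] at hsum
  omega

section
variable {V : Type} [DecidableEq V] {c : Finset V → Bool}

theorem weave : ∀ (A Q : List V), Q.length = 2 * A.length + 2 → Q.Nodup →
    (∀ x ∈ Q, ∀ y ∈ Q, x ≠ y → ∀ z ∈ A, c {x, y, z} = true) →
    ∃ (l l' l'' : List V) (q1 q2 q3 q4 : V), l = q1 :: q2 :: l' ∧ l = l'' ++ [q3, q4] ∧
      q1 ∈ Q ∧ q2 ∈ Q ∧ q3 ∈ Q ∧ q4 ∈ Q ∧ q1 ≠ q2 ∧ q3 ≠ q4 ∧ l.Perm (Q ++ A) ∧ Tight c l := by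
  intro A
  induction A with
  | nil =>
    intro Q hQ hn _
    match Q, hQ, hn with
    | [x, y], _, hn =>
      simp at hn
      exact ⟨[x, y], [], [], x, y, x, y, rfl, rfl, by simp, by simp, by simp, by simp, hn, hn,
        by simp, trivial⟩
  | cons α A ih =>
    intro Q hQ hn hred
    match Q, hQ, hn, hred with
    | x :: y :: Q, hQ, hn, hred =>
      obtain ⟨l, l', l'', q1, q2, q3, q4, h1, h2, m1, m2, m3, m4, n1, n2, hp, ht⟩ := ih Q
        (by simp at hQ ⊢; omega) hn.of_cons.of_cons (fun u hu v hv huv z hz =>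
          hred u (by simp [hu]) v (by simp [hv]) huv z (by simp [hz]))
      have hxy : x ≠ y := by simp at hn; tauto
      have hyq : y ≠ q1 := by
        rintro rfl
        simp at hn; tauto
      refine ⟨x :: y :: α :: l, α :: l, x :: y :: α :: l'', x, y, q3, q4, rfl, by simp [h2],
        by simp, by simp, by simp [m3], by simp [m4], hxy, n2, ?_, ?_⟩
      · refine List.Perm.cons _ (List.Perm.cons _ ?_)
        exact (hp.cons α).trans List.perm_middle.symm
      · rw [h1] at ht ⊢
        refine ⟨hred x (by simp) y (by simp) hxy α (by simp), ?_, ?_, ht⟩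
        · have : ({y, α, q1} : Finset V) = {y, q1, α} := by ext u; simp; tauto
          rw [this]
          exact hred y (by simp) q1 (by simp [m1]) hyq α (by simp)
        · have : ({α, q1, q2} : Finset V) = {q1, q2, α} := by ext u; simp; tauto
          rw [this]
          exact hred q1 (by simp [m1]) q2 (by simp [m2]) n1 α (by simp)

/-- the potential -/
noncomputable def phi (c : Finset V → Bool) (s0 : ℕ) (L : List (List V)) : ℕ :=
  (L.map (fun s => if Clq c s then s.length - s0 else 0)).sum

theorem insert_step {s0 t : ℕ} {L1 L2 : List (List V)} {a b d e : V} {S0 : List V}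
    (hn : (L1 ++ [a :: b :: (S0 ++ [d, e])] ++ L2).flatten.Nodup)
    (ht : Tight c (L1 ++ [a :: b :: (S0 ++ [d, e])] ++ L2).flatten)
    (hq : Clq c (a :: b :: (S0 ++ [d, e])))
    {Q A : List V} (hQn : Q.Nodup) (hQ : ∀ x ∈ Q, x ∈ S0) (hQl : Q.length = 2 * t + 2)
    (hAl : A.length = t)
    (hred : ∀ x ∈ Q, ∀ y ∈ Q, x ≠ y → ∀ z ∈ A, c {x, y, z} = true) :
    ∃ L : List (List V),
      L.flatten.Perm ((L1 ++ [a :: b :: (S0 ++ [d, e])] ++ L2).flatten ++ A) ∧ Tight c L.flatten ∧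
      phi c s0 (L1 ++ [a :: b :: (S0 ++ [d, e])] ++ L2) ≤ phi c s0 L + (2 * t + 4) := by
  obtain ⟨l, l', l'', q1, q2, q3, q4, h1, h2, m1, m2, m3, m4, n1, n2, hp, htl⟩ :=
    weave A Q (by omega) hQn hred
  obtain ⟨R, hR⟩ : ∃ R, (Q ++ R).Perm S0 :=
    ((List.Sublist.exists_perm_append (List.subperm_of_subset hQn (fun x hx => hQ x hx)).choose_spec.2).imp
      fun _ h => ((List.subperm_of_subset hQn (fun x hx => hQ x hx)).choose_spec.1.symm.append_right _).trans h.symm)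
  have hSn : (a :: b :: (S0 ++ [d, e])).Nodup := by
    rw [List.flatten_append, List.flatten_append, List.flatten_singleton] at hn
    exact hn.of_append_left.of_append_right
  have hRsub : ∀ x ∈ R, x ∈ S0 := fun x hx => hR.subset (by simp [hx])
  have hnQR : (Q ++ (R ++ [d, e])).Nodup := by
    have h3 : (Q ++ (R ++ [d, e])).Perm (S0 ++ [d, e]) := by
      rw [← List.append_assoc]; exact hR.append_right _
    exact h3.nodup_iff.2 hSn.of_cons.of_cons
  refine ⟨L1 ++ [a :: b :: l, R ++ [d, e]] ++ L2, ?_, ?_, ?_⟩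
  · simp only [List.flatten_append, List.flatten_cons, List.flatten_nil,
      List.append_nil]
    have h3 : (a :: b :: l ++ (R ++ [d, e])).Perm ((a :: b :: (S0 ++ [d, e])) ++ A) := by
      refine List.Perm.cons _ (List.Perm.cons _ ?_)
      have h4 : (l ++ (R ++ [d, e])).Perm ((Q ++ A) ++ (R ++ [d, e])) := hp.append_right _
      refine h4.trans ?_
      have h5 : ((Q ++ A) ++ (R ++ [d, e])).Perm (Q ++ ((R ++ [d, e]) ++ A)) := by
        rw [List.append_assoc]
        exact List.perm_append_comm.append_left _
      refine h5.trans ?_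
      have h6 := hR.append_right ([d, e] ++ A)
      simpa using h6
    refine ((h3.append_left L1.flatten).append_right L2.flatten).trans ?_
    simp only [List.append_assoc]
    refine List.Perm.append_left _ ?_
    refine List.Perm.append_left _ ?_
    exact List.perm_append_comm
  · have t1 : Tight c (L1.flatten ++ [a, b]) := by
      have : Tight c ((L1.flatten ++ [a, b]) ++ (S0 ++ [d, e] ++ L2.flatten)) := by simpa using ht
      exact this.left
    have t5 : Tight c (d :: e :: L2.flatten) := by
      have : Tight c ((L1.flatten ++ (a :: b :: S0)) ++ (d :: e :: L2.flatten)) := by simpa using ht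
      exact this.right
    have t2 : Tight c ([a, b] ++ [q1, q2]) := by
      apply Clq.tight
      · refine hq.mono ?_
        intro x hx
        simp at hx
        rcases hx with rfl | rfl | rfl | rfl
        · simp
        · simp
        · simp [hQ _ m1]
        · simp [hQ _ m2]
      · have h1 := hQ _ m1
        have h2 := hQ _ m2
        simp at hSn ⊢
        grind
    have t4 : Tight c ([q3, q4] ++ (R ++ [d, e])) := by
      apply Clq.tight
      · refine hq.mono ?_
        intro x hx
        simp at hx
        rcases hx with rfl | rfl | hx | rfl | rfl
        · simp [hQ _ m3]
        · simp [hQ _ m4]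
        · simp [hRsub _ hx]
        · simp
        · simp
      · rw [List.nodup_append'] at hnQR ⊢
        refine ⟨by simpa using n2, hnQR.2.1, ?_⟩
        intro x hx
        apply hnQR.2.2
        simp at hx
        rcases hx with rfl | rfl <;> assumption
    have g1 : Tight c (([q3, q4] ++ R) ++ d :: e :: L2.flatten) :=
      Tight.glue (by simpa using t4) t5
    have g2 : Tight c (l'' ++ q3 :: q4 :: (R ++ d :: e :: L2.flatten)) :=
      Tight.glue (by rw [← h2]; exact htl) (by simpa using g1)
    have g3 : Tight c (q1 :: q2 :: (l' ++ (R ++ d :: e :: L2.flatten))) := by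
      have h3 : l'' ++ q3 :: q4 :: (R ++ d :: e :: L2.flatten) = l ++ (R ++ d :: e :: L2.flatten) := by
        rw [h2]; simp
      rw [h3, h1] at g2
      simpa using g2
    have g4 := Tight.glue t2 g3
    have g5 := Tight.glue t1 g4
    rw [h1]
    simpa using g5
  · have hc2 : Clq c (R ++ [d, e]) := hq.mono (by
      intro x hx
      simp at hx
      rcases hx with hx | rfl | rfl
      · simp [hRsub _ hx]
      · simp
      · simp)
    have hlen := hR.length_eq
    simp only [List.length_append] at hlen
    simp only [phi, List.map_append, List.map_cons, List.map_nil, List.sum_append, List.sum_cons,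
      List.sum_nil, hq, hc2, if_true, List.length_cons, List.length_append]
    simp only [List.length_nil]
    omega

theorem exists_of_phi_pos {s0 : ℕ} {L : List (List V)} (h : phi c s0 L ≠ 0) :
    ∃ s ∈ L, Clq c s ∧ s0 < s.length := by
  by_contra hcon
  push Not at hcon
  apply h
  unfold phi
  apply List.sum_eq_zero
  intro x hx
  obtain ⟨s, hs, rfl⟩ := List.mem_map.1 hx
  split_ifs with h1
  · have := hcon s hs h1
    omega
  · rfl
end

theorem block (χ m t : ℕ) : ∃ s : ℕ, ∀ (V : Type) [DecidableEq V]
    (c : Finset V → Bool) (S Y Q : Finset V), Y ⊆ S → Q ⊆ S → Disjoint Q Y → s ≤ Q.card →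
    BlueH c Y χ s → BlueH c S (χ + 1) m ∨ ∃ Q' ⊆ Q, ∃ A ⊆ Y, Q'.card = 2 * t + 2 ∧ A.card = t ∧
      ∀ x ∈ Q', ∀ y ∈ Q', x ≠ y → ∀ z ∈ A, c {x, y, z} = true := by
  obtain ⟨s, hs⟩ := multi_hom (χ + 1) (max m (2 * t + 2))
  refine ⟨s, fun V _ c S Y Q hY hQ hd hQs ⟨B, hB1, hB2, hB3, hB4⟩ => ?_⟩
  obtain ⟨E', h1, h2, b, hb⟩ := hs V c (Fin.cons Q B) (by
    intro i
    refine Fin.cases ?_ (fun i => ?_) i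
    · simpa using hQs
    · simpa using hB2 i)
  have e0 : E' 0 ⊆ Q := by simpa using h1 0
  have es : ∀ i : Fin χ, E' i.succ ⊆ B i := fun i => by simpa using h1 i.succ
  by_cases hex : ∃ i : Fin χ, b 0 i.succ = true
  · right
    obtain ⟨i, hi⟩ := hex
    have := h2 0
    have := h2 i.succ
    obtain ⟨Q', hQ', hQc⟩ := Finset.exists_subset_card_eq (show 2 * t + 2 ≤ (E' 0).card by omega)
    obtain ⟨A, hA, hAc⟩ := Finset.exists_subset_card_eq (show t ≤ (E' i.succ).card by omega)
    refine ⟨Q', hQ'.trans e0, A, hA.trans ((es i).trans (hB1 i)), hQc, hAc, ?_⟩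
    intro x hx y hy hxy z hz
    rw [hb 0 i.succ (Fin.succ_ne_zero i).symm x (hQ' hx) y (hQ' hy) hxy z (hA hz), hi]
  · left
    have hex' : ∀ i : Fin χ, b 0 i.succ = false := by simpa using hex
    have hd' : ∀ i : Fin χ, Disjoint (E' 0) (E' i.succ) := fun i =>
      Finset.disjoint_of_subset_left e0 (Finset.disjoint_of_subset_right ((es i).trans (hB1 i)) hd)
    refine ⟨E', ?_, fun i => le_trans (le_max_left _ _) (h2 i), ?_, ?_⟩
    · intro i
      refine Fin.cases ?_ (fun i => ?_) i
      · exact e0.trans hQ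
      · exact (es i).trans ((hB1 i).trans hY)
    · intro i j
      refine Fin.cases ?_ (fun i => ?_) i <;> refine Fin.cases ?_ (fun j => ?_) j
      · intro h; exact absurd rfl h
      · intro _; exact hd' j
      · intro _; exact (hd' i).symm
      · intro h
        exact Finset.disjoint_of_subset_left (es i) (Finset.disjoint_of_subset_right (es j)
          (hB3 i j (fun h' => h (by rw [h']))))
    · intro i j
      refine Fin.cases ?_ (fun i => ?_) i <;> refine Fin.cases ?_ (fun j => ?_) j
      · intro h; exact absurd h (lt_irrefl _)
      · intro h x hx y hy hxy z hz
        rw [hb 0 j.succ h.ne x hx y hy hxy z hz, hex']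
      · intro h; exact absurd h (Fin.not_lt_zero _)
      · intro h x hx y hy hxy z hz
        exact hB4 i j (Fin.succ_lt_succ_iff.1 h) x (es i hx) y (es i hy) hxy z (es j hz)

theorem extend (χ m t : ℕ) (ht : 0 < t) : ∃ s : ℕ, ∀ (V : Type) [DecidableEq V]
    (c : Finset V → Bool) (S : Finset V) (n F : ℕ),
    (∀ Y ⊆ S, F ≤ Y.card → RedPath c Y n ∨ BlueH c Y χ s) → n + F ≤ S.card →
    ∀ L : List (List V), L.flatten.Nodup → (∀ x ∈ L.flatten, x ∈ S) → Tight c L.flatten →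
    (2 * t + 4) * n ≤ (2 * t + 4) * L.flatten.length + t * phi c s L →
    RedPath c S n ∨ BlueH c S (χ + 1) m := by
  obtain ⟨s, hs⟩ := block χ m t
  refine ⟨s + 4, fun V _ c S n F hF hSn => ?_⟩
  suffices H : ∀ k : ℕ, ∀ L : List (List V), S.card - L.flatten.length = k → L.flatten.Nodup →
      (∀ x ∈ L.flatten, x ∈ S) → Tight c L.flatten →
      (2 * t + 4) * n ≤ (2 * t + 4) * L.flatten.length + t * phi c (s + 4) L →
      RedPath c S n ∨ BlueH c S (χ + 1) m from fun L => H _ L rfl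
  intro k
  induction k using Nat.strong_induction_on with
  | _ k ih =>
  intro L hk hLn hLS hLt hM
  by_cases hlen : n ≤ L.flatten.length
  · exact Or.inl ⟨_, hLn, hLS, hlen, hLt⟩
  have hphi : phi c (s + 4) L ≠ 0 := by
    intro h0
    rw [h0] at hM
    apply hlen
    exact Nat.le_of_mul_le_mul_left (by simpa using hM) (by omega : 0 < 2 * t + 4)
  obtain ⟨q, hqL, hqc, hql⟩ := exists_of_phi_pos hphi
  obtain ⟨L1, L2, rfl⟩ := List.append_of_mem hqL
  obtain ⟨a, b, S0, d, e, rfl⟩ : ∃ a b S0 d e, q = a :: b :: (S0 ++ [d, e]) := by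
    match q, hql with
    | a :: b :: q', hql =>
      simp at hql
      rcases List.eq_nil_or_concat q' with rfl | ⟨q'', e, rfl⟩
      · simp at hql
      rcases List.eq_nil_or_concat q'' with rfl | ⟨q3, d, rfl⟩
      · simp at hql
      exact ⟨a, b, q3, d, e, by simp⟩
  have hLe : L1 ++ (a :: b :: (S0 ++ [d, e])) :: L2 = L1 ++ [a :: b :: (S0 ++ [d, e])] ++ L2 := by
    simp
  rw [hLe] at hk hLn hLS hLt hM hlen
  clear hqL hphi
  generalize hP : (L1 ++ [a :: b :: (S0 ++ [d, e])] ++ L2).flatten = P at *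
  have hmem : ∀ x ∈ S0, x ∈ P := fun x hx => by rw [← hP]; simp [hx]
  have hPc : P.toFinset.card = P.length := List.toFinset_card_of_nodup hLn
  have hPS : P.toFinset ⊆ S := fun x hx => hLS x (by simpa using hx)
  have hYc := Finset.card_sdiff_of_subset hPS
  have hS0n : S0.Nodup := by
    rw [← hP, List.flatten_append, List.flatten_append, List.flatten_singleton] at hLn
    exact hLn.of_append_left.of_append_right.of_cons.of_cons.of_append_left
  rcases hF (S \ P.toFinset) Finset.sdiff_subset (by omega) with h | h
  · exact Or.inl (h.mono Finset.sdiff_subset)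
  have h' : BlueH c (S \ P.toFinset) χ s := by
    obtain ⟨A, h1, h2, h3⟩ := h
    exact ⟨A, h1, fun i => le_trans (by omega) (h2 i), h3⟩
  rcases hs V c S (S \ P.toFinset) S0.toFinset Finset.sdiff_subset
    (fun x hx => hLS x (hmem x (by simpa using hx))) (by
      rw [Finset.disjoint_left]
      intro x hx hx'
      simp at hx hx'
      exact hx'.2 (hmem x hx)) (by
      rw [List.toFinset_card_of_nodup hS0n]
      simp at hql
      omega) h' with h | ⟨Q', hQ', A, hA, hQc, hAc, hred⟩
  · exact Or.inr h
  obtain ⟨L', hp, hLt', hphi'⟩ := insert_step (s0 := s + 4) (t := t) (by rw [hP]; exact hLn) (by rw [hP]; exact hLt)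
    hqc (Q := Q'.toList) (A := A.toList) Q'.nodup_toList
    (fun x hx => by simpa using hQ' (by simpa using hx)) (by simpa using hQc) (by simpa using hAc)
    (by simpa using hred)
  rw [hP] at hp
  have hn' : (P ++ A.toList).Nodup := by
    rw [List.nodup_append']
    refine ⟨hLn, A.nodup_toList, ?_⟩
    intro x hx hx'
    have := hA (by simpa using hx')
    simp at this
    exact this.2 hx
  have hsub : ∀ x ∈ P ++ A.toList, x ∈ S := by
    intro x hx
    rcases List.mem_append.1 hx with hx | hx
    · exact hLS x hx
    · exact (Finset.mem_sdiff.1 (hA (by simpa using hx))).1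
  have hlen' := hp.length_eq
  rw [List.length_append, Finset.length_toList, hAc] at hlen'
  have hle := Finset.card_le_card hPS
  refine ih _ ?_ L' rfl (hp.nodup_iff.2 hn') (fun x hx => hsub x (hp.subset hx)) hLt' ?_
  · omega
  · rw [hlen']
    have := Nat.mul_le_mul_left t hphi'
    nlinarith

theorem phi_strip {V : Type} [DecidableEq V] {c : Finset V → Bool} {K s : ℕ} :
    ∀ (U : List (List V)), (∀ u ∈ U, u.length = K ∧ Clq c u) →
    phi c s U = (K - s) * U.length ∧ U.flatten.length = K * U.length := by
  intro U
  induction U with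
  | nil => intro _; simp [phi]
  | cons u U ih =>
    intro h
    obtain ⟨h1, h2⟩ := ih (fun v hv => h v (by simp [hv]))
    obtain ⟨h3, h4⟩ := h u (by simp)
    unfold phi at h1 ⊢
    rw [List.map_cons, List.sum_cons, h1, if_pos h4, h3, List.flatten_cons, List.length_append, h2, h3,
      List.length_cons]
    constructor <;> ring

theorem main_step (r χ m : ℕ) (hr : TournProp r (χ + 1)) (hr2 : 2 ≤ r) (ε : ℝ) (hε : 0 < ε) :
    ∃ m' n₀ : ℕ, ∀ n, n₀ ≤ n → ∀ (V : Type) [DecidableEq V] (c : Finset V → Bool) (S : Finset V)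
    (F : ℕ), (∀ Y ⊆ S, F ≤ Y.card → RedPath c Y n ∨ BlueH c Y χ m') → n + F ≤ S.card →
    (2 / 3 + ε) * ((r : ℝ) - 1) * n ≤ S.card + 1 → RedPath c S n ∨ BlueH c S (χ + 1) m := by
  obtain ⟨a, ha⟩ : ∃ a : ℝ, a = 2 / 3 + ε / 2 := ⟨_, rfl⟩
  have ha0 : 0 < a := by rw [ha]; positivity
  obtain ⟨η, hη⟩ : ∃ η : ℝ, η = 3 / 2 - 1 / a := ⟨_, rfl⟩
  have hη0 : 0 < η := by
    rw [hη, sub_pos, div_lt_div_iff₀ ha0 (by norm_num)]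
    linarith
  have haη : a * (3 / 2 - η) = 1 := by rw [hη]; field_simp; ring
  obtain ⟨t0, ht0⟩ := exists_nat_ge (2 / η)
  obtain ⟨t, htdef⟩ : ∃ t, t = t0 + 1 := ⟨_, rfl⟩
  have ht : 2 ≤ t * η := by
    rw [div_le_iff₀ hη0] at ht0
    rw [htdef]; push_cast; nlinarith
  obtain ⟨s, hs⟩ := extend χ m t (by omega)
  obtain ⟨K0, hK0⟩ := long_strip r (χ + 1) m hr
  obtain ⟨k1, hk1⟩ := exists_nat_ge ((s : ℝ) / η)
  obtain ⟨K, hKdef⟩ : ∃ K, K = K0 + k1 + s := ⟨_, rfl⟩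
  have hK : (s : ℝ) ≤ η * K := by
    rw [div_le_iff₀ hη0] at hk1
    rw [hKdef]; push_cast
    nlinarith [mul_nonneg hη0.le (Nat.cast_nonneg (α := ℝ) K0), mul_nonneg hη0.le (Nat.cast_nonneg (α := ℝ) s)]
  obtain ⟨C, hC⟩ := hK0 K (by omega)
  obtain ⟨n₀, hn₀⟩ := exists_nat_ge (((C : ℝ) + 2) / (ε / 2))
  refine ⟨s, n₀, fun n hn V _ c S F hF hSn hSc => ?_⟩
  have hrR : (1 : ℝ) ≤ (r : ℝ) - 1 := by
    have : (2 : ℝ) ≤ r := by exact_mod_cast hr2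
    linarith
  have hnC : (C : ℝ) + 2 ≤ ε / 2 * n := by
    rw [div_le_iff₀ (by positivity)] at hn₀
    have : (n₀ : ℝ) ≤ n := by exact_mod_cast hn
    nlinarith
  have hbig : (C : ℝ) + 2 ≤ ε / 2 * ((r : ℝ) - 1) * n := by
    nlinarith [mul_nonneg (mul_nonneg hε.le (sub_nonneg.2 hrR)) (Nat.cast_nonneg (α := ℝ) n)]
  have han : 0 ≤ a * n * ((r : ℝ) - 1) := by positivity
  have hsplit : (2 / 3 + ε) * ((r : ℝ) - 1) * n = a * n * ((r : ℝ) - 1) + ε / 2 * ((r : ℝ) - 1) * n := by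
    rw [ha]; ring
  rcases hC V c S with h | h | ⟨U, hU, hUn, hUS, hUc⟩
  · exact Or.inr h
  · exfalso
    have : (S.card : ℝ) ≤ C := by exact_mod_cast h
    linarith
  · refine hs V c S n F hF hSn U hUn hUS hU.2.2 ?_
    obtain ⟨e1, e2⟩ := phi_strip (s := s) U hU.2.1
    have hUc' : (S.card : ℝ) ≤ ((r : ℝ) - 1) * U.flatten.length + C := by
      have : ((r - 1 : ℕ) : ℝ) = (r : ℝ) - 1 := by push_cast [show 1 ≤ r by omega]; ring
      rw [← this]; exact_mod_cast hUc
    have hl : a * n ≤ U.flatten.length := by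
      have : a * n * ((r : ℝ) - 1) ≤ U.flatten.length * ((r : ℝ) - 1) := by linarith
      exact le_of_mul_le_mul_right this (by linarith)
    have hphi : (1 - η) * (U.flatten.length : ℝ) ≤ (phi c s U : ℝ) := by
      rw [e1, e2]
      push_cast [show s ≤ K by omega]
      have : (0 : ℝ) ≤ U.length := Nat.cast_nonneg _
      nlinarith
    have htR : (0 : ℝ) ≤ t := Nat.cast_nonneg _
    have goal : ((2 * t + 4) * n : ℝ) ≤ (2 * t + 4) * U.flatten.length + t * phi c s U := by
      have s1 : (t : ℝ) * ((1 - η) * (U.flatten.length : ℝ)) ≤ t * phi c s U :=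
        mul_le_mul_of_nonneg_left hphi htR
      have hl0 : (0 : ℝ) ≤ U.flatten.length := Nat.cast_nonneg _
      have hη32 : 0 < 3 / 2 - η := by
        by_contra hc
        push Not at hc
        nlinarith
      have s2 : ((2 * t + 4) * n : ℝ) ≤ (2 * t + 4) * (3 / 2 - η) * U.flatten.length := by
        have : (n : ℝ) ≤ (3 / 2 - η) * U.flatten.length := by
          calc (n : ℝ) = (a * (3 / 2 - η)) * n := by rw [haη, one_mul]
            _ = (3 / 2 - η) * (a * n) := by ring
            _ ≤ _ := mul_le_mul_of_nonneg_left hl hη32.le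
        calc ((2 * t + 4) * n : ℝ) ≤ (2 * t + 4) * ((3 / 2 - η) * U.flatten.length) :=
              mul_le_mul_of_nonneg_left this (by positivity)
          _ = _ := by ring
      have s3 : (2 * t + 4) * (3 / 2 - η) * (U.flatten.length : ℝ) ≤
          ((2 * t + 4) + t * (1 - η)) * U.flatten.length := by
        apply mul_le_mul_of_nonneg_right _ hl0
        nlinarith
      have s4 : ((2 * t + 4) + t * (1 - η)) * (U.flatten.length : ℝ) =
          (2 * t + 4) * U.flatten.length + t * ((1 - η) * (U.flatten.length : ℝ)) := by ring
      linarith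
    exact_mod_cast goal

theorem tourn_two : TournProp 2 2 := by
  intro T hT
  by_cases h : T 0 1
  · refine ⟨id, Function.injective_id, ?_⟩
    intro i j hij
    have hi : i = 0 := by omega
    have hj : j = 1 := by omega
    subst hi hj; exact h
  · refine ⟨Fin.rev, Fin.rev_injective, ?_⟩
    intro i j hij
    have hi : i = 0 := by omega
    have hj : j = 1 := by omega
    subst hi hj
    exact (hT.2 1 0 (by simp)).2 h

theorem main_two (m : ℕ) : ∃ C : ℕ, ∀ (n : ℕ) (V : Type) [DecidableEq V] (c : Finset V → Bool)
    (S : Finset V), n + C ≤ S.card → RedPath c S n ∨ BlueH c S 2 m := by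
  obtain ⟨K0, hK0⟩ := long_strip 2 2 m tourn_two
  obtain ⟨C, hC⟩ := hK0 K0 le_rfl
  refine ⟨C + 1, fun n V _ c S hS => ?_⟩
  rcases hC V c S with h | h | ⟨U, hU, hUn, hUS, hUc⟩
  · exact Or.inr h
  · omega
  · exact Or.inl ⟨_, hUn, hUS, by omega, hU.2.2⟩

/-- the set defining the tournament Ramsey number -/
def dirSet (ℓ : ℕ) : Set ℕ := {N : ℕ | ∀ M : ℕ, N ≤ M → ∀ T : Fin M → Fin M → Prop,
    IsTournament T → ContainsTransTourn T ℓ}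

theorem dirSet_nonempty (ℓ : ℕ) : (dirSet ℓ).Nonempty := by
  obtain ⟨N, hN⟩ := ramsey_aux_s10 2 ℓ ℓ
  refine ⟨N, fun M hM T hT => ?_⟩
  rcases hN (Fin M) (fun e => decide (∃ i j, i < j ∧ e = {i, j} ∧ T i j)) Finset.univ (by simpa using hM) with
    ⟨A, -, hA, h⟩ | ⟨A, -, hA, h⟩
  · refine ⟨A.orderEmbOfFin hA, (A.orderEmbOfFin hA).injective, fun i j hij => ?_⟩
    have hlt : A.orderEmbOfFin hA i < A.orderEmbOfFin hA j := (A.orderEmbOfFin hA).strictMono hij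
    have := h {A.orderEmbOfFin hA i, A.orderEmbOfFin hA j} (by
      intro x hx
      simp only [Finset.mem_insert, Finset.mem_singleton] at hx
      rcases hx with rfl | rfl <;> exact Finset.orderEmbOfFin_mem _ _ _) (Finset.card_pair hlt.ne)
    obtain ⟨x, y, hxy, he, hT'⟩ := of_decide_eq_true this
    generalize A.orderEmbOfFin hA i = u at *
    generalize A.orderEmbOfFin hA j = v at *
    have hx : x ∈ ({u, v} : Finset (Fin M)) := by rw [he]; simp
    have hy : y ∈ ({u, v} : Finset (Fin M)) := by rw [he]; simp
    simp only [Finset.mem_insert, Finset.mem_singleton] at hx hy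
    rcases hx with rfl | rfl <;> rcases hy with rfl | rfl
    · exact absurd hxy (lt_irrefl _)
    · exact hT'
    · exact absurd hxy (not_lt_of_gt hlt)
    · exact absurd hxy (lt_irrefl _)
  · refine ⟨fun i => A.orderEmbOfFin hA i.rev, (A.orderEmbOfFin hA).injective.comp Fin.rev_injective,
      fun i j hij => ?_⟩
    have hlt : A.orderEmbOfFin hA j.rev < A.orderEmbOfFin hA i.rev :=
      (A.orderEmbOfFin hA).strictMono (Fin.rev_lt_rev.2 hij)
    have := h {A.orderEmbOfFin hA j.rev, A.orderEmbOfFin hA i.rev} (by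
      intro x hx
      simp only [Finset.mem_insert, Finset.mem_singleton] at hx
      rcases hx with rfl | rfl <;> exact Finset.orderEmbOfFin_mem _ _ _) (Finset.card_pair hlt.ne)
    have h2 := of_decide_eq_false this
    rw [hT.2 _ _ hlt.ne']
    intro h3
    exact h2 ⟨_, _, hlt, rfl, h3⟩

theorem dirRamsey_mem (ℓ : ℕ) : dirRamsey ℓ ∈ dirSet ℓ := Nat.sInf_mem (dirSet_nonempty ℓ)

theorem dirRamsey_tourn (ℓ : ℕ) : TournProp (dirRamsey ℓ) ℓ := fun T hT =>
  dirRamsey_mem ℓ _ le_rfl T hT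

theorem dirRamsey_ge (ℓ : ℕ) : ℓ ≤ dirRamsey ℓ := by
  obtain ⟨f, hf, _⟩ := dirRamsey_tourn ℓ (fun i j => i < j)
    ⟨fun v => lt_irrefl v, fun u v huv => by
      constructor
      · intro h; exact not_lt_of_gt h
      · intro h; exact lt_of_le_of_ne (not_lt.1 h) huv⟩
  simpa using Fintype.card_le_of_injective f hf

theorem dirRamsey_succ (ℓ : ℕ) (hℓ : 2 ≤ ℓ) : dirRamsey ℓ + 2 ≤ dirRamsey (ℓ + 1) := by
  have hge := dirRamsey_ge ℓ
  have hnot : dirRamsey ℓ - 1 ∉ dirSet ℓ := fun h => by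
    have : dirRamsey ℓ ≤ dirRamsey ℓ - 1 := Nat.sInf_le h
    omega
  simp only [dirSet, Set.mem_ofPred_eq, not_forall] at hnot
  obtain ⟨M, hM, T, hT, hTT⟩ := hnot
  by_contra hcon
  have hM1 : 0 < M := by omega
  let π : Fin (M + 2) → Fin M := fun x => if h : x.1 < M then ⟨x.1, h⟩ else ⟨0, hM1⟩
  have hπ : ∀ x y : Fin (M + 2), x ≠ y → π x = π y →
      (x.1 = 0 ∨ x.1 = M ∨ x.1 = M + 1) ∧ (y.1 = 0 ∨ y.1 = M ∨ y.1 = M + 1) := by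
    intro x y hxy h
    have hx := x.2
    have hy := y.2
    have hne : x.1 ≠ y.1 := fun h => hxy (Fin.ext h)
    simp only [π] at h
    split_ifs at h with h1 h2 h2 <;> simp only [Fin.mk.injEq] at h <;> omega
  let cyc : Fin (M + 2) → Fin (M + 2) → Prop := fun x y =>
    (x.1 = 0 ∧ y.1 = M) ∨ (x.1 = M ∧ y.1 = M + 1) ∨ (x.1 = M + 1 ∧ y.1 = 0)
  let T' : Fin (M + 2) → Fin (M + 2) → Prop := fun x y =>
    (π x ≠ π y ∧ T (π x) (π y)) ∨ (π x = π y ∧ cyc x y)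
  have hT' : IsTournament T' := by
    refine ⟨?_, ?_⟩
    · rintro v (h | h)
      · exact h.1 rfl
      · have := h.2
        simp only [cyc] at this
        omega
    · intro u v huv
      by_cases h : π u = π v
      · have h2 := hπ u v huv h
        have hne : u.1 ≠ v.1 := fun h => huv (Fin.ext h)
        simp only [T', h, cyc]
        simp only [ne_eq, not_true_eq_false, false_and, true_and, false_or]
        omega
      · have h3 := hT.2 _ _ h
        have h4 : ¬ π v = π u := fun h' => h h'.symm
        simp only [T', h, h4, ne_eq, not_false_eq_true, true_and, false_and, or_false]
        exact h3
  obtain ⟨f, hf, hfT⟩ := dirRamsey_mem (ℓ + 1) (M + 2) (by omega) T' hT'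
  have hcyc : ∀ i j, i < j → π (f i) = π (f j) → cyc (f i) (f j) := by
    intro i j hij h
    rcases hfT i j hij with h' | h'
    · exact absurd h h'.1
    · exact h'.2
  have no3 : ∀ i j k, i < j → j < k → π (f i) = π (f j) → π (f j) = π (f k) → False := by
    intro i j k hij hjk h1 h2
    have a1 := hcyc i j hij h1
    have a2 := hcyc j k hjk h2
    have a3 := hcyc i k (hij.trans hjk) (h1.trans h2)
    simp only [cyc] at a1 a2 a3
    omega
  have hp0 : ∀ i j, i ≠ j → π (f i) = π (f j) → π (f i) = ⟨0, hM1⟩ := by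
    intro i j hij h
    have h1 := (hπ (f i) (f j) (fun h => hij (hf h)) h).1
    simp only [π]
    split_ifs with h2
    · apply Fin.ext
      show (f i).1 = 0
      omega
    · rfl
  have no3' : ∀ i j k, i ≠ j → j ≠ k → i ≠ k → π (f i) = π (f j) → π (f j) = π (f k) → False := by
    intro i j k hij hjk hik h1 h2
    rcases lt_or_gt_of_ne hij with a | a <;> rcases lt_or_gt_of_ne hjk with b | b <;>
      rcases lt_or_gt_of_ne hik with d | d
    · exact no3 i j k a b h1 h2
    · exact no3 i j k a b h1 h2
    · exact no3 i k j d b (h1.trans h2) h2.symm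
    · exact no3 k i j d a (h1.trans h2).symm h1
    · exact no3 j i k a d h1.symm (h1.trans h2)
    · exact no3 j k i b d h2 (h1.trans h2).symm
    · exact no3 k j i b a h2.symm h1.symm
    · exact no3 k j i b a h2.symm h1.symm
  have hdrop : ∃ i : Fin (ℓ + 1), Function.Injective (fun k : Fin ℓ => π (f (i.succAbove k))) := by
    by_cases hinj : Function.Injective (fun k => π (f k))
    · exact ⟨0, hinj.comp Fin.succAbove_right_injective⟩
    · simp only [Function.Injective, not_forall] at hinj
      obtain ⟨i, j, hij, hne⟩ := hinj
      refine ⟨i, fun k l hkl => ?_⟩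
      by_contra hkl'
      have hkl2 : i.succAbove k ≠ i.succAbove l := fun h => hkl' (Fin.succAbove_right_injective h)
      have e1 := hp0 _ _ hne hij
      have e2 := hp0 _ _ hkl2 hkl
      exact no3' i _ _ (Fin.succAbove_ne i k).symm hkl2 (Fin.succAbove_ne i l).symm
        (e1.trans e2.symm) hkl
  obtain ⟨i, hi⟩ := hdrop
  apply hTT
  refine ⟨_, hi, fun k l hkl => ?_⟩
  rcases hfT (i.succAbove k) (i.succAbove l) (Fin.succAbove_lt_succAbove_iff.2 hkl) with h | h
  · exact h.2
  · exact absurd (hi h.1) hkl.ne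

theorem main_ge3 (χ : ℕ) (hχ : 3 ≤ χ) : ∀ (m : ℕ) (ε : ℝ), 0 < ε →
    ∃ n₀ : ℕ, ∀ n, n₀ ≤ n → ∀ (V : Type) [DecidableEq V] (c : Finset V → Bool) (S : Finset V),
    (2 / 3 + ε) * ((dirRamsey χ : ℝ) - 1) * n ≤ S.card + 1 → RedPath c S n ∨ BlueH c S χ m := by
  induction χ, hχ using Nat.le_induction with
  | base =>
    intro m ε hε
    have hR : 4 ≤ dirRamsey 3 := by
      have := dirRamsey_ge 2
      have : dirRamsey 2 + 2 ≤ dirRamsey 3 := dirRamsey_succ 2 le_rfl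
      omega
    obtain ⟨m', n₀, h⟩ := main_step (dirRamsey 3) 2 m (dirRamsey_tourn 3) (by omega) ε hε
    obtain ⟨C, hC⟩ := main_two m'
    obtain ⟨n₁, hn₁⟩ := exists_nat_ge (((C : ℝ) + 1) / ε)
    refine ⟨max n₀ n₁, fun n hn V _ c S hS => ?_⟩
    refine h n (le_trans (le_max_left _ _) hn) V c S (n + C) (fun Y _ hY => hC n V c Y hY) ?_ hS
    have h1 : (C : ℝ) + 1 ≤ ε * n := by
      rw [div_le_iff₀ hε] at hn₁
      have : (n₁ : ℝ) ≤ n := by exact_mod_cast (le_trans (le_max_right _ _) hn)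
      nlinarith
    have h2 : (3 : ℝ) ≤ (dirRamsey 3 : ℝ) - 1 := by
      have : (4 : ℝ) ≤ (dirRamsey 3 : ℝ) := by exact_mod_cast hR
      linarith
    have h3 : (2 / 3 + ε) * n * 3 ≤ (2 / 3 + ε) * n * ((dirRamsey 3 : ℝ) - 1) :=
      mul_le_mul_of_nonneg_left h2 (by positivity)
    have h4 : ((n + (n + C) : ℕ) : ℝ) ≤ S.card := by
      push_cast
      nlinarith [Nat.cast_nonneg (α := ℝ) C]
    exact_mod_cast h4
  | succ χ hχ ih =>
    intro m ε hε
    have hR := dirRamsey_succ χ (by omega)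
    have hR2 := dirRamsey_ge χ
    obtain ⟨m', n₀, h⟩ := main_step (dirRamsey (χ + 1)) χ m (dirRamsey_tourn (χ + 1)) (by omega) ε hε
    obtain ⟨n₁, hn₁⟩ := ih m' ε hε
    refine ⟨max (max n₀ n₁) 6, fun n hn V _ c S hS => ?_⟩
    have hnn₀ : n₀ ≤ n := by omega
    have hnn₁ : n₁ ≤ n := by omega
    have hn6 : 6 ≤ n := by omega
    have hB : 0 ≤ (2 / 3 + ε) * ((dirRamsey χ : ℝ) - 1) * n := by
      have : (1 : ℝ) ≤ dirRamsey χ := by exact_mod_cast (by omega : 1 ≤ dirRamsey χ)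
      have := sub_nonneg.2 this
      positivity
    refine h n hnn₀ V c S ⌈(2 / 3 + ε) * ((dirRamsey χ : ℝ) - 1) * n⌉₊ (fun Y _ hY => ?_) ?_ hS
    · apply hn₁ n hnn₁ V c Y
      have := Nat.ceil_le.1 hY
      linarith
    · have h1 := Nat.ceil_lt_add_one hB
      have h2 : (dirRamsey χ : ℝ) + 2 ≤ dirRamsey (χ + 1) := by exact_mod_cast hR
      have h3 : (2 / 3 + ε) * n * ((dirRamsey χ : ℝ) - 1 + 2) ≤
          (2 / 3 + ε) * n * ((dirRamsey (χ + 1) : ℝ) - 1) :=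
        mul_le_mul_of_nonneg_left (by linarith) (by positivity)
      have h6 : (6 : ℝ) ≤ n := by exact_mod_cast hn6
      have h4 : ((n + ⌈(2 / 3 + ε) * ((dirRamsey χ : ℝ) - 1) * n⌉₊ : ℕ) : ℝ) ≤ S.card := by
        push_cast
        nlinarith
      exact_mod_cast h4

theorem Tight.get {V : Type} [DecidableEq V] {c : Finset V → Bool} : ∀ {l : List V}, Tight c l →
    ∀ (i : ℕ) (h : i + 2 < l.length), c {l[i], l[i + 1], l[i + 2]} = true := by
  intro l
  induction l with
  | nil => intro _ i h; simp at h
  | cons x l ih =>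
    intro ht i h
    cases i with
    | zero =>
      match l, ht, h with
      | y :: z :: l, ht, _ => exact ht.1
    | succ i => exact ih ht.tail i (by rw [List.length_cons] at h; omega)

theorem RedPath.copy {N n : ℕ} {c : Finset (Fin N) → Bool} (h : RedPath c Finset.univ n) :
    hasMonoCopy c true (ellPathEdges 3 2 n) := by
  obtain ⟨l, hn, -, hl, ht⟩ := h
  refine ⟨fun i => l[i.1]'(lt_of_lt_of_le i.2 hl), ?_, ?_⟩
  · intro i j hij
    exact Fin.ext ((hn.getElem_inj_iff).1 hij)
  · intro e he
    obtain ⟨i, hi, rfl⟩ := Finset.mem_image.1 he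
    rw [Finset.mem_range] at hi
    have hi2 : i + 2 < n := by omega
    rw [← ht.get i (by omega)]
    congr 1
    ext x
    simp only [Finset.mem_image, Finset.mem_filter, Finset.mem_univ, true_and, Finset.mem_insert,
      Finset.mem_singleton]
    constructor
    · rintro ⟨⟨v, hv⟩, ⟨h1, h2⟩, rfl⟩
      simp only at h1 h2
      have : v = i ∨ v = i + 1 ∨ v = i + 2 := by omega
      rcases this with rfl | rfl | rfl <;> simp
    · rintro (rfl | rfl | rfl)
      · exact ⟨⟨i, by omega⟩, ⟨by simp, by simp⟩, rfl⟩
      · exact ⟨⟨i + 1, by omega⟩, ⟨by simp, by simp⟩, rfl⟩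
      · exact ⟨⟨i + 2, by omega⟩, ⟨by simp, by simp⟩, rfl⟩

theorem BlueH.copy {N χ m : ℕ} {c : Finset (Fin N) → Bool} (h : BlueH c Finset.univ χ m) :
    hasMonoCopy c false (transTournHyp χ m) := by
  obtain ⟨A, -, h2, h3, h4⟩ := h
  have h5 : ∀ i, ∃ g : Fin m → Fin N, Function.Injective g ∧ ∀ x, g x ∈ A i := by
    intro i
    obtain ⟨B, hB, hBc⟩ := Finset.exists_subset_card_eq (h2 i)
    exact ⟨B.orderEmbOfFin hBc, (B.orderEmbOfFin hBc).injective,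
      fun x => hB (Finset.orderEmbOfFin_mem _ _ _)⟩
  choose g hg hgA using h5
  have hinj : Function.Injective (fun p : Fin χ × Fin m => g p.1 p.2) := by
    rintro ⟨i, x⟩ ⟨j, y⟩ hxy
    simp only at hxy
    by_cases hij : i = j
    · subst hij
      rw [hg i hxy]
    · exfalso
      exact Finset.disjoint_left.1 (h3 i j hij) (hgA i x) (by rw [hxy]; exact hgA j y)
  refine ⟨fun p => g p.1 p.2, hinj, ?_⟩
  intro e he
  obtain ⟨-, x, -, y, -, z, -, hxy, rfl, h1, hlt⟩ := Finset.mem_filter.1 he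
  rw [Finset.image_insert, Finset.image_insert, Finset.image_singleton]
  exact h4 x.1 z.1 hlt _ (hgA _ _) _ (by rw [h1]; exact hgA _ _) (fun h => hxy (hinj h)) _ (hgA _ _)

/-- Upper bound for tight paths versus transitive tournament hypergraphs:
`R(P_{n,2}^{(3)}, H(TT_χ,m)) ≤ (1+ε)n` if `χ = 2`, and
`R(P_{n,2}^{(3)}, H(TT_χ,m)) ≤ (2/3+ε)(R⃗(χ)-1)n` if `χ ≥ 3`, for all large `n`. -/
theorem tightPath_upper (χ m : ℕ) (hχ : 2 ≤ χ) (hm : 2 ≤ m) (ε : ℝ) (hε : 0 < ε) :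
    ∃ n₀ : ℕ, ∀ n : ℕ, n₀ ≤ n →
      (χ = 2 →
        (ramseyNumber (ellPathEdges 3 2 n) (transTournHyp χ m) : ℝ) ≤ (1 + ε) * n) ∧
      (3 ≤ χ →
        (ramseyNumber (ellPathEdges 3 2 n) (transTournHyp χ m) : ℝ) ≤
          (2 / 3 + ε) * ((dirRamsey χ : ℝ) - 1) * n) := by
  have key : ∀ (n N : ℕ), (∀ (c : Finset (Fin N) → Bool), RedPath c Finset.univ n ∨
      BlueH c Finset.univ χ m) → ramseyNumber (ellPathEdges 3 2 n) (transTournHyp χ m) ≤ N := by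
    intro n N h
    apply Nat.sInf_le
    intro c
    rcases h c with h | h
    · exact Or.inl h.copy
    · exact Or.inr h.copy
  by_cases h2 : χ = 2
  · subst h2
    obtain ⟨C, hC⟩ := main_two m
    obtain ⟨n₁, hn₁⟩ := exists_nat_ge ((C : ℝ) / ε)
    refine ⟨n₁, fun n hn => ⟨fun _ => ?_, fun h => by omega⟩⟩
    have h1 : (C : ℝ) ≤ ε * n := by
      rw [div_le_iff₀ hε] at hn₁
      have : (n₁ : ℝ) ≤ n := by exact_mod_cast hn
      nlinarith
    have h3 := key n (n + C) (fun c => hC n _ c _ (by simp))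
    have h4 : (ramseyNumber (ellPathEdges 3 2 n) (transTournHyp 2 m) : ℝ) ≤ ((n + C : ℕ) : ℝ) := by
      exact_mod_cast h3
    push_cast at h4
    linarith
  · obtain ⟨n₀, h⟩ := main_ge3 χ (by omega) m ε hε
    refine ⟨n₀, fun n hn => ⟨fun h => absurd h h2, fun _ => ?_⟩⟩
    have hB : 0 ≤ (2 / 3 + ε) * ((dirRamsey χ : ℝ) - 1) * n := by
      have := dirRamsey_ge χ
      have : (1 : ℝ) ≤ dirRamsey χ := by exact_mod_cast (by omega : 1 ≤ dirRamsey χ)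
      have := sub_nonneg.2 this
      positivity
    have h3 := key n ⌊(2 / 3 + ε) * ((dirRamsey χ : ℝ) - 1) * n⌋₊ (fun c => by
      apply h n hn
      rw [Finset.card_univ, Fintype.card_fin]
      exact (Nat.lt_floor_add_one _).le)
    exact le_trans (by exact_mod_cast h3) (Nat.floor_le hB)
end

section
/- For all integers k ≥ 3, ℓ ∈ {1, k-1}, α ≥ 2 and all real 0 < ε < 1, there exists an integer M_0 = M_0(k, α, ε) such that for all M ≥ M_0 the following holds. Let G be a k-graph on vertex set V_0 ⊔ V_1 ⊔ … ⊔ V_t, where |V_i| = M and V_i induces a complete k-graph K_M^{(k)} in G for all i ∈ [t]. Suppose that, for every subset I ⊆ [t] of size α and every choice of subsets W_i ⊆ V_i of size M/2 for i ∈ I, the k-graph induced by G on the union of the W_i contains an ℓ-path of length q_0(k,ℓ) connecting W_j and W_{j'} for some distinct j, j' ∈ I. Then G contains a (k,ℓ,F)-path system L such that: (a) F is a forest with vertex set [t] having fewer than α components; (b) |V(L) ∩ V_i| ≤ εM for all i ∈ [t]; (c) for every component T of F, the set of vertices of the paths L_{e,1}, L_{e,2} over e ∈ E(T) that lie outside the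 union of the V_i for i ∈ V(T) has size at most 4αk; (d) for any i and i' contained in different components of F, the k-graph obtained from G by deleting V(L) does not contain two vertex-disjoint ℓ-paths, each with at most 2k vertices, connecting V_i and V_{i'}. -/
open scoped Classical

/-- `w` is (the vertex sequence of) a `k`-uniform `ℓ`-path of length `q` in the
hypergraph `E`: the first `q(k-ℓ)+ℓ` values of `w` are distinct and every window
of `k` consecutive vertices starting at a multiple of `k-ℓ` is an edge of `E`. -/
def IsPathSeq (k ℓ : ℕ) {V : Type*} [DecidableEq V] (E : Finset (Finset V))
    (q : ℕ) (w : ℕ → V) : Prop :=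
  (∀ i j, i < q * (k - ℓ) + ℓ → j < q * (k - ℓ) + ℓ → w i = w j → i = j) ∧
  ∀ i < q, (Finset.range k).image (fun j => w (i * (k - ℓ) + j)) ∈ E

/-- The `ℓ`-path of length `q` with vertex sequence `w` connects `S` and `S'`:
one of its ends (its first `ℓ` or last `ℓ` vertices) lies in `S` and the other
in `S'`. -/
def PathConnects (k ℓ q : ℕ) {V : Type*} (w : ℕ → V) (S S' : Finset V) : Prop :=
  ((∀ i < ℓ, w i ∈ S) ∧ (∀ i, q * (k - ℓ) ≤ i → i < q * (k - ℓ) + ℓ → w i ∈ S')) ∨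
  ((∀ i < ℓ, w i ∈ S') ∧ (∀ i, q * (k - ℓ) ≤ i → i < q * (k - ℓ) + ℓ → w i ∈ S))

/-- The set of the first `r` vertices of the sequence `w`. -/
def seqVerts {V : Type*} [DecidableEq V] (r : ℕ) (w : ℕ → V) : Finset V :=
  (Finset.range r).image w

/-- `q₀(k,ℓ) = ⌈ℓ/(k-ℓ)⌉`, the minimum length of an `ℓ`-path on at least
`max{k, 2ℓ}` vertices. -/
def qZero (k ℓ : ℕ) : ℕ := (ℓ + (k - ℓ) - 1) / (k - ℓ)

def cls {t N : ℕ} (part : Fin N → Fin (t + 1)) (i : Fin t) : Finset (Fin N) :=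
  Finset.univ.filter (fun v => part v = i.succ)

def Conn (k ℓ : ℕ) {t N : ℕ} (part : Fin N → Fin (t + 1)) (E : Finset (Finset (Fin N)))
    (a b : Fin t) (S : Finset (Fin N)) : Prop :=
  ∃ (q : ℕ) (w : ℕ → Fin N), IsPathSeq k ℓ E q w ∧ q * (k - ℓ) + ℓ ≤ 2 * k ∧
    PathConnects k ℓ q w (cls part a) (cls part b) ∧
    seqVerts (q * (k - ℓ) + ℓ) w ⊆ S

theorem Conn.symm {k ℓ t N : ℕ} {part : Fin N → Fin (t + 1)} {E : Finset (Finset (Fin N))}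
    {a b : Fin t} {S : Finset (Fin N)} (h : Conn k ℓ part E a b S) : Conn k ℓ part E b a S := by
  obtain ⟨q, w, h1, h2, h3, h4⟩ := h
  exact ⟨q, w, h1, h2, h3.symm, h4⟩

def Realz (k ℓ : ℕ) {t N : ℕ} (part : Fin N → Fin (t + 1)) (E : Finset (Finset (Fin N)))
    (F : SimpleGraph (Fin t)) (c : Fin t → Finset (Fin N)) : Prop :=
  ∃ (q : Fin t → Fin t → Fin 2 → ℕ) (w : Fin t → Fin t → Fin 2 → ℕ → Fin N),
    (∀ x y : Fin t, x < y → F.Adj x y → ∀ b : Fin 2,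
          IsPathSeq k ℓ E (q x y b) (w x y b) ∧
          q x y b * (k - ℓ) + ℓ ≤ 2 * k ∧
          PathConnects k ℓ (q x y b) (w x y b) (cls part x) (cls part y)) ∧
    (∀ x y x' y' : Fin t, ∀ b b' : Fin 2,
          x < y → F.Adj x y → x' < y' → F.Adj x' y' →
          (x, y, b) ≠ (x', y', b') →
          Disjoint (seqVerts (q x y b * (k - ℓ) + ℓ) (w x y b))
            (seqVerts (q x' y' b' * (k - ℓ) + ℓ) (w x' y' b'))) ∧
    (∀ x v, v ∈ c x ↔ ∃ y b, x < y ∧ F.Adj x y ∧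
      v ∈ seqVerts (q x y b * (k - ℓ) + ℓ) (w x y b))

/-- pass to a spanning forest -/
theorem Realz.forest {k ℓ t N : ℕ} {part : Fin N → Fin (t + 1)} {E : Finset (Finset (Fin N))}
    {F : SimpleGraph (Fin t)} {c : Fin t → Finset (Fin N)} (h : Realz k ℓ part E F c) :
    ∃ F' c', Realz k ℓ part E F' c' ∧ F'.IsAcyclic ∧ F'.Reachable = F.Reachable ∧
      ∀ x, c' x ⊆ c x := by
  obtain ⟨q, w, h1, h2, h3⟩ := h
  obtain ⟨F', hle, hac, hr⟩ := F.exists_isAcyclic_reachable_eq_le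
  refine ⟨F', fun x => Finset.univ.filter (fun v => ∃ y b, x < y ∧ F'.Adj x y ∧
      v ∈ seqVerts (q x y b * (k - ℓ) + ℓ) (w x y b)), ⟨q, w, ?_, ?_, ?_⟩, hac, hr, ?_⟩
  · exact fun x y hxy ha b => h1 x y hxy (hle ha) b
  · exact fun x y x' y' b b' hxy ha hxy' ha' => h2 x y x' y' b b' hxy (hle ha) hxy' (hle ha')
  · intro x v; simp
  · intro x v hv
    simp only [Finset.mem_filter, Finset.mem_univ, true_and] at hv
    obtain ⟨y, b, hxy, ha, hv⟩ := hv
    exact (h3 x v).2 ⟨y, b, hxy, hle ha, hv⟩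

theorem star {k ℓ t N : ℕ} {part : Fin N → Fin (t + 1)} {E : Finset (Finset (Fin N))}
    {F : SimpleGraph (Fin t)} {c : Fin t → Finset (Fin N)} (h : Realz k ℓ part E F c)
    (j0 : Fin t) (J : Finset (Fin t)) (hJ : ∀ j ∈ J, ¬ F.Reachable j0 j)
    (S : Fin t → Fin 2 → Finset (Fin N))
    (hS : ∀ j ∈ J, ∀ b, Conn k ℓ part E j0 j (S j b))
    (hd : ∀ j ∈ J, ∀ b, ∀ j' ∈ J, ∀ b', (j, b) ≠ (j', b') → Disjoint (S j b) (S j' b'))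
    (hc : ∀ j ∈ J, ∀ b x, Disjoint (S j b) (c x)) :
    ∃ F' c', Realz k ℓ part E F' c' ∧ F ≤ F' ∧ (∀ j ∈ J, F'.Adj j0 j) ∧
      (∀ x y, F'.Adj x y → F.Adj x y ∨ (x = j0 ∧ y ∈ J) ∨ (y = j0 ∧ x ∈ J)) ∧
      (∀ x, ∀ v ∈ c' x, v ∈ c x ∨ ∃ j ∈ J, (x = j0 ∨ x = j) ∧ ∃ b, v ∈ S j b) := by
  obtain ⟨q, w, h1, h2, h3⟩ := h
  have hj0 : j0 ∉ J := fun h => hJ _ h (SimpleGraph.Reachable.refl _)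
  have hna : ∀ j ∈ J, ¬ F.Adj j0 j := fun j hj h => hJ j hj h.reachable
  have : Nonempty (Fin N) := ⟨w j0 j0 0 0⟩
  choose! Q P hP using hS
  let F' : SimpleGraph (Fin t) :=
    { Adj := fun x y => F.Adj x y ∨ (x = j0 ∧ y ∈ J) ∨ (y = j0 ∧ x ∈ J)
      symm := ⟨fun x y h => by
        rcases h with h | h | h
        · exact Or.inl h.symm
        · exact Or.inr (Or.inr h)
        · exact Or.inr (Or.inl h)⟩
      loopless := ⟨fun x h => by
        rcases h with h | h | h
        · exact F.loopless.irrefl _ h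
        · exact hj0 (h.1 ▸ h.2)
        · exact hj0 (h.1 ▸ h.2)⟩ }
  let q' : Fin t → Fin t → Fin 2 → ℕ := fun x y b =>
    if F.Adj x y then q x y b else if x = j0 then Q y b else Q x b
  let w' : Fin t → Fin t → Fin 2 → ℕ → Fin N := fun x y b =>
    if F.Adj x y then w x y b else if x = j0 then P y b else P x b
  -- classification of edges
  have key : ∀ x y, F'.Adj x y → (F.Adj x y ∧ ∀ b, q' x y b = q x y b ∧ w' x y b = w x y b) ∨
      ∃ j ∈ J, ((x = j0 ∧ y = j) ∨ (x = j ∧ y = j0)) ∧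
        ∀ b, q' x y b = Q j b ∧ w' x y b = P j b := by
    intro x y hxy
    by_cases hF : F.Adj x y
    · left; exact ⟨hF, fun b => by simp [q', w', hF]⟩
    · right
      rcases hxy with h | ⟨rfl, h⟩ | ⟨rfl, h⟩
      · exact absurd h hF
      · exact ⟨y, h, Or.inl ⟨rfl, rfl⟩, fun b => by simp [q', w', hF]⟩
      · refine ⟨x, h, Or.inr ⟨rfl, rfl⟩, fun b => ?_⟩
        have : x ≠ y := fun e => hj0 (e ▸ h)
        simp [q', w', hF, this]
  refine ⟨F', fun x => Finset.univ.filter (fun v => ∃ y b, x < y ∧ F'.Adj x y ∧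
      v ∈ seqVerts (q' x y b * (k - ℓ) + ℓ) (w' x y b)), ⟨q', w', ?_, ?_, ?_⟩, ?_, ?_, ?_, ?_⟩
  · intro x y hxy ha b
    rcases key x y ha with ⟨hF, e⟩ | ⟨j, hj, hxj, e⟩
    · rw [(e b).1, (e b).2]; exact h1 x y hxy hF b
    · rw [(e b).1, (e b).2]
      obtain ⟨p1, p2, p3, p4⟩ := hP j hj b
      refine ⟨p1, p2, ?_⟩
      rcases hxj with ⟨rfl, rfl⟩ | ⟨rfl, rfl⟩
      · exact p3
      · exact p3.symm
  · intro x y x' y' b b' hxy ha hxy' ha' hne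
    rcases key x y ha with ⟨hF, e⟩ | ⟨j, hj, hxj, e⟩ <;>
    rcases key x' y' ha' with ⟨hF', e'⟩ | ⟨j', hj', hxj', e'⟩ <;>
    rw [(e b).1, (e b).2, (e' b').1, (e' b').2]
    · exact h2 x y x' y' b b' hxy hF hxy' hF' hne
    · refine ((hc j' hj' b' x).symm.mono_right (hP j' hj' b').2.2.2).mono_left ?_
      intro v hv; exact (h3 x v).2 ⟨y, b, hxy, hF, hv⟩
    · refine ((hc j hj b x').mono_left (hP j hj b).2.2.2).mono_right ?_
      intro v hv; exact (h3 x' v).2 ⟨y', b', hxy', hF', hv⟩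
    · refine ((hd j hj b j' hj' b' ?_).mono_left (hP j hj b).2.2.2).mono_right
        (hP j' hj' b').2.2.2
      intro he
      rw [Prod.mk.injEq] at he
      obtain ⟨rfl, rfl⟩ := he
      apply hne
      rcases hxj with ⟨rfl, rfl⟩ | ⟨rfl, rfl⟩ <;> rcases hxj' with ⟨rfl, h⟩ | ⟨h, rfl⟩
      · rw [h]
      · exact absurd hxy' (not_lt.2 (h ▸ hxy.le))
      · exact absurd hxy' (not_lt.2 (h ▸ hxy.le))
      · rw [h]
  · intro x v; simp
  · intro x y h; exact Or.inl h
  · intro j hj; exact Or.inr (Or.inl ⟨rfl, hj⟩)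
  · intro x y h; exact h
  · intro x v hv
    simp only [Finset.mem_filter, Finset.mem_univ, true_and] at hv
    obtain ⟨y, b, hxy, ha, hv⟩ := hv
    rcases key x y ha with ⟨hF, e⟩ | ⟨j, hj, hxj, e⟩
    · rw [(e b).1, (e b).2] at hv
      exact Or.inl ((h3 x v).2 ⟨y, b, hxy, hF, hv⟩)
    · rw [(e b).1, (e b).2] at hv
      exact Or.inr ⟨j, hj, hxj.imp And.left And.left, b, (hP j hj b).2.2.2 hv⟩

theorem card_comp_lt {t : ℕ} {F F' : SimpleGraph (Fin t)} (hle : F ≤ F') {a b : Fin t}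
    (h : ¬ F.Reachable a b) (h' : F'.Reachable a b) :
    Nat.card F'.ConnectedComponent < Nat.card F.ConnectedComponent := by
  let φ : F.ConnectedComponent → F'.ConnectedComponent :=
    SimpleGraph.ConnectedComponent.map (SimpleGraph.Hom.ofLE hle)
  have hs : Function.Surjective φ := by
    intro d
    induction d using SimpleGraph.ConnectedComponent.ind with
    | h v => exact ⟨F.connectedComponentMk v, rfl⟩
  refine lt_of_le_of_ne (Nat.card_le_card_of_surjective φ hs) fun he => ?_
  have hb : Function.Bijective φ := (Nat.bijective_iff_surjective_and_card φ).2 ⟨hs, he.symm⟩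
  apply h
  have : φ (F.connectedComponentMk a) = φ (F.connectedComponentMk b) :=
    SimpleGraph.ConnectedComponent.sound h'
  exact SimpleGraph.ConnectedComponent.exact (hb.1 this)

/-- reorder an edge so that it starts and ends at prescribed positions -/
theorem exists_perm (k p r : ℕ) (hk : 2 ≤ k) (hp : p < k) (hr : r < k) (hpr : p ≠ r) :
    ∃ σ : Equiv.Perm ℕ, σ 0 = p ∧ σ (k - 1) = r ∧ ∀ i, i < k → σ i < k := by
  have sw : ∀ a b, a < k → b < k → ∀ i, i < k → Equiv.swap a b i < k := by
    intro a b ha hb i hi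
    rw [Equiv.swap_apply_def]; split_ifs <;> assumption
  refine ⟨(Equiv.swap (k - 1) (Equiv.swap 0 p r)).trans (Equiv.swap 0 p), ?_, ?_, ?_⟩
  · rw [Equiv.trans_apply, Equiv.swap_apply_of_ne_of_ne (a := k - 1) (by omega) ?_,
      Equiv.swap_apply_left]
    intro h
    have := congrArg (Equiv.swap 0 p) h
    rw [Equiv.swap_apply_left, Equiv.swap_apply_self] at this
    exact hpr this
  · simp
  · intro i hi
    rw [Equiv.trans_apply]
    exact sw _ _ (by omega) hp _ (sw _ _ (by omega) (sw _ _ (by omega) hp _ hr) _ hi)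

theorem bundle_exists (k ℓ α M K : ℕ) (hk : 3 ≤ k) (hℓ : ℓ = 1 ∨ ℓ = k - 1)
    (hM : 2 * K + 2 ≤ M) {t N : ℕ} (part : Fin N → Fin (t + 1)) (E : Finset (Finset (Fin N)))
    (hcard : ∀ i : Fin t, (cls part i).card = M) (I : Finset (Fin t))
    (H : ∀ W : Fin t → Finset (Fin N),
          (∀ i ∈ I, W i ⊆ cls part i ∧ (W i).card = M / 2) →
          ∃ j ∈ I, ∃ j' ∈ I, j ≠ j' ∧ ∃ w : ℕ → Fin N,
            IsPathSeq k ℓ E (qZero k ℓ) w ∧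
            (∀ p < qZero k ℓ * (k - ℓ) + ℓ, w p ∈ I.biUnion W) ∧
            PathConnects k ℓ (qZero k ℓ) w (W j) (W j'))
    (A : Finset (Fin N)) (hA : ∀ i ∈ I, (A ∩ cls part i).card ≤ K) :
    ∃ J ⊆ I, 2 ≤ J.card ∧ ∃ S : Finset (Fin N), S.card ≤ 2 * k ∧ Disjoint S A ∧
      (∀ v ∈ S, ∃ j ∈ J, part v = j.succ) ∧
      ∀ a ∈ J, ∀ b ∈ J, a ≠ b → Conn k ℓ part E a b S := by
  have hW : ∀ i, ∃ W, i ∈ I → W ⊆ cls part i \ A ∧ W.card = M / 2 := by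
    intro i
    by_cases hi : i ∈ I
    · obtain ⟨W, h1, h2⟩ := Finset.exists_subset_card_eq (s := cls part i \ A) (n := M / 2) (by
        have h1 := Finset.card_sdiff_add_card_inter (cls part i) A
        have h2 := hA i hi
        rw [Finset.inter_comm] at h2
        rw [hcard] at h1
        omega)
      exact ⟨W, fun _ => ⟨h1, h2⟩⟩
    · exact ⟨∅, fun h => absurd h hi⟩
  choose W hW using hW
  obtain ⟨j, hj, j', hj', hne, w, hw, hwI, hcon⟩ := H W
    (fun i hi => ⟨(hW i hi).1.trans Finset.sdiff_subset, (hW i hi).2⟩)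
  have hWp : ∀ i ∈ I, ∀ v ∈ W i, part v = i.succ ∧ v ∉ A := by
    intro i hi v hv
    have := (hW i hi).1 hv
    simpa [cls] using this
  have hWc : ∀ i ∈ I, W i ⊆ cls part i := fun i hi => (hW i hi).1.trans Finset.sdiff_subset
  have hdisj : ∀ n, n ≤ qZero k ℓ * (k - ℓ) + ℓ → Disjoint (seqVerts n w) A := by
    intro n hn
    rw [Finset.disjoint_left]
    intro v hv
    simp only [seqVerts, Finset.mem_image, Finset.mem_range] at hv
    obtain ⟨p, hp, rfl⟩ := hv
    obtain ⟨i, hi, hv⟩ := Finset.mem_biUnion.1 (hwI p (by omega))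
    exact (hWp i hi _ hv).2
  rcases hℓ with rfl | rfl
  · have hq : qZero k 1 = 1 := by
      unfold qZero
      have : 1 + (k - 1) - 1 = k - 1 := by omega
      rw [this]; exact Nat.div_self (by omega)
    have hlen : 1 * (k - 1) + 1 = k := by omega
    rw [hq] at hw hwI hcon hdisj
    rw [hlen] at hwI hdisj
    have hw1 := hw.1
    have hw2 := hw.2 0 (by omega)
    rw [hlen] at hw1
    simp only [zero_mul, zero_add] at hw2
    refine ⟨I.filter (fun i => ∃ p < k, w p ∈ W i), Finset.filter_subset _ _, ?_,
      seqVerts k w, ?_, hdisj k le_rfl, ?_, ?_⟩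
    · have hends : (∃ p < k, w p ∈ W j) ∧ (∃ p < k, w p ∈ W j') := by
        rcases hcon with ⟨h1, h2⟩ | ⟨h1, h2⟩
        · exact ⟨⟨0, by omega, h1 0 (by omega)⟩, ⟨k - 1, by omega, h2 _ (by omega) (by omega)⟩⟩
        · exact ⟨⟨k - 1, by omega, h2 _ (by omega) (by omega)⟩, ⟨0, by omega, h1 0 (by omega)⟩⟩
      rw [← Finset.card_pair hne]
      apply Finset.card_le_card
      intro x hx
      rcases Finset.mem_insert.1 hx with rfl | hx
      · exact Finset.mem_filter.2 ⟨hj, hends.1⟩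
      · rw [Finset.mem_singleton.1 hx]
        exact Finset.mem_filter.2 ⟨hj', hends.2⟩
    · refine Finset.card_image_le.trans ?_
      rw [Finset.card_range]; omega
    · intro v hv
      simp only [seqVerts, Finset.mem_image, Finset.mem_range] at hv
      obtain ⟨p, hp, rfl⟩ := hv
      obtain ⟨i, hi, hv⟩ := Finset.mem_biUnion.1 (hwI p hp)
      exact ⟨i, Finset.mem_filter.2 ⟨hi, p, hp, hv⟩, (hWp i hi _ hv).1⟩
    · intro a ha b hb hab
      obtain ⟨haI, p, hp, hpa⟩ := Finset.mem_filter.1 ha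
      obtain ⟨hbI, r, hr, hrb⟩ := Finset.mem_filter.1 hb
      have hpr : p ≠ r := by
        rintro rfl
        have h1 := (hWp a haI _ hpa).1
        have h2 := (hWp b hbI _ hrb).1
        exact hab (Fin.succ_injective _ (h1.symm.trans h2))
      obtain ⟨σ, h0, h1, h2⟩ := exists_perm k p r (by omega) hp hr hpr
      have himg : (Finset.range k).image (fun i => w (σ i)) = (Finset.range k).image w := by
        have hσ : (Finset.range k).image σ = Finset.range k := by
          apply Finset.eq_of_subset_of_card_le
          · intro x hx
            simp only [Finset.mem_image, Finset.mem_range] at hx ⊢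
            obtain ⟨i, hi, rfl⟩ := hx
            exact h2 i hi
          · rw [Finset.card_image_of_injective _ σ.injective]
        conv_rhs => rw [← hσ]
        rw [Finset.image_image]; rfl
      refine ⟨1, fun i => w (σ i), ⟨?_, ?_⟩, by omega, Or.inl ⟨?_, ?_⟩, ?_⟩
      · rw [hlen]
        intro x y hx hy hxy
        exact σ.injective (hw1 _ _ (h2 x hx) (h2 y hy) hxy)
      · intro i hi
        have : i = 0 := by omega
        subst this
        simp only [zero_mul, zero_add]
        rw [himg]; exact hw2
      · intro i hi
        have : i = 0 := by omega
        subst this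
        simp only [h0]; exact hWc a haI hpa
      · intro i hi hi'
        have : i = k - 1 := by omega
        subst this
        simp only [h1]; exact hWc b hbI hrb
      · rw [hlen]; unfold seqVerts; rw [himg]
  · have hk1 : k - (k - 1) = 1 := by omega
    have hq : qZero k (k - 1) = k - 1 := by
      unfold qZero; rw [hk1]; simp
    have hlen : qZero k (k - 1) * (k - (k - 1)) + (k - 1) = 2 * k - 2 := by
      rw [hq, hk1]; omega
    refine ⟨{j, j'}, ?_, (Finset.card_pair hne).ge, seqVerts (2 * k - 2) w, ?_,
      hdisj _ hlen.ge, ?_, ?_⟩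
    · intro x hx
      rcases Finset.mem_insert.1 hx with rfl | hx
      · exact hj
      · rw [Finset.mem_singleton.1 hx]; exact hj'
    · refine Finset.card_image_le.trans ?_
      rw [Finset.card_range]; omega
    · intro v hv
      simp only [seqVerts, Finset.mem_image, Finset.mem_range] at hv
      obtain ⟨p, hp, rfl⟩ := hv
      unfold PathConnects at hcon
      rw [hq, hk1] at hcon
      by_cases hpk : p < k - 1
      · rcases hcon with ⟨h1, h2⟩ | ⟨h1, h2⟩
        · exact ⟨j, by simp, (hWp j hj _ (h1 p hpk)).1⟩
        · exact ⟨j', by simp, (hWp j' hj' _ (h1 p hpk)).1⟩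
      · rcases hcon with ⟨h1, h2⟩ | ⟨h1, h2⟩
        · exact ⟨j', by simp, (hWp j' hj' _ (h2 p (by omega) (by omega))).1⟩
        · exact ⟨j, by simp, (hWp j hj _ (h2 p (by omega) (by omega))).1⟩
    · have hc : Conn k (k - 1) part E j j' (seqVerts (2 * k - 2) w) := by
        refine ⟨_, w, hw, by omega, ?_, by rw [hlen]⟩
        rcases hcon with ⟨h1, h2⟩ | ⟨h1, h2⟩
        · exact Or.inl ⟨fun i hi => hWc j hj (h1 i hi), fun i hi hi' => hWc j' hj' (h2 i hi hi')⟩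
        · exact Or.inr ⟨fun i hi => hWc j' hj' (h1 i hi), fun i hi hi' => hWc j hj (h2 i hi hi')⟩
      intro a ha b hb hab
      simp only [Finset.mem_insert, Finset.mem_singleton] at ha hb
      rcases ha with rfl | rfl <;> rcases hb with rfl | rfl
      · exact absurd rfl hab
      · exact hc
      · exact hc.symm
      · exact absurd rfl hab

/-- many disjoint bundles with the same index set -/
theorem bundles (k ℓ α M C : ℕ) (hk : 3 ≤ k) (hℓ : ℓ = 1 ∨ ℓ = k - 1)
    (hM : 2 * (C + (2 ^ α * (2 * α) + 1) * (2 * k)) + 2 ≤ M)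
    {t N : ℕ} (part : Fin N → Fin (t + 1)) (E : Finset (Finset (Fin N)))
    (hcard : ∀ i : Fin t, (cls part i).card = M) (I : Finset (Fin t)) (hI : I.card = α)
    (H : ∀ W : Fin t → Finset (Fin N),
          (∀ i ∈ I, W i ⊆ cls part i ∧ (W i).card = M / 2) →
          ∃ j ∈ I, ∃ j' ∈ I, j ≠ j' ∧ ∃ w : ℕ → Fin N,
            IsPathSeq k ℓ E (qZero k ℓ) w ∧
            (∀ p < qZero k ℓ * (k - ℓ) + ℓ, w p ∈ I.biUnion W) ∧
            PathConnects k ℓ (qZero k ℓ) w (W j) (W j'))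
    (A : Finset (Fin N)) (hA : ∀ i ∈ I, (A ∩ cls part i).card ≤ C) :
    ∃ J ⊆ I, 2 ≤ J.card ∧ ∃ S : Fin t → Fin 2 → Finset (Fin N),
      (∀ j ∈ J, ∀ b, (S j b).card ≤ 2 * k ∧ Disjoint (S j b) A ∧
        (∀ v ∈ S j b, ∃ i ∈ J, part v = i.succ) ∧
        ∀ x ∈ J, ∀ y ∈ J, x ≠ y → Conn k ℓ part E x y (S j b)) ∧
      (∀ j ∈ J, ∀ b, ∀ j' ∈ J, ∀ b', (j, b) ≠ (j', b') → Disjoint (S j b) (S j' b')) := by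
  set n0 := 2 ^ α * (2 * α) + 1 with hn0
  have greedy : ∀ n ≤ n0, ∃ (Jf : ℕ → Finset (Fin t)) (Sf : ℕ → Finset (Fin N)),
      (∀ i < n, Jf i ⊆ I ∧ 2 ≤ (Jf i).card ∧ (Sf i).card ≤ 2 * k ∧ Disjoint (Sf i) A ∧
      (∀ v ∈ Sf i, ∃ j ∈ Jf i, part v = j.succ) ∧
      ∀ a ∈ Jf i, ∀ b ∈ Jf i, a ≠ b → Conn k ℓ part E a b (Sf i)) ∧
      ∀ i j, i < j → j < n → Disjoint (Sf i) (Sf j) := by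
    intro n
    induction n with
    | zero => exact fun _ => ⟨fun _ => ∅, fun _ => ∅, by simp, by simp⟩
    | succ n ih =>
      intro hn
      obtain ⟨Jf, Sf, h1, h2⟩ := ih (by omega)
      obtain ⟨J, hJ, hJ2, S, hS1, hS2, hS3, hS4⟩ := bundle_exists k ℓ α M (C + n0 * (2 * k))
        hk hℓ hM part E hcard I H (A ∪ (Finset.range n).biUnion Sf) (by
          intro i hi
          rw [Finset.union_inter_distrib_right]
          refine (Finset.card_union_le _ _).trans (Nat.add_le_add (hA i hi) ?_)
          refine (Finset.card_le_card Finset.inter_subset_left).trans ?_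
          refine (Finset.card_biUnion_le_card_mul _ _ (2 * k) ?_).trans ?_
          · intro x hx; exact (h1 x (Finset.mem_range.1 hx)).2.2.1
          · rw [Finset.card_range]; exact Nat.mul_le_mul_right _ (by omega))
      rw [Finset.disjoint_union_right] at hS2
      refine ⟨Function.update Jf n J, Function.update Sf n S, ?_, ?_⟩
      · intro i hi
        by_cases hin : i = n
        · subst hin
          simp only [Function.update_self]
          exact ⟨hJ, hJ2, hS1, hS2.1, hS3, hS4⟩
        · simp only [Function.update_of_ne hin]
          exact h1 i (by omega)
      · intro i j hij hj
        rw [Function.update_of_ne (by omega : i ≠ n)]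
        by_cases hjn : j = n
        · subst hjn
          rw [Function.update_self]
          exact (hS2.2.mono_right (Finset.subset_biUnion_of_mem Sf (Finset.mem_range.2 hij))).symm
        · rw [Function.update_of_ne hjn]
          exact h2 i j hij (by omega)
  obtain ⟨Jf, Sf, h1, h2⟩ := greedy n0 le_rfl
  obtain ⟨J, hJI, hJ⟩ := Finset.exists_lt_card_fiber_of_mul_lt_card_of_maps_to
    (s := Finset.range n0) (t := I.powerset) (f := Jf) (n := 2 * α)
    (fun i hi => Finset.mem_powerset.2 (h1 i (Finset.mem_range.1 hi)).1)
    (by rw [Finset.card_powerset, hI, Finset.card_range]; omega)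
  set B := (Finset.range n0).filter (fun x => Jf x = J) with hB
  have hJI' := Finset.mem_powerset.1 hJI
  have hJc : (J ×ˢ (Finset.univ : Finset (Fin 2))).card ≤ B.card := by
    rw [Finset.card_product, Finset.card_univ, Fintype.card_fin]
    have := Finset.card_le_card hJI'
    omega
  obtain ⟨B', hB', hBc⟩ := Finset.exists_subset_card_eq hJc
  have e := Finset.equivOfCardEq hBc.symm
  let g : Fin t → Fin 2 → ℕ := fun j b =>
    if h : j ∈ J then (e ⟨(j, b), by simp [h]⟩ : ℕ) else 0
  have hg : ∀ j ∈ J, ∀ b, g j b < n0 ∧ Jf (g j b) = J := by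
    intro j hj b
    simp only [g, hj, dite_true]
    have := hB' (e ⟨(j, b), by simp [hj]⟩).2
    simpa [hB] using this
  have hginj : ∀ j ∈ J, ∀ b, ∀ j' ∈ J, ∀ b', (j, b) ≠ (j', b') → g j b ≠ g j' b' := by
    intro j hj b j' hj' b' hne he
    simp only [g, hj, hj', dite_true] at he
    have := e.injective (Subtype.ext he)
    exact hne (Subtype.ext_iff.1 this)
  have hBne : ∃ x, x ∈ B := Finset.card_pos.1 (by omega)
  obtain ⟨x0, hx0⟩ := hBne
  have hx0' := Finset.mem_filter.1 hx0
  refine ⟨J, hJI', ?_, fun j b => Sf (g j b), ?_, ?_⟩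
  · rw [← hx0'.2]; exact (h1 x0 (Finset.mem_range.1 hx0'.1)).2.1
  · intro j hj b
    obtain ⟨ha, hb⟩ := hg j hj b
    have := h1 _ ha
    rw [hb] at this
    exact ⟨this.2.2.1, this.2.2.2.1, this.2.2.2.2.1, this.2.2.2.2.2⟩
  · intro j hj b j' hj' b' hne
    rcases lt_or_gt_of_ne (hginj j hj b j' hj' b' hne) with h | h
    · exact h2 _ _ h (hg j' hj' b').1
    · exact (h2 _ _ h (hg j hj b).1).symm

def use {t N : ℕ} (part : Fin N → Fin (t + 1)) (c : Fin t → Finset (Fin N)) (i : Fin t) : ℕ :=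
  (Finset.univ.biUnion c ∩ cls part i).card

def Inv1 (k ℓ C : ℕ) {t N : ℕ} (part : Fin N → Fin (t + 1)) (E : Finset (Finset (Fin N)))
    (F : SimpleGraph (Fin t)) (c : Fin t → Finset (Fin N)) : Prop :=
  Realz k ℓ part E F c ∧
  (∀ y, ∀ v ∈ c y, ∃ i, part v = Fin.succ i ∧ F.Reachable i y) ∧
  (∀ i, use part c i ≤ 2 * C) ∧
  (∀ i, (use part c i = 0 ∧ ∀ j, F.Reachable i j → j = i) ∨
    ∃ a b, a ≠ b ∧ F.Reachable i a ∧ F.Reachable i b ∧ use part c a ≤ C ∧ use part c b ≤ C)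

theorem use_le {t N : ℕ} (part : Fin N → Fin (t + 1)) (c c' : Fin t → Finset (Fin N))
    (T : Finset (Fin N)) (h : ∀ x, ∀ v ∈ c' x, v ∈ T ∨ ∃ y, v ∈ c y) (i : Fin t) :
    use part c' i ≤ use part c i + (T ∩ cls part i).card := by
  unfold use
  refine le_trans (Finset.card_le_card ?_) (Finset.card_union_le _ _)
  intro v hv
  simp only [Finset.mem_inter, Finset.mem_biUnion, Finset.mem_univ, true_and,
    Finset.mem_union] at hv ⊢
  obtain ⟨⟨x, hx⟩, hv⟩ := hv
  rcases h x v hx with h | h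
  · exact Or.inr ⟨h, hv⟩
  · exact Or.inl ⟨h, hv⟩

theorem step1 (k ℓ α M : ℕ) (hk : 3 ≤ k) (hℓ : ℓ = 1 ∨ ℓ = k - 1)
    (hM : 2 * (4 * α * k + (2 ^ α * (2 * α) + 1) * (2 * k)) + 2 ≤ M)
    {t N : ℕ} (part : Fin N → Fin (t + 1)) (E : Finset (Finset (Fin N)))
    (hcard : ∀ i : Fin t, (cls part i).card = M)
    (H : ∀ I : Finset (Fin t), I.card = α → ∀ W : Fin t → Finset (Fin N),
          (∀ i ∈ I, W i ⊆ cls part i ∧ (W i).card = M / 2) →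
          ∃ j ∈ I, ∃ j' ∈ I, j ≠ j' ∧ ∃ w : ℕ → Fin N,
            IsPathSeq k ℓ E (qZero k ℓ) w ∧
            (∀ p < qZero k ℓ * (k - ℓ) + ℓ, w p ∈ I.biUnion W) ∧
            PathConnects k ℓ (qZero k ℓ) w (W j) (W j'))
    (F : SimpleGraph (Fin t)) (c : Fin t → Finset (Fin N))
    (hinv : Inv1 k ℓ (4 * α * k) part E F c) (hα : α ≤ Nat.card F.ConnectedComponent) :
    ∃ F' c', Inv1 k ℓ (4 * α * k) part E F' c' ∧
      Nat.card F'.ConnectedComponent < Nat.card F.ConnectedComponent := by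
  set C := 4 * α * k with hC
  obtain ⟨hR, hsp, hu, hD⟩ := hinv
  have hf : ∀ i, ∃ f, F.Reachable i f ∧ use part c f ≤ C := by
    intro i
    rcases hD i with ⟨h, -⟩ | ⟨a, b, -, ha, -, hua, -⟩
    · exact ⟨i, SimpleGraph.Reachable.refl _, by omega⟩
    · exact ⟨a, ha, hua⟩
  choose f hfr hfu using hf
  obtain ⟨I, hIc, hIu, hIr⟩ : ∃ I : Finset (Fin t), I.card = α ∧ (∀ i ∈ I, use part c i ≤ C) ∧
      ∀ i ∈ I, ∀ j ∈ I, F.Reachable i j → i = j := by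
    rw [Nat.card_eq_fintype_card, ← Finset.card_univ] at hα
    obtain ⟨D, -, hDc⟩ := Finset.exists_subset_card_eq hα
    let rep : F.ConnectedComponent → Fin t := fun d => f d.out
    have hrep : ∀ d, F.connectedComponentMk (rep d) = d := by
      intro d
      have h1 : F.connectedComponentMk d.out = d := Quot.out_eq d
      rw [← h1]
      exact (SimpleGraph.ConnectedComponent.sound (by rw [h1]; exact hfr _)).symm
    refine ⟨D.image rep, ?_, ?_, ?_⟩
    · rw [Finset.card_image_of_injective _ (Function.LeftInverse.injective hrep), hDc]
    · intro i hi
      obtain ⟨d, -, rfl⟩ := Finset.mem_image.1 hi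
      exact hfu _
    · intro i hi j hj hij
      obtain ⟨d, -, rfl⟩ := Finset.mem_image.1 hi
      obtain ⟨d', -, rfl⟩ := Finset.mem_image.1 hj
      have := SimpleGraph.ConnectedComponent.sound hij
      rw [hrep, hrep] at this
      rw [this]
  obtain ⟨J, hJI, hJ2, S, hS, hSd⟩ := bundles k ℓ α M C hk hℓ hM part E hcard I hIc
    (H I hIc) (Finset.univ.biUnion c) hIu
  obtain ⟨j0, hj0, j1, hj1, hne⟩ := Finset.one_lt_card.1 (by omega : 1 < J.card)
  have hnr : ∀ a ∈ J, ∀ b ∈ J, a ≠ b → ¬ F.Reachable a b :=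
    fun a ha b hb hab h => hab (hIr a (hJI ha) b (hJI hb) h)
  obtain ⟨F', c', hR', hle, hadj, hadj', hc'⟩ := star hR j0 (J.erase j0)
    (fun j hj => hnr j0 hj0 j (Finset.mem_of_mem_erase hj) (Finset.ne_of_mem_erase hj).symm) S
    (fun j hj b => (hS j (Finset.mem_of_mem_erase hj) b).2.2.2 j0 hj0 j
      (Finset.mem_of_mem_erase hj) (Finset.ne_of_mem_erase hj).symm)
    (fun j hj b j' hj' b' => hSd j (Finset.mem_of_mem_erase hj) b j'
      (Finset.mem_of_mem_erase hj') b')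
    (fun j hj b x => (hS j (Finset.mem_of_mem_erase hj) b).2.1.mono_right
      (Finset.subset_biUnion_of_mem c (Finset.mem_univ x)))
  have hJr : ∀ i ∈ J, F'.Reachable j0 i := by
    intro i hi
    by_cases h : i = j0
    · rw [h]
    · exact (hadj i (Finset.mem_erase.2 ⟨h, hi⟩)).reachable
  let T : Finset (Fin N) := (J ×ˢ (Finset.univ : Finset (Fin 2))).biUnion (fun z => S z.1 z.2)
  have hTc : T.card ≤ C := by
    refine (Finset.card_biUnion_le_card_mul _ _ (2 * k) ?_).trans ?_
    · intro z hz; exact (hS z.1 (Finset.mem_product.1 hz).1 z.2).1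
    · rw [Finset.card_product, Finset.card_univ, Fintype.card_fin, hC]
      have := Finset.card_le_card hJI
      rw [hIc] at this
      nlinarith
  have hcT : ∀ x, ∀ v ∈ c' x, v ∈ T ∨ ∃ y, v ∈ c y := by
    intro x v hv
    rcases hc' x v hv with h | ⟨j, hj, -, b, h⟩
    · exact Or.inr ⟨x, h⟩
    · exact Or.inl (Finset.mem_biUnion.2 ⟨(j, b), by simp [Finset.mem_of_mem_erase hj], h⟩)
  have hTJ : ∀ i, i ∉ J → T ∩ cls part i = ∅ := by
    intro i hi
    rw [Finset.eq_empty_iff_forall_notMem]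
    intro v hv
    obtain ⟨hv, hvi⟩ := Finset.mem_inter.1 hv
    obtain ⟨z, hz, hv⟩ := Finset.mem_biUnion.1 hv
    obtain ⟨i', hi', e⟩ := (hS z.1 (Finset.mem_product.1 hz).1 z.2).2.2.1 v hv
    simp only [cls, Finset.mem_filter, Finset.mem_univ, true_and] at hvi
    exact hi (Fin.succ_injective _ (e.symm.trans hvi) ▸ hi')
  have hu1 : ∀ i, i ∉ J → use part c' i ≤ use part c i := by
    intro i hi
    have := use_le part c c' T hcT i
    rw [hTJ i hi] at this
    simpa using this
  have hu2 : ∀ i, use part c' i ≤ use part c i + C := by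
    intro i
    refine (use_le part c c' T hcT i).trans (Nat.add_le_add_left ?_ _)
    exact (Finset.card_le_card Finset.inter_subset_left).trans hTc
  refine ⟨F', c', ⟨hR', ?_, ?_, ?_⟩, card_comp_lt hle (hnr j0 hj0 j1 hj1 hne) (hJr j1 hj1)⟩
  · intro y v hv
    rcases hc' y v hv with h | ⟨j, hj, hy, b, h⟩
    · obtain ⟨i, hi, hr⟩ := hsp y v h
      exact ⟨i, hi, hr.mono hle⟩
    · have hjJ := Finset.mem_of_mem_erase hj
      obtain ⟨i, hi, e⟩ := (hS j hjJ b).2.2.1 v h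
      refine ⟨i, e, (hJr i hi).symm.trans ?_⟩
      rcases hy with rfl | rfl
      · exact SimpleGraph.Reachable.refl _
      · exact hJr _ hjJ
  · intro i
    by_cases hi : i ∈ J
    · have h1 := hIu i (hJI hi)
      have h2 := hu2 i
      omega
    · exact (hu1 i hi).trans (hu i)
  · intro i
    by_cases hi : ∃ j ∈ J, F.Reachable i j
    · obtain ⟨j, hj, hij⟩ := hi
      right
      have hij' : ∀ x ∈ J, F'.Reachable i x := fun x hx =>
        (hij.mono hle).trans ((hJr j hj).symm.trans (hJr x hx))
      have fresh : ∀ x ∈ J, ∃ a, F.Reachable x a ∧ use part c' a ≤ C := by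
        intro x hx
        have hout : ∀ a, F.Reachable x a → a ≠ x → a ∉ J :=
          fun a ha hax haJ => hnr x hx a haJ hax.symm ha
        rcases hD x with ⟨h, -⟩ | ⟨a, b, hab, ha, hb, hua, hub⟩
        · refine ⟨x, SimpleGraph.Reachable.refl _, ?_⟩
          have := hu2 x
          omega
        · by_cases hax : a = x
          · exact ⟨b, hb, (hu1 b (hout b hb (fun h => hab (hax.trans h.symm)))).trans hub⟩
          · exact ⟨a, ha, (hu1 a (hout a ha hax)).trans hua⟩
      obtain ⟨a, ha, hua⟩ := fresh j0 hj0
      obtain ⟨b, hb, hub⟩ := fresh j1 hj1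
      refine ⟨a, b, ?_, (hij' j0 hj0).trans (ha.mono hle), (hij' j1 hj1).trans (hb.mono hle),
        hua, hub⟩
      rintro rfl
      exact hnr j0 hj0 j1 hj1 hne (ha.trans hb.symm)
    · have hback : ∀ x, F'.Reachable i x → F.Reachable i x := by
        intro x hx
        rw [SimpleGraph.reachable_iff_reflTransGen] at hx
        induction hx with
        | refl => exact SimpleGraph.Reachable.refl _
        | tail _ h ih =>
          rcases hadj' _ _ h with h | ⟨rfl, -⟩ | ⟨-, h⟩
          · exact ih.trans h.reachable
          · exact absurd ⟨_, hj0, ih⟩ hi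
          · exact absurd ⟨_, Finset.mem_of_mem_erase h, ih⟩ hi
      have hiJ : i ∉ J := fun h => hi ⟨i, h, SimpleGraph.Reachable.refl _⟩
      rcases hD i with ⟨h, h'⟩ | ⟨a, b, hab, ha, hb, hua, hub⟩
      · left
        refine ⟨?_, fun j hj => h' j (hback j hj)⟩
        have := hu1 i hiJ
        omega
      · right
        have hout : ∀ a, F.Reachable i a → a ∉ J := fun a ha haJ => hi ⟨a, haJ, ha⟩
        exact ⟨a, b, hab, ha.mono hle, hb.mono hle, (hu1 a (hout a ha)).trans hua,
          (hu1 b (hout b hb)).trans hub⟩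

def Inv2 (k ℓ α s : ℕ) {t N : ℕ} (part : Fin N → Fin (t + 1)) (E : Finset (Finset (Fin N)))
    (F : SimpleGraph (Fin t)) (c : Fin t → Finset (Fin N)) : Prop :=
  Realz k ℓ part E F c ∧ Nat.card F.ConnectedComponent + s < α ∧
  (∃ X : Finset (Fin N), X.card ≤ 4 * k * s ∧
    ∀ y, ∀ v ∈ c y, v ∈ X ∨ ∃ i, part v = Fin.succ i ∧ F.Reachable i y) ∧
  (∀ i, use part c i ≤ 8 * α * k + 4 * k * s)

theorem card_comp_eq {t : ℕ} {F F' : SimpleGraph (Fin t)} (h : F'.Reachable = F.Reachable) :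
    Nat.card F'.ConnectedComponent = Nat.card F.ConnectedComponent := by
  unfold SimpleGraph.ConnectedComponent
  rw [h]

def Bad (k ℓ : ℕ) {t N : ℕ} (part : Fin N → Fin (t + 1)) (E : Finset (Finset (Fin N)))
    (A : Finset (Fin N)) (i i' : Fin t) : Prop :=
  ∃ (q₁ q₂ : ℕ) (w₁ w₂ : ℕ → Fin N),
            IsPathSeq k ℓ E q₁ w₁ ∧ IsPathSeq k ℓ E q₂ w₂ ∧
            q₁ * (k - ℓ) + ℓ ≤ 2 * k ∧ q₂ * (k - ℓ) + ℓ ≤ 2 * k ∧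
            (∀ p < q₁ * (k - ℓ) + ℓ, w₁ p ∉ A) ∧
            (∀ p < q₂ * (k - ℓ) + ℓ, w₂ p ∉ A) ∧
            Disjoint (seqVerts (q₁ * (k - ℓ) + ℓ) w₁)
              (seqVerts (q₂ * (k - ℓ) + ℓ) w₂) ∧
            PathConnects k ℓ q₁ w₁ (cls part i) (cls part i') ∧
            PathConnects k ℓ q₂ w₂ (cls part i) (cls part i')

theorem stage2 (k ℓ α : ℕ) {t N : ℕ} (part : Fin N → Fin (t + 1)) (E : Finset (Finset (Fin N))) :
    ∀ (n s : ℕ) (F : SimpleGraph (Fin t)) (c : Fin t → Finset (Fin N)),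
      Nat.card F.ConnectedComponent = n → Inv2 k ℓ α s part E F c →
      ∃ s' F' c', Inv2 k ℓ α s' part E F' c' ∧ F'.IsAcyclic ∧
        ∀ i i', ¬ F'.Reachable i i' → ¬ Bad k ℓ part E (Finset.univ.biUnion c') i i' := by
  intro n
  induction n using Nat.strong_induction_on with
  | _ n ih =>
  intro s F0 c0 hn0 hinv0
  -- reduce to a forest
  obtain ⟨F, c, hn, hinv, hac⟩ : ∃ F c, Nat.card (SimpleGraph.ConnectedComponent F) = n ∧
      Inv2 k ℓ α s part E F c ∧ F.IsAcyclic := by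
    obtain ⟨hR, hcc, ⟨X, hX, hXc⟩, hu⟩ := hinv0
    obtain ⟨F, c, hR', hac, hr, hsub⟩ := hR.forest
    have hce := card_comp_eq hr
    refine ⟨F, c, hce.trans hn0, ⟨hR', by rw [hce]; exact hcc, ⟨X, hX, ?_⟩, ?_⟩, hac⟩
    · intro y v hv
      rw [hr]; exact hXc y v (hsub y hv)
    · intro i
      refine le_trans ?_ (hu i)
      have := use_le part c0 c ∅ (fun x v hv => Or.inr ⟨x, hsub x hv⟩) i
      simpa using this
  by_cases hbad : ∃ i i', ¬ F.Reachable i i' ∧ Bad k ℓ part E (Finset.univ.biUnion c) i i'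
  · obtain ⟨i, i', hr, q₁, q₂, w₁, w₂, a1, a2, b1, b2, d1, d2, dd, e1, e2⟩ := hbad
    obtain ⟨hR, hcc, ⟨X, hX, hXc⟩, hu⟩ := hinv
    let S1 := seqVerts (q₁ * (k - ℓ) + ℓ) w₁
    let S2 := seqVerts (q₂ * (k - ℓ) + ℓ) w₂
    have hS1 : S1.card ≤ 2 * k := by
      refine Finset.card_image_le.trans ?_
      rw [Finset.card_range]; exact b1
    have hS2 : S2.card ≤ 2 * k := by
      refine Finset.card_image_le.trans ?_
      rw [Finset.card_range]; exact b2
    have hU : (S1 ∪ S2).card ≤ 4 * k := (Finset.card_union_le _ _).trans (by omega)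
    let S : Fin t → Fin 2 → Finset (Fin N) := fun _ b => if b = 0 then S1 else S2
    have hSU : ∀ j b, S j b ⊆ S1 ∪ S2 := by
      intro j b
      by_cases hb : b = 0
      · simp only [S, hb, if_true]; exact Finset.subset_union_left
      · simp only [S, hb, if_false]; exact Finset.subset_union_right
    have hUd : ∀ v ∈ S1 ∪ S2, v ∉ Finset.univ.biUnion c := by
      intro v hv
      rcases Finset.mem_union.1 hv with h | h
      · simp only [S1, seqVerts, Finset.mem_image, Finset.mem_range] at h
        obtain ⟨p, hp, rfl⟩ := h; exact d1 p hp
      · simp only [S2, seqVerts, Finset.mem_image, Finset.mem_range] at h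
        obtain ⟨p, hp, rfl⟩ := h; exact d2 p hp
    obtain ⟨F', c', hR', hle, hadj, -, hc'⟩ := star hR i {i'}
      (by simpa using hr) S
      (by
        intro j hj b
        rw [Finset.mem_singleton.1 hj]
        by_cases hb : b = 0
        · simp only [S, hb, if_true]; exact ⟨q₁, w₁, a1, b1, e1, subset_rfl⟩
        · simp only [S, hb, if_false]; exact ⟨q₂, w₂, a2, b2, e2, subset_rfl⟩)
      (by
        intro j hj b j' hj' b' hne
        rw [Finset.mem_singleton.1 hj, Finset.mem_singleton.1 hj'] at hne
        have hbb : b ≠ b' := fun h => hne (by rw [h])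
        by_cases hb : b = 0
        · have hb' : b' ≠ 0 := fun h => hbb (hb.trans h.symm)
          simp only [S, hb, hb', if_true, if_false]; exact dd
        · have hb' : b' = 0 := by omega
          simp only [S, hb, hb', if_true, if_false]; exact dd.symm)
      (by
        intro j hj b x
        rw [Finset.disjoint_left]
        intro v hv hvx
        exact hUd v (hSU j b hv) (Finset.mem_biUnion.2 ⟨x, Finset.mem_univ _, hvx⟩))
    have hlt := card_comp_lt hle hr (hadj i' (by simp)).reachable
    have hcU : ∀ x, ∀ v ∈ c' x, v ∈ c x ∨ v ∈ S1 ∪ S2 := by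
      intro x v hv
      rcases hc' x v hv with h | ⟨j, -, -, b, h⟩
      · exact Or.inl h
      · exact Or.inr (hSU j b h)
    refine ih _ (hn ▸ hlt) (s + 1) F' c' rfl ⟨hR', by omega, ⟨X ∪ (S1 ∪ S2), ?_, ?_⟩, ?_⟩
    · refine (Finset.card_union_le _ _).trans ?_
      rw [Nat.mul_add]; omega
    · intro y v hv
      rcases hcU y v hv with h | h
      · rcases hXc y v h with h | ⟨x, hx, hxr⟩
        · exact Or.inl (Finset.mem_union_left _ h)
        · exact Or.inr ⟨x, hx, hxr.mono hle⟩
      · exact Or.inl (Finset.mem_union_right _ h)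
    · intro x
      have h1 := use_le part c c' (S1 ∪ S2) (fun x v hv => by
        rcases hcU x v hv with h | h
        · exact Or.inr ⟨x, h⟩
        · exact Or.inl h) x
      have h2 : ((S1 ∪ S2) ∩ cls part x).card ≤ (S1 ∪ S2).card :=
        Finset.card_le_card Finset.inter_subset_left
      have h3 := hu x
      rw [Nat.mul_add]; omega
  · exact ⟨s, F, c, hinv, hac, fun i i' h hb => hbad ⟨i, i', h, hb⟩⟩

/-- The path-system lemma.  The vertex set of `G = (Fin N, E)` is partitioned by
`part` into classes `V_0, V_1, …, V_t` (class `i.succ` is `V_i` for `i ∈ [t]`),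
where `V_1, …, V_t` are red cliques of size `M`.  If any `α` of the classes,
shrunk to halves `W_i`, are connected by an `ℓ`-path of length `q₀(k,ℓ)`, then
there is a forest `F` on `[t]` with fewer than `α` components and a
`(k,ℓ,F)`-path system `L` (a pair of vertex-disjoint connecting `ℓ`-paths
`w x y b`, `b ∈ Fin 2`, of order at most `2k` for every edge `xy` of `F`)
such that `L` meets every `V_i` in at most `εM` vertices, spills at most `4αk`
vertices out of every component, and such that no two classes in different
components of `F` are connected by two vertex-disjoint `ℓ`-paths of order at
most `2k` avoiding `V(L)`. -/
theorem path_system (k ℓ α : ℕ) (ε : ℝ) (hk : 3 ≤ k) (hℓ : ℓ = 1 ∨ ℓ = k - 1)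
    (hα : 2 ≤ α) (hε₀ : 0 < ε) (hε₁ : ε < 1) :
    ∃ M₀ : ℕ, ∀ M : ℕ, M₀ ≤ M →
    ∀ (t N : ℕ) (part : Fin N → Fin (t + 1)) (E : Finset (Finset (Fin N))),
      (∀ i : Fin t, (Finset.univ.filter (fun v => part v = i.succ)).card = M) →
      (∀ (i : Fin t) (e : Finset (Fin N)), e.card = k →
        (∀ v ∈ e, part v = i.succ) → e ∈ E) →
      (∀ I : Finset (Fin t), I.card = α →
        ∀ W : Fin t → Finset (Fin N),
          (∀ i ∈ I, W i ⊆ Finset.univ.filter (fun v => part v = i.succ) ∧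
            (W i).card = M / 2) →
          ∃ j ∈ I, ∃ j' ∈ I, j ≠ j' ∧ ∃ w : ℕ → Fin N,
            IsPathSeq k ℓ E (qZero k ℓ) w ∧
            (∀ p < qZero k ℓ * (k - ℓ) + ℓ, w p ∈ I.biUnion W) ∧
            PathConnects k ℓ (qZero k ℓ) w (W j) (W j')) →
      ∃ (F : SimpleGraph (Fin t)) (q : Fin t → Fin t → Fin 2 → ℕ)
        (w : Fin t → Fin t → Fin 2 → ℕ → Fin N) (VL : Finset (Fin N)),
        F.IsAcyclic ∧
        Nat.card F.ConnectedComponent < α ∧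
        (∀ x y : Fin t, x < y → F.Adj x y → ∀ b : Fin 2,
          IsPathSeq k ℓ E (q x y b) (w x y b) ∧
          q x y b * (k - ℓ) + ℓ ≤ 2 * k ∧
          PathConnects k ℓ (q x y b) (w x y b)
            (Finset.univ.filter (fun v => part v = x.succ))
            (Finset.univ.filter (fun v => part v = y.succ))) ∧
        (∀ x y x' y' : Fin t, ∀ b b' : Fin 2,
          x < y → F.Adj x y → x' < y' → F.Adj x' y' →
          (x, y, b) ≠ (x', y', b') →
          Disjoint (seqVerts (q x y b * (k - ℓ) + ℓ) (w x y b))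
            (seqVerts (q x' y' b' * (k - ℓ) + ℓ) (w x' y' b'))) ∧
        VL = (Finset.univ : Finset (Fin t × Fin t × Fin 2)).biUnion
          (fun z => if z.1 < z.2.1 ∧ F.Adj z.1 z.2.1 then
            seqVerts (q z.1 z.2.1 z.2.2 * (k - ℓ) + ℓ) (w z.1 z.2.1 z.2.2)
          else ∅) ∧
        (∀ i : Fin t,
          (((VL ∩ Finset.univ.filter (fun v => part v = i.succ)).card : ℕ) : ℝ) ≤
            ε * (M : ℝ)) ∧
        (∀ comp : F.ConnectedComponent,
          ((Finset.univ : Finset (Fin t × Fin t × Fin 2)).biUnion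
              (fun z => if z.1 < z.2.1 ∧ F.Adj z.1 z.2.1 ∧
                  F.connectedComponentMk z.1 = comp then
                seqVerts (q z.1 z.2.1 z.2.2 * (k - ℓ) + ℓ) (w z.1 z.2.1 z.2.2)
              else ∅) \
            Finset.univ.filter (fun v => ∃ i : Fin t,
              part v = i.succ ∧ F.connectedComponentMk i = comp)).card ≤
            4 * α * k) ∧
        (∀ i i' : Fin t, ¬ F.Reachable i i' →
          ¬ ∃ (q₁ q₂ : ℕ) (w₁ w₂ : ℕ → Fin N),
            IsPathSeq k ℓ E q₁ w₁ ∧ IsPathSeq k ℓ E q₂ w₂ ∧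
            q₁ * (k - ℓ) + ℓ ≤ 2 * k ∧ q₂ * (k - ℓ) + ℓ ≤ 2 * k ∧
            (∀ p < q₁ * (k - ℓ) + ℓ, w₁ p ∉ VL) ∧
            (∀ p < q₂ * (k - ℓ) + ℓ, w₂ p ∉ VL) ∧
            Disjoint (seqVerts (q₁ * (k - ℓ) + ℓ) w₁)
              (seqVerts (q₂ * (k - ℓ) + ℓ) w₂) ∧
            PathConnects k ℓ q₁ w₁
              (Finset.univ.filter (fun v => part v = i.succ))
              (Finset.univ.filter (fun v => part v = i'.succ)) ∧
            PathConnects k ℓ q₂ w₂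
              (Finset.univ.filter (fun v => part v = i.succ))
              (Finset.univ.filter (fun v => part v = i'.succ))) := by

  set K := 2 * (4 * α * k + (2 ^ α * (2 * α) + 1) * (2 * k)) + 2 with hK
  refine ⟨max K ⌈(12 * α * k : ℝ) / ε⌉₊, ?_⟩
  intro M hM t N part E hcard _ H
  have hM1 : K ≤ M := (le_max_left _ _).trans hM
  have hM2 : (12 * α * k : ℝ) ≤ ε * M := by
    have h1 : ((12 * α * k : ℝ) / ε) ≤ M :=
      (Nat.le_ceil _).trans (by exact_mod_cast (le_max_right _ _).trans hM)
    rw [div_le_iff₀ hε₀] at h1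
    linarith
  have stage1 : ∀ (n : ℕ) (F : SimpleGraph (Fin t)) (c : Fin t → Finset (Fin N)),
      Nat.card F.ConnectedComponent = n → Inv1 k ℓ (4 * α * k) part E F c →
      ∃ F' c', Inv1 k ℓ (4 * α * k) part E F' c' ∧
        Nat.card (SimpleGraph.ConnectedComponent F') < α := by
    intro n
    induction n using Nat.strong_induction_on with
    | _ n ih =>
    intro F c hn hinv
    by_cases h : Nat.card F.ConnectedComponent < α
    · exact ⟨F, c, hinv, h⟩
    · obtain ⟨F', c', h1, h2⟩ := step1 k ℓ α M hk hℓ hM1 part E hcard H F c hinv (by omega)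
      exact ih _ (hn ▸ h2) F' c' rfl h1
  have hN : t = 0 ∨ Nonempty (Fin N) := by
    rcases Nat.eq_zero_or_pos t with h | h
    · exact Or.inl h
    · right
      have h1 := hcard ⟨0, h⟩
      obtain ⟨v, -⟩ := Finset.card_pos.1 (by rw [h1]; omega)
      exact ⟨v⟩
  obtain ⟨w0⟩ : Nonempty (Fin t → Fin t → Fin 2 → ℕ → Fin N) := by
    rcases hN with rfl | ⟨⟨v⟩⟩
    · exact ⟨fun x => x.elim0⟩
    · exact ⟨fun _ _ _ _ => v⟩
  have hinit : Inv1 k ℓ (4 * α * k) part E (⊥ : SimpleGraph (Fin t)) (fun _ => ∅) := by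
    have hz : ∀ i, use part (fun _ : Fin t => (∅ : Finset (Fin N))) i = 0 := by
      intro i
      unfold use
      rw [Finset.card_eq_zero, Finset.eq_empty_iff_forall_notMem]
      intro v hv
      obtain ⟨x, -, hx⟩ := Finset.mem_biUnion.1 (Finset.mem_inter.1 hv).1
      exact absurd hx (Finset.notMem_empty v)
    refine ⟨⟨fun _ _ _ => 0, w0, by simp, by simp, by simp⟩, by simp, ?_, ?_⟩
    · intro i; rw [hz]; omega
    · intro i
      refine Or.inl ⟨hz i, fun j hj => ?_⟩
      exact (SimpleGraph.reachable_bot.1 hj).symm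
  obtain ⟨F1, c1, ⟨g1, g2, g3, -⟩, hcc⟩ := stage1 _ _ _ rfl hinit
  obtain ⟨s, F, c, ⟨⟨q, w, r1, r2, r3⟩, hs, ⟨X, hX, hXc⟩, hu⟩, hac, hd⟩ :=
    stage2 k ℓ α part E _ 0 F1 c1 rfl ⟨g1, by omega, ⟨∅, by simp, fun y v hv => Or.inr (g2 y v hv)⟩,
      fun i => (g3 i).trans (by nlinarith)⟩
  have hVL : (Finset.univ : Finset (Fin t × Fin t × Fin 2)).biUnion
          (fun z => if z.1 < z.2.1 ∧ F.Adj z.1 z.2.1 then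
            seqVerts (q z.1 z.2.1 z.2.2 * (k - ℓ) + ℓ) (w z.1 z.2.1 z.2.2)
          else ∅) = Finset.univ.biUnion c := by
    ext v
    simp only [Finset.mem_biUnion, Finset.mem_univ, true_and]
    constructor
    · rintro ⟨⟨x, y, b⟩, hv⟩
      split_ifs at hv with h
      · exact ⟨x, (r3 x v).2 ⟨y, b, h.1, h.2, hv⟩⟩
      · simp at hv
    · rintro ⟨x, hv⟩
      obtain ⟨y, b, h1, h2, h3⟩ := (r3 x v).1 hv
      refine ⟨(x, y, b), ?_⟩
      rw [if_pos ⟨h1, h2⟩]; exact h3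
  have hsk : 4 * k * s ≤ 4 * α * k := by nlinarith
  refine ⟨F, q, w, _, hac, by omega, r1, r2, hVL.symm, ?_, ?_, hd⟩
  · intro i
    refine le_trans ?_ hM2
    have h1 := hu i
    have h2 : use part c i ≤ 12 * α * k := by nlinarith
    exact_mod_cast h2
  · intro comp
    refine le_trans (Finset.card_le_card ?_) (hX.trans hsk)
    intro v hv
    simp only [Finset.mem_sdiff, Finset.mem_biUnion, Finset.mem_univ, true_and,
      Finset.mem_filter] at hv
    obtain ⟨⟨⟨x, y, b⟩, hv⟩, hn⟩ := hv
    split_ifs at hv with h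
    · rcases hXc x v ((r3 x v).2 ⟨y, b, h.1, h.2.1, hv⟩) with h' | ⟨i, hi, hr⟩
      · exact h'
      · exact absurd ⟨i, hi, (SimpleGraph.ConnectedComponent.sound hr).trans h.2.2⟩ hn
    · simp at hv
end
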